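/- arXiv:2109.05555 — 5 statements merged into one kernel-verified Lean document; each statement's English description precedes it below -/
import Mathlib

section
/- Let P be a Poisson ring which is an integral domain of characteristic zero, let n ≥ 1 be an integer and let A, B ∈ P. If q_n(A^m, B; B^n) = 0 for every integer m ≥ n, then ⁅A, B⁆ = 0. -/
/-- The iterated Poisson-bracket expressions `q_i(X, Y; Z)` of the paper, for a
commutative ring equipped with a bracket `br`:
`q₁(X,Y;Z) = ⁅Z,X⁆` and `q_i(X,Y;Z) = ⁅q_{i-1}(X,Y;Z), q_{i-1}(X,Y;Y^{i-1})⁆`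
for `i ≥ 2`. -/
def qIter {P : Type*} [CommRing P] (br : P → P → P) (X Y : P) : ℕ → P → P
  | 0, Z => Z
  | 1, Z => br Z X
  | (i + 2), Z => br (qIter br X Y (i + 1) Z) (qIter br X Y (i + 1) (Y ^ (i + 1)))

open Polynomial

/-- The sequence `F` is given by a polynomial of degree at most `d` whose coefficient in
degree `d` is `v`. -/
def IsPolySeq {P : Type*} [CommRing P] (d : ℕ) (v : P) (F : ℕ → P) : Prop :=
  ∃ p : P[X], p.natDegree ≤ d ∧ p.coeff d = v ∧ ∀ t : ℕ, F t = p.eval (t : P)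

namespace IsPolySeq

variable {P : Type*} [CommRing P] {d e k : ℕ} {v w : P} {F G : ℕ → P}

theorem const (v : P) : IsPolySeq 0 v (fun _ => v) :=
  ⟨C v, by simp, by simp, by simp⟩

theorem linear (a b : P) : IsPolySeq 1 a (fun t => a * t + b) :=
  ⟨C a * X + C b, natDegree_linear_le, by simp, by simp⟩

theorem monomial (k : ℕ) : IsPolySeq k 1 (fun t => (t : P) ^ k) :=
  ⟨X ^ k, natDegree_X_pow_le k, by simp, by simp⟩

theorem mono (hF : IsPolySeq d v F) (h : d < e) : IsPolySeq e 0 F := by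
  obtain ⟨p, hp, -, hpF⟩ := hF
  exact ⟨p, by lia, coeff_eq_zero_of_natDegree_lt (by lia), hpF⟩

theorem zero (d : ℕ) : IsPolySeq d (0 : P) (fun _ => 0) := ⟨0, by simp, by simp, by simp⟩

theorem add (hF : IsPolySeq d v F) (hG : IsPolySeq d w G) :
    IsPolySeq d (v + w) (fun t => F t + G t) := by
  obtain ⟨p, hp, rfl, hpF⟩ := hF
  obtain ⟨q, hq, rfl, hqG⟩ := hG
  exact ⟨p + q, natDegree_add_le_of_degree_le hp hq, by simp, by simp [hpF, hqG]⟩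

theorem sub (hF : IsPolySeq d v F) (hG : IsPolySeq d w G) :
    IsPolySeq d (v - w) (fun t => F t - G t) := by
  obtain ⟨p, hp, rfl, hpF⟩ := hF
  obtain ⟨q, hq, rfl, hqG⟩ := hG
  exact ⟨p - q, natDegree_sub_le_of_le hp hq |>.trans (by simp), by simp, by simp [hpF, hqG]⟩

theorem mul (hF : IsPolySeq d v F) (hG : IsPolySeq e w G) :
    IsPolySeq (d + e) (v * w) (fun t => F t * G t) := by
  obtain ⟨p, hp, rfl, hpF⟩ := hF
  obtain ⟨q, hq, rfl, hqG⟩ := hG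
  exact ⟨p * q, natDegree_mul_le_of_le hp hq, coeff_mul_add_eq_of_natDegree_le hp hq,
    by simp [hpF, hqG]⟩

theorem sum {ι : Type*} (s : Finset ι) (v : ι → P) (F : ι → ℕ → P)
    (h : ∀ i ∈ s, IsPolySeq d (v i) (F i)) :
    IsPolySeq d (∑ i ∈ s, v i) (fun t => ∑ i ∈ s, F i t) := by
  classical
  induction s using Finset.induction_on with
  | empty => simpa using zero d
  | insert a s ha ih =>
    simp only [Finset.sum_insert ha]
    exact (h a (by simp)).add (ih fun i hi => h i (by simp [hi]))

theorem exists_eq_sum (hF : IsPolySeq d v F) :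
    ∃ a : ℕ → P, a d = v ∧ ∀ t : ℕ, F t = ∑ i ∈ Finset.range (d + 1), a i * (t : P) ^ i := by
  obtain ⟨p, hp, rfl, hpF⟩ := hF
  exact ⟨p.coeff, rfl, fun t => by rw [hpF, eval_eq_sum_range' (Nat.lt_succ_of_le hp)]⟩

theorem derivation (D : Derivation ℤ P P) (hF : IsPolySeq d v F) :
    IsPolySeq d (D v) (fun t => D (F t)) := by
  obtain ⟨a, rfl, ha⟩ := hF.exists_eq_sum
  have hD : ∀ t, D (F t) = ∑ i ∈ Finset.range (d + 1), D (a i) * (t : P) ^ i := by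
    intro t
    rw [ha, map_sum]
    refine Finset.sum_congr rfl fun i _ => ?_
    rw [Derivation.leibniz, Derivation.leibniz_pow]
    simp [mul_comm]
  simp only [hD, Finset.sum_range_succ]
  have hlow := sum (Finset.range d) (fun _ => 0) (fun i t => D (a i) * (t : P) ^ i)
    (d := d) fun i hi =>
      ((const (D (a i))).mul (monomial i)).mono (by simpa using Finset.mem_range.1 hi)
  simpa using hlow.add (by simpa using (const (D (a d))).mul (monomial d))

theorem bracket (β : P → Derivation ℤ P P) (hβ : ∀ a b, β a b = -β b a)
    (hF : IsPolySeq d v F) (hG : IsPolySeq e w G) (h : d + e < k) :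
    IsPolySeq k 0 (fun t => β (F t) (G t)) := by
  obtain ⟨a, rfl, ha⟩ := hF.exists_eq_sum
  have hB : ∀ t, β (F t) (G t) =
      ∑ i ∈ Finset.range (d + 1), β (a i) (G t) * (t : P) ^ i := by
    intro t
    rw [hβ, ha, map_sum, ← Finset.sum_neg_distrib]
    refine Finset.sum_congr rfl fun i _ => ?_
    rw [Derivation.leibniz, Derivation.leibniz_pow, hβ (a i)]
    simp [mul_comm]
  simp only [hB]
  simpa using sum (Finset.range (d + 1)) (fun _ => 0) (fun i t => β (a i) (G t) * (t : P) ^ i)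
    (d := k) fun i hi =>
      ((hG.derivation (β (a i))).mul (monomial i)).mono (by have := Finset.mem_range.1 hi; lia)

theorem eq_zero_of_eventually_eq_zero [IsDomain P] [CharZero P] (hF : IsPolySeq d v F) (n : ℕ)
    (h : ∀ t, n ≤ t → F t = 0) : v = 0 := by
  obtain ⟨p, -, rfl, hp⟩ := hF
  have : p = 0 := by
    refine eq_zero_of_infinite_isRoot p (Set.Infinite.mono ?_
      ((Set.Ici_infinite n).image (Nat.cast_injective (R := P)).injOn))
    rintro _ ⟨t, ht, rfl⟩
    rw [Set.mem_ofPred_eq, IsRoot.def, ← hp, h t ht]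
  simp [this]

end IsPolySeq

section Bracket

variable {P : Type*} [CommRing P]

theorem bracket_pow_mul_pow_mul (β : P → Derivation ℤ P P) (hβ : ∀ a b, β a b = -β b a)
    (hself : ∀ a, β a a = 0) (A f g : P) (s : ℕ) :
    β (A ^ (s + 1) * f) (A ^ (s + 1) * g) =
      A ^ (2 * s + 1) * (A * β f g + (s + 1) * (f * β A g - g * β A f)) := by
  have h1 : ∀ x, β x (A ^ (s + 1)) = -((s + 1) * A ^ s * β A x) := by
    intro x
    rw [Derivation.leibniz_pow, hβ x A]
    simp [mul_assoc]
  have h2 : β (A ^ (s + 1) * f) g = A ^ (s + 1) * β f g + f * ((s + 1) * A ^ s * β A g) := by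
    rw [hβ, Derivation.leibniz, h1, hβ g f]
    simp only [smul_eq_mul]
    ring
  have h3 : β A (A ^ (s + 1) * f) = A ^ (s + 1) * β A f := by
    rw [Derivation.leibniz, Derivation.leibniz_pow, hself]
    simp
  rw [Derivation.leibniz, h1, h2, h3]
  simp only [smul_eq_mul]
  ring

theorem wronskian_leading_terms (D : Derivation ℤ P P) (B : P) (K N i j : ℕ) :
    (K * i.descFactorial i * B ^ (i - i) * D B ^ N) *
        D (K * j.descFactorial i * B ^ (j - i) * D B ^ N) -
      (K * j.descFactorial i * B ^ (j - i) * D B ^ N) *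
        D (K * i.descFactorial i * B ^ (i - i) * D B ^ N) =
    ((K * K * i.factorial : ℕ) : P) * j.descFactorial (i + 1) * B ^ (j - (i + 1)) *
      D B ^ (2 * N + 1) := by
  have hC : ∀ (a b : ℕ) (x : P), D (a * b * x) = a * b * D x := by
    intro a b x
    rw [Derivation.leibniz, Derivation.leibniz]
    simp
  simp only [mul_assoc _ (B ^ _), hC]
  rw [Derivation.leibniz, Derivation.leibniz_pow D (a := B), Nat.descFactorial_self,
    Nat.descFactorial_succ, Nat.sub_sub]
  simp only [Nat.sub_self, pow_zero, one_mul, smul_eq_mul, nsmul_eq_mul]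
  push_cast
  ring

end Bracket

theorem exists_isPolySeq_qIter {P : Type*} [CommRing P] (β : P → Derivation ℤ P P)
    (hβ : ∀ a b, β a b = -β b a) (hself : ∀ a, β a a = 0) (A B : P) (i : ℕ) :
    ∃ d c N K : ℕ, 0 < c ∧ 0 < K ∧ ∀ j : ℕ, ∃ F : ℕ → P,
      IsPolySeq d (K * j.descFactorial (i + 1) * B ^ (j - (i + 1)) * (-β A B) ^ N) F ∧
      ∀ t, qIter (fun a b => β a b) (A ^ (t + 2)) B (i + 1) (B ^ j) = A ^ (c * t + 1) * F t := by
  set D : Derivation ℤ P P := -β A with hD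
  have hDB : -β A B = D B := rfl
  rw [hDB]
  induction i with
  | zero =>
    refine ⟨1, 1, 1, 1, one_pos, one_pos, fun j => ⟨_,
      .linear _ (2 * (j * B ^ (j - 1) * D B)), fun t => ?_⟩⟩
    have hpow : β A (B ^ j) = j * B ^ (j - 1) * β A B := by
      rw [Derivation.leibniz_pow]
      simp [mul_assoc]
    simp only [qIter, ← hDB]
    rw [Derivation.leibniz_pow, hβ _ A, hpow]
    simp
    ring
  | succ i ih =>
    obtain ⟨d, c, N, K, hc, hK, ih⟩ := ih
    obtain ⟨G, hG, hqG⟩ := ih (i + 1)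
    refine ⟨2 * d + 1, 2 * c, 2 * N + 1, c * (K * K * (i + 1).factorial), by positivity,
      by positivity, fun j => ?_⟩
    obtain ⟨F, hF, hqF⟩ := ih j
    refine ⟨fun t => A * β (F t) (G t) + (c * t + 1) * (G t * D (F t) - F t * D (G t)), ?_, ?_⟩
    · have h1 : IsPolySeq (2 * d + 1) 0 (fun t => A * β (F t) (G t)) := by
        simpa using (IsPolySeq.const A).mul (hF.bracket β hβ hG (k := 2 * d + 1) (by lia))
      have h2 := (IsPolySeq.linear (c : P) 1).mul
        ((hG.mul (hF.derivation D)).sub (hF.mul (hG.derivation D)))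
      rw [wronskian_leading_terms, show 1 + (d + d) = 2 * d + 1 by ring] at h2
      convert h1.add h2 using 1
      push_cast
      ring
    · intro t
      simp only [qIter]
      rw [hqF, hqG, bracket_pow_mul_pow_mul β hβ hself]
      simp only [hD, Derivation.neg_apply]
      push_cast
      ring

theorem bracket_eq_zero_of_qIter_eq_zero {P : Type*} [CommRing P] [IsDomain P] [CharZero P]
    (β : P → Derivation ℤ P P) (hβ : ∀ a b, β a b = -β b a) (hself : ∀ a, β a a = 0)
    (n : ℕ) (hn : 1 ≤ n) (A B : P)
    (h : ∀ m : ℕ, n ≤ m → qIter (fun a b => β a b) (A ^ m) B n (B ^ n) = 0) :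
    β A B = 0 := by
  rcases eq_or_ne A 0 with rfl | hA
  · rw [hβ, map_zero, neg_zero]
  obtain ⟨i, rfl⟩ := Nat.exists_eq_add_of_le' hn
  obtain ⟨d, c, N, K, -, hK, hq⟩ := exists_isPolySeq_qIter β hβ hself A B i
  obtain ⟨F, hF, hqF⟩ := hq (i + 1)
  have h0 := hF.eq_zero_of_eventually_eq_zero (i + 1) fun t ht => by
    have := hqF t
    rw [h _ (by lia)] at this
    exact (mul_eq_zero.1 this.symm).resolve_left (pow_ne_zero _ hA)
  rw [Nat.descFactorial_self, Nat.sub_self, pow_zero, mul_one] at h0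
  have hcoeff : (K : P) * (i + 1).factorial ≠ 0 :=
    mul_ne_zero (by exact_mod_cast hK.ne') (by exact_mod_cast (Nat.factorial_pos _).ne')
  exact neg_eq_zero.1 (eq_zero_of_pow_eq_zero ((mul_eq_zero.1 h0).resolve_left hcoeff))

/-- Let `P` be a Poisson ring (a commutative ring with a biadditive alternating bracket
satisfying the Jacobi identity in Leibniz form and the Leibniz rule) which is an integral
domain of characteristic zero, `n ≥ 1` and `A, B ∈ P`.  If `q_n(A^m, B; B^n) = 0` for
every integer `m ≥ n`, then `⁅A, B⁆ = 0`. -/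
theorem stmt12 (P : Type*) [CommRing P] [IsDomain P] [CharZero P] (br : P → P → P)
    (hadd_left : ∀ a b c : P, br (a + b) c = br a c + br b c)
    (hadd_right : ∀ a b c : P, br a (b + c) = br a b + br a c)
    (halt : ∀ a : P, br a a = 0)
    (hjacobi : ∀ a b c : P, br a (br b c) = br (br a b) c + br b (br a c))
    (hleibniz : ∀ a b c : P, br a (b * c) = br a b * c + b * br a c)
    (n : ℕ) (hn : 1 ≤ n) (A B : P)
    (h : ∀ m : ℕ, n ≤ m → qIter br (A ^ m) B n (B ^ n) = 0) :
    br A B = 0 := by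
  have hanti : ∀ a b, br a b = -br b a := by
    intro a b
    have := halt (a + b)
    rw [hadd_left, hadd_right, hadd_right, halt, halt] at this
    linear_combination this
  exact bracket_eq_zero_of_qIter_eq_zero
    (fun a => Derivation.mk' (AddMonoidHom.mk' (br a) (hadd_right a)).toIntLinearMap
      fun b c => (hleibniz a b c).trans (by simp; ring)) hanti halt n hn A B h
end

section
/- Let R be an associative unital algebra over a commutative ring k, let n ≥ 1, and let b ∈ R satisfy a monic polynomial relation b^n + c_{n−1}b^{n−1} + ⋯ + c₁b + c₀·1 = 0 with coefficients c₀, …, c_{n−1} ∈ k. Then p_n(a, b; b^n) = 0 for every a ∈ R. -/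
/-- The iterated commutator expressions `p_i(X, Y; Z)` of the paper:
`p₁(X,Y;Z) = [Z,X] = ZX - XZ` and
`p_i(X,Y;Z) = [p_{i-1}(X,Y;Z), p_{i-1}(X,Y;Y^{i-1})]` for `i ≥ 2`. -/
def pComm {R : Type*} [Ring R] (X Y : R) : ℕ → R → R
  | 0, Z => Z
  | 1, Z => Z * X - X * Z
  | (i + 2), Z =>
      pComm X Y (i + 1) Z * pComm X Y (i + 1) (Y ^ (i + 1)) -
        pComm X Y (i + 1) (Y ^ (i + 1)) * pComm X Y (i + 1) Z

theorem pComm_succ_succ {R : Type*} [Ring R] (X Y : R) (i : ℕ) (Z : R) :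
    pComm X Y (i + 2) Z =
      pComm X Y (i + 1) Z * pComm X Y (i + 1) (Y ^ (i + 1)) -
        pComm X Y (i + 1) (Y ^ (i + 1)) * pComm X Y (i + 1) Z :=
  rfl

theorem pComm_add {R : Type*} [Ring R] (X Y : R) (i : ℕ) (Z W : R) :
    pComm X Y (i + 1) (Z + W) = pComm X Y (i + 1) Z + pComm X Y (i + 1) W := by
  induction i with
  | zero => simp only [pComm]; noncomm_ring
  | succ i ih => rw [pComm_succ_succ, pComm_succ_succ, pComm_succ_succ, ih]; noncomm_ring

theorem pComm_smul {k R : Type*} [CommRing k] [Ring R] [Algebra k R] (X Y : R) (i : ℕ)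
    (r : k) (Z : R) : pComm X Y (i + 1) (r • Z) = r • pComm X Y (i + 1) Z := by
  induction i with
  | zero => simp only [pComm, smul_mul_assoc, mul_smul_comm, smul_sub]
  | succ i ih =>
    rw [pComm_succ_succ, pComm_succ_succ, ih, smul_mul_assoc, mul_smul_comm, smul_sub]

/-- `pComm X Y (i + 1)` as a linear map in its last argument. -/
def pCommLinear (k : Type*) {R : Type*} [CommRing k] [Ring R] [Algebra k R] (X Y : R) (i : ℕ) :
    R →ₗ[k] R where
  toFun := pComm X Y (i + 1)
  map_add' := pComm_add X Y i
  map_smul' := pComm_smul X Y i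

theorem pComm_pow_eq_zero {R : Type*} [Ring R] (X Y : R) {i j : ℕ} (hj : j < i + 1) :
    pComm X Y (i + 1) (Y ^ j) = 0 := by
  induction i with
  | zero =>
    obtain rfl : j = 0 := by omega
    simp [pComm]
  | succ i ih =>
    rw [pComm_succ_succ]
    rcases Nat.lt_succ_iff_lt_or_eq.mp hj with h | rfl
    · simp [ih h]
    · exact sub_self _

/-- Let `R` be an associative unital algebra over a commutative ring `k`, `n ≥ 1`, and
`b ∈ R` satisfying a monic relation `b^n + c_{n-1}b^{n-1} + ⋯ + c₁b + c₀·1 = 0` with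
coefficients in `k`.  Then `p_n(a, b; b^n) = 0` for every `a ∈ R`. -/
theorem stmt13 (k : Type*) [CommRing k] (R : Type*) [Ring R] [Algebra k R]
    (n : ℕ) (hn : 1 ≤ n) (b : R) (c : Fin n → k)
    (hb : b ^ n + ∑ i : Fin n, c i • b ^ (i : ℕ) = 0) :
    ∀ a : R, pComm a b n (b ^ n) = 0 := by
  intro a
  obtain ⟨m, rfl⟩ := Nat.exists_eq_add_of_le' hn
  rw [eq_neg_of_add_eq_zero_left hb]
  change pCommLinear k a b m _ = 0
  rw [map_neg, map_sum, neg_eq_zero]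
  refine Finset.sum_eq_zero fun i _ => ?_
  rw [map_smul]
  change c i • pComm a b (m + 1) (b ^ (i : ℕ)) = 0
  rw [pComm_pow_eq_zero a b i.isLt, smul_zero]
end

section
/- Let g be a finite-dimensional reductive Lie algebra over ℂ (i.e. the radical of g equals its center), let U(g) be its universal enveloping algebra and Z the center of U(g). Let I be a proper two-sided ideal of U(g) such that I ∩ Z has finite codimension in Z (the image of Z in U(g)/I is finite dimensional over ℂ). Then there exist finitely many primitive two-sided ideals J₁, …, J_n of U(g) — each the annihilator of some simple U(g)-module — such that I ⊆ J_k for every k and J₁J₂⋯J_n ⊆ I (every product x₁x₂⋯x_n with x_k ∈ J_k lies in I). -/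
set_option linter.unusedSectionVars false

namespace CasimirBound

open Module LieModule

section Casimir

variable {s : Type*} [LieRing s] [LieAlgebra ℂ s] [FiniteDimensional ℂ s]
  [LieAlgebra.IsKilling ℂ s]

variable (s) in
/-- A basis of `s`. -/
noncomputable def bas : Basis (Fin (finrank ℂ s)) ℂ s := finBasis ℂ s

variable (s) in
/-- The basis of `s` dual to `bas s` for the Killing form. -/
noncomputable def dbas : Basis (Fin (finrank ℂ s)) ℂ s :=
  (killingForm ℂ s).dualBasis (LieAlgebra.IsKilling.killingForm_nondegenerate ℂ s) (bas s)

lemma killingForm_dbas_bas (i j : Fin (finrank ℂ s)) :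
    killingForm ℂ s (dbas s i) (bas s j) = if j = i then 1 else 0 :=
  LinearMap.BilinForm.apply_dualBasis_left ..

lemma killingForm_symm (x y : s) : killingForm ℂ s x y = killingForm ℂ s y x :=
  LieModule.traceForm_comm ℂ s s x y

lemma killingForm_lie (x y z : s) :
    killingForm ℂ s ⁅x, y⁆ z = killingForm ℂ s x ⁅y, z⁆ :=
  LieModule.traceForm_apply_lie_apply ℂ s s x y z

lemma bas_repr (z : s) (i : Fin (finrank ℂ s)) :
    (bas s).repr z i = killingForm ℂ s (dbas s i) z := by
  have h : killingForm ℂ s (dbas s i) (∑ j, (bas s).repr z j • bas s j) = (bas s).repr z i := by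
    simp only [map_sum, map_smul, killingForm_dbas_bas, smul_eq_mul, mul_ite, mul_one, mul_zero,
      Finset.sum_ite_eq', Finset.mem_univ, if_true]
  rw [← h, (bas s).sum_repr]

lemma dbas_repr (z : s) (i : Fin (finrank ℂ s)) :
    (dbas s).repr z i = killingForm ℂ s z (bas s i) := by
  have h : killingForm ℂ s (∑ j, (dbas s).repr z j • dbas s j) (bas s i) =
      (dbas s).repr z i := by
    simp only [map_sum, map_smul, LinearMap.sum_apply, LinearMap.smul_apply,
      killingForm_dbas_bas, smul_eq_mul, mul_ite, mul_one, mul_zero,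
      Finset.sum_ite_eq, Finset.mem_univ, if_true]
  rw [← h, (dbas s).sum_repr]

lemma sum_killingForm_smul_bas (z : s) :
    ∑ i, killingForm ℂ s (dbas s i) z • bas s i = z := by
  simp_rw [← bas_repr]
  exact (bas s).sum_repr z

lemma sum_killingForm_smul_dbas (z : s) :
    ∑ i, killingForm ℂ s z (bas s i) • dbas s i = z := by
  simp_rw [← dbas_repr]
  exact (dbas s).sum_repr z

/-- Any pair of families dual with respect to the Killing form gives the same contraction. -/
lemma sum_dual_families {ι : Type*} [Fintype ι] (x y : ι → s)
    (h : ∀ z, ∑ i, killingForm ℂ s (y i) z • x i = z)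
    {E : Type*} [AddCommGroup E] [Module ℂ E] (B : s →ₗ[ℂ] s →ₗ[ℂ] E) :
    ∑ i, B (x i) (y i) = ∑ j, B (bas s j) (dbas s j) := by
  have h1 : ∀ i, B (x i) (y i) =
      ∑ j, B (killingForm ℂ s (y i) (bas s j) • x i) (dbas s j) := by
    intro i
    conv_lhs => rw [← sum_killingForm_smul_dbas (y i)]
    simp
  simp_rw [h1]
  rw [Finset.sum_comm]
  refine Finset.sum_congr rfl fun j _ => ?_
  conv_rhs => rw [← h (bas s j)]
  simp [LinearMap.sum_apply]

lemma sum_swap {E : Type*} [AddCommGroup E] [Module ℂ E] (B : s →ₗ[ℂ] s →ₗ[ℂ] E) :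
    ∑ i, B (dbas s i) (bas s i) = ∑ j, B (bas s j) (dbas s j) := by
  apply sum_dual_families (fun i => dbas s i) (fun i => bas s i)
  intro z
  simp_rw [killingForm_symm (bas s _) z]
  exact sum_killingForm_smul_dbas z

/-- The Casimir tensor is invariant. -/
lemma sum_lie_casimir {E : Type*} [AddCommGroup E] [Module ℂ E] (B : s →ₗ[ℂ] s →ₗ[ℂ] E) (z : s) :
    ∑ i, (B ⁅z, bas s i⁆ (dbas s i) + B (bas s i) ⁅z, dbas s i⁆) = 0 := by
  rw [Finset.sum_add_distrib]
  have h1 : ∀ i, B ⁅z, bas s i⁆ (dbas s i) =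
      ∑ j, killingForm ℂ s (dbas s j) ⁅z, bas s i⁆ • B (bas s j) (dbas s i) := by
    intro i
    conv_lhs => rw [← sum_killingForm_smul_bas ⁅z, bas s i⁆]
    simp [LinearMap.sum_apply]
  have h2 : ∀ j, B (bas s j) ⁅z, dbas s j⁆ =
      ∑ i, killingForm ℂ s ⁅z, dbas s j⁆ (bas s i) • B (bas s j) (dbas s i) := by
    intro i
    conv_lhs => rw [← sum_killingForm_smul_dbas ⁅z, dbas s i⁆]
    simp
  simp_rw [h1, h2]
  rw [Finset.sum_comm, ← Finset.sum_add_distrib]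
  refine Finset.sum_eq_zero fun j _ => ?_
  rw [← Finset.sum_add_distrib]
  refine Finset.sum_eq_zero fun i _ => ?_
  rw [← add_smul, ← lie_skew z (dbas s j), map_neg, LinearMap.neg_apply, killingForm_lie,
    add_neg_cancel, zero_smul]

variable (s) (M : Type*) [AddCommGroup M] [Module ℂ M] [LieRingModule s M] [LieModule ℂ s M]

/-- The bilinear map `(x, y) ↦ (m ↦ x (y m))`. -/
noncomputable def actMul : s →ₗ[ℂ] s →ₗ[ℂ] Module.End ℂ M :=
  (LinearMap.mul ℂ (Module.End ℂ M)).compl₁₂ (toEnd ℂ s M : s →ₗ[ℂ] Module.End ℂ M)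
    (toEnd ℂ s M : s →ₗ[ℂ] Module.End ℂ M)

variable {M} in
@[simp] lemma actMul_apply (x y : s) (m : M) : actMul s M x y m = ⁅x, ⁅y, m⁆⁆ := rfl

/-- The Casimir operator of the Killing form. -/
noncomputable def casimir : M →ₗ⁅ℂ, s⁆ M where
  toLinearMap := ∑ i, actMul s M (bas s i) (dbas s i)
  map_lie' := by
    intro z m
    have h := congrArg (fun φ : Module.End ℂ M => φ m) (sum_lie_casimir (actMul s M) z)
    simp only [LinearMap.sum_apply, LinearMap.add_apply, actMul_apply, LinearMap.zero_apply] at h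
    change (∑ i, actMul s M (bas s i) (dbas s i)) ⁅z, m⁆ =
      ⁅z, (∑ i, actMul s M (bas s i) (dbas s i)) m⁆
    simp only [LinearMap.sum_apply, actMul_apply, lie_sum]
    rw [← sub_eq_zero, ← neg_eq_zero, ← h, ← Finset.sum_sub_distrib, ← Finset.sum_neg_distrib]
    refine Finset.sum_congr rfl fun i _ => ?_
    simp only [lie_lie, lie_sub]
    abel

variable {M}

lemma casimir_apply (m : M) : casimir s M m = ∑ i, ⁅bas s i, ⁅dbas s i, m⁆⁆ := by
  change (∑ i, actMul s M (bas s i) (dbas s i)) m = _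
  simp [LinearMap.sum_apply]

lemma casimir_apply_of_dual {ι : Type*} [Fintype ι] (x y : ι → s)
    (h : ∀ z, ∑ i, killingForm ℂ s (y i) z • x i = z) (m : M) :
    casimir s M m = ∑ i, ⁅x i, ⁅y i, m⁆⁆ := by
  have := congrArg (fun φ : Module.End ℂ M => φ m) (sum_dual_families x y h (actMul s M))
  simp only [LinearMap.sum_apply, actMul_apply] at this
  rw [casimir_apply, this]

variable {N : Type*} [AddCommGroup N] [Module ℂ N] [LieRingModule s N] [LieModule ℂ s N]

lemma map_casimir (φ : M →ₗ⁅ℂ, s⁆ N) (m : M) : φ (casimir s M m) = casimir s N (φ m) := by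
  simp [casimir_apply]

lemma casimir_coe (P : LieSubmodule ℂ s M) (m : P) :
    (casimir s P m : M) = casimir s M m := map_casimir s P.incl m

/-- The Casimir operator of the Killing form acts on the adjoint module as the identity. -/
lemma casimir_adjoint (z : s) : casimir s s z = z := by
  have key : ∀ w, killingForm ℂ s (casimir s s z) w = killingForm ℂ s z w := by
    intro w
    rw [casimir_apply, map_sum, LinearMap.sum_apply, killingForm_apply_apply ℂ s z w,
      LinearMap.trace_eq_matrix_trace ℂ (bas s), Matrix.trace]
    refine Finset.sum_congr rfl fun i _ => ?_
    rw [Matrix.diag_apply, LinearMap.toMatrix_apply, bas_repr, ← lie_skew, map_neg,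
      LinearMap.neg_apply,
      killingForm_lie, killingForm_lie]
    simp only [LinearMap.comp_apply, LieAlgebra.ad_apply]
    rw [← lie_skew (bas s i) w, lie_neg, map_neg, neg_neg]
  have := LieAlgebra.IsKilling.killingForm_nondegenerate ℂ s
  rw [← sub_eq_zero]
  apply this.1
  intro w
  rw [map_sub, LinearMap.sub_apply, key, sub_self]

end Casimir

end CasimirBound

namespace CasimirBound

open Module LieModule LieAlgebra LieAlgebra.IsKilling

section Weights

variable {s : Type*} [LieRing s] [LieAlgebra ℂ s] [FiniteDimensional ℂ s]
  [LieAlgebra.IsKilling ℂ s] (H : LieSubalgebra ℂ s) [H.IsCartanSubalgebra]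

/-- The root `α` as an element of the dual of the Cartan subalgebra. -/
noncomputable abbrev rootLin (α : H.root) : Dual ℂ H := Weight.toLinear ℂ H s α

/-- The element of `H` dual to `μ` under the Killing form. -/
noncomputable abbrev tvec (μ : Dual ℂ H) : H := (cartanEquivDual H).symm μ

lemma root_ne_zero (α : H.root) : (α : Weight ℂ H s).IsNonZero := by
  exact H.isNonZero_coe_root α

variable {H} in
lemma killingForm_tvec (μ : Dual ℂ H) (h : H) :
    killingForm ℂ s (tvec H μ) h = μ h := by
  have : cartanEquivDual H (tvec H μ) h = μ h := by rw [LinearEquiv.apply_symm_apply]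
  rw [← this]
  rfl

lemma apply_tvec_comm (μ ν : Dual ℂ H) : μ (tvec H ν) = ν (tvec H μ) := by
  rw [← killingForm_tvec, ← killingForm_tvec, killingForm_symm]

lemma sum_root_mul (μ ν : Dual ℂ H) :
    ∑ α : H.root, μ (tvec H (rootLin H α)) * ν (tvec H (rootLin H α)) = μ (tvec H ν) := by
  rw [← killingForm_tvec μ]
  have h := congrArg (fun B : H.toSubmodule →ₗ[ℂ] H.toSubmodule →ₗ[ℂ] ℂ => B (tvec H μ) (tvec H ν))
    (restrict_killingForm_eq_sum (K := ℂ) (L := s) (H := H))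
  simp only [LinearMap.sum_apply, LinearMap.smulRight_apply, LinearMap.smul_apply] at h
  have h' : killingForm ℂ s (tvec H μ : s) (tvec H ν : s) =
    ∑ α ∈ H.root, (Weight.toLinear ℂ H s α (tvec H μ)) • (Weight.toLinear ℂ H s α (tvec H ν)) := h
  rw [h', ← Finset.sum_coe_sort H.root (fun α =>
    (Weight.toLinear ℂ H s α (tvec H μ)) • (Weight.toLinear ℂ H s α (tvec H ν)))]
  refine Finset.sum_congr rfl fun α _ => ?_
  rw [apply_tvec_comm, apply_tvec_comm H ν]
  rfl

section
variable (M : Type*) [AddCommGroup M] [Module ℂ M] [LieRingModule s M] [LieModule ℂ s M]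

/-- `μ` is the weight of a simultaneous eigenvector of `H` in `M`. -/
def IsWt (μ : Dual ℂ H) : Prop := ∃ v : M, v ≠ 0 ∧ ∀ h : H, ⁅(h : s), v⁆ = μ h • v

variable {M H}

lemma IsWt.genWeightSpace_ne_bot {μ : Dual ℂ H} (h : IsWt H M μ) : genWeightSpace M μ ≠ ⊥ := by
  obtain ⟨v, hv, h⟩ := h
  intro h0
  apply hv
  have : v ∈ genWeightSpace M μ := by
    apply weightSpace_le_genWeightSpace
    rw [mem_weightSpace]
    exact h
  rw [h0] at this
  simpa using this

lemma IsWt.of_injective {N : Type*} [AddCommGroup N] [Module ℂ N] [LieRingModule s N]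
    [LieModule ℂ s N] (φ : M →ₗ⁅ℂ, s⁆ N) (hφ : Function.Injective φ) {μ : Dual ℂ H}
    (h : IsWt H M μ) : IsWt H N μ := by
  obtain ⟨v, hv, h⟩ := h
  refine ⟨φ v, fun h0 => hv (hφ (by rw [h0, map_zero])), fun x => ?_⟩
  rw [← LieModuleHom.map_lie, h, map_smul]

variable [FiniteDimensional ℂ M]

lemma isWt_of_weight (χ : Weight ℂ H M) : IsWt H M (Weight.toLinear ℂ H M χ) :=
  exists_forall_lie_eq_smul ℂ H M χ

lemma IsWt.rational {μ : Dual ℂ H} (h : IsWt H M μ) (α : H.root) :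
    ∃ q : ℚ, μ (tvec H (rootLin H α)) = q * rootLin H α (tvec H (rootLin H α)) := by
  have hα : ((α : Weight ℂ H s) : H → ℂ) ≠ 0 := root_ne_zero H α
  obtain ⟨a, b, hb, hab⟩ := exists_forall_mem_corootSpace_smul_add_eq_zero M
    ((α : Weight ℂ H s) : H → ℂ) μ hα h.genWeightSpace_ne_bot
  have h1 := hab _ (cartanEquivDual_symm_apply_mem_corootSpace (α : Weight ℂ H s))
  refine ⟨-a / b, ?_⟩
  have hb' : (b : ℂ) ≠ 0 := by exact_mod_cast hb.ne'
  rw [Pi.add_apply, Pi.smul_apply, Pi.smul_apply, zsmul_eq_mul, zsmul_eq_mul] at h1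
  push_cast
  rw [div_mul_eq_mul_div, eq_div_iff hb']
  change _ = - (a : ℂ) * ((α : Weight ℂ H s) (tvec H (rootLin H α)))
  linear_combination h1

end

/-- `H`-weights whose pairings with all roots are real. -/
def IsRealWt (μ : Dual ℂ H) : Prop := ∀ α : H.root, (μ (tvec H (rootLin H α))).im = 0

lemma isWt_rootLin (α : H.root) : IsWt H s (rootLin H α) := isWt_of_weight _

lemma exists_pos_root (α : H.root) :
    ∃ r : ℝ, 0 < r ∧ rootLin H α (tvec H (rootLin H α)) = r := by
  choose q hq using fun β => (isWt_rootLin H β).rational α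
  set c := rootLin H α (tvec H (rootLin H α)) with hc
  have hc0 : c ≠ 0 := root_apply_cartanEquivDual_symm_ne_zero (root_ne_zero H α)
  have h1 : (∑ β : H.root, (q β : ℂ) ^ 2) * c ^ 2 = c := by
    conv_rhs => rw [hc, ← sum_root_mul]
    rw [Finset.sum_mul]
    refine Finset.sum_congr rfl fun β _ => ?_
    rw [apply_tvec_comm, hq]
    ring
  have h2 : (∑ β : H.root, (q β : ℂ) ^ 2) * c = 1 := by
    have : ((∑ β : H.root, (q β : ℂ) ^ 2) * c) * c = 1 * c := by
      linear_combination h1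
    exact mul_right_cancel₀ hc0 this
  have h3 : ((∑ β : H.root, (q β : ℝ) ^ 2 : ℝ) : ℂ) = ∑ β : H.root, (q β : ℂ) ^ 2 := by
    push_cast; rfl
  set S := ∑ β : H.root, (q β : ℝ) ^ 2
  have hS : S ≠ 0 := by
    rintro h; rw [← h3, h] at h2; simp at h2
  have hS' : 0 ≤ S := Finset.sum_nonneg fun _ _ => sq_nonneg _
  refine ⟨S⁻¹, inv_pos.mpr (lt_of_le_of_ne hS' hS.symm), ?_⟩
  rw [← h3] at h2
  push_cast
  exact eq_inv_of_mul_eq_one_right h2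

variable {H} in
lemma IsWt.isRealWt {M : Type*} [AddCommGroup M] [Module ℂ M] [LieRingModule s M]
    [LieModule ℂ s M] [FiniteDimensional ℂ M] {μ : Dual ℂ H} (h : IsWt H M μ) :
    IsRealWt H μ := by
  intro α
  obtain ⟨q, hq⟩ := h.rational α
  obtain ⟨r, -, hr⟩ := exists_pos_root H α
  rw [hq, hr]
  simp

/-- The vector of (real parts of) pairings with the roots. -/
noncomputable def pairVec : Dual ℂ H →+ EuclideanSpace ℝ H.root where
  toFun μ := WithLp.toLp 2 fun α => (μ (tvec H (rootLin H α))).re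
  map_zero' := by ext; simp
  map_add' μ ν := by ext; simp

@[simp] lemma pairVec_apply (μ : Dual ℂ H) (α : H.root) :
    pairVec H μ α = (μ (tvec H (rootLin H α))).re := rfl

variable {H}

lemma inner_pairVec {μ ν : Dual ℂ H} (hμ : IsRealWt H μ) (hν : IsRealWt H ν) :
    ((inner ℝ (pairVec H μ) (pairVec H ν) : ℝ) : ℂ) = μ (tvec H ν) := by
  rw [← sum_root_mul, PiLp.inner_apply]
  push_cast
  refine Finset.sum_congr rfl fun α _ => ?_
  have h1 : ((pairVec H μ α : ℝ) : ℂ) = μ (tvec H (rootLin H α)) := by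
    apply Complex.ext <;> simp [hμ α]
  have h2 : ((pairVec H ν α : ℝ) : ℂ) = ν (tvec H (rootLin H α)) := by
    apply Complex.ext <;> simp [hν α]
  rw [← h1, ← h2]
  simp [mul_comm]

lemma norm_pairVec_rootLin_pos (α : H.root) : 0 < ‖pairVec H (rootLin H α)‖ := by
  obtain ⟨r, hr, h⟩ := exists_pos_root H α
  rw [norm_pos_iff]
  intro h0
  have := congrArg (fun v => v α) h0
  simp only [pairVec_apply, h] at this
  simp at this
  exact hr.ne' this

lemma eq_zero_of_pairVec_eq_zero {μ : Dual ℂ H} (hμ : IsRealWt H μ) (h : pairVec H μ = 0) :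
    μ = 0 := by
  have h1 : ∀ ν : Dual ℂ H, ν (tvec H μ) = 0 := by
    intro ν
    have : (⊤ : Submodule ℂ (Dual ℂ H)) ≤ LinearMap.ker (LinearMap.applyₗ (R := ℂ) (tvec H μ)) := by
      rw [← span_weight_isNonZero_eq_top ℂ s H, Submodule.span_le]
      rintro _ ⟨α, hα, rfl⟩
      have hα' : α ∈ H.root := by simpa using hα
      have h2 := congrArg (fun v => v ⟨α, hα'⟩) h
      simp only [pairVec_apply] at h2
      have h3 := hμ ⟨α, hα'⟩
      simp only [SetLike.mem_coe, LinearMap.mem_ker, LinearMap.applyₗ_apply_apply]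
      rw [apply_tvec_comm]
      exact Complex.ext h2 h3
    simpa using this (Submodule.mem_top : ν ∈ ⊤)
  have h2 : tvec H μ = 0 := by
    rwa [← Module.forall_dual_apply_eq_zero_iff ℂ]
  simpa using h2

end Weights

end CasimirBound

namespace CasimirBound

open Module LieModule LieAlgebra LieAlgebra.IsKilling

section Weights

variable {s : Type*} [LieRing s] [LieAlgebra ℂ s] [FiniteDimensional ℂ s]
  [LieAlgebra.IsKilling ℂ s] {H : LieSubalgebra ℂ s} [H.IsCartanSubalgebra]

lemma exists_root_vectors (α : H.root) : ∃ e f : s, e ∈ rootSpace H (α : Weight ℂ H s) ∧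
    f ∈ rootSpace H (-(α : Weight ℂ H s) : H → ℂ) ∧ killingForm ℂ s e f = 1 ∧
    ⁅e, f⁆ = tvec H (rootLin H α) := by
  obtain ⟨e, he, he0⟩ := (α : Weight ℂ H s).exists_ne_zero
  have h1 : ∃ f ∈ rootSpace H (-(α : Weight ℂ H s) : H → ℂ), killingForm ℂ s e f ≠ 0 := by
    by_contra! hcon
    have := mem_ker_killingForm_of_mem_rootSpace_of_forall_rootSpace_neg ℂ s H he hcon
    rw [LieAlgebra.IsKilling.ker_killingForm_eq_bot] at this
    exact he0 (by simpa using this)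
  obtain ⟨f, hf, hne⟩ := h1
  have hf' : (killingForm ℂ s e f)⁻¹ • f ∈ rootSpace H (-(α : Weight ℂ H s) : H → ℂ) :=
    (rootSpace H (-(α : Weight ℂ H s) : H → ℂ)).smul_mem _ hf
  have h2 : killingForm ℂ s e ((killingForm ℂ s e f)⁻¹ • f) = 1 := by simp [hne]
  refine ⟨e, _, he, hf', h2, ?_⟩
  rw [lie_eq_killingForm_smul_of_mem_rootSpace_of_mem_rootSpace_neg he hf', h2, one_smul]

/-- A root vector for `α`. -/
noncomputable def evec (α : H.root) : s := (exists_root_vectors α).choose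

/-- The root vector for `-α` dual to `evec α`. -/
noncomputable def fvec (α : H.root) : s := (exists_root_vectors α).choose_spec.choose

lemma evec_mem (α : H.root) : evec α ∈ rootSpace H (α : Weight ℂ H s) :=
  (exists_root_vectors α).choose_spec.choose_spec.1

lemma fvec_mem (α : H.root) : fvec α ∈ rootSpace H (-(α : Weight ℂ H s) : H → ℂ) :=
  (exists_root_vectors α).choose_spec.choose_spec.2.1

lemma killingForm_evec_fvec (α : H.root) : killingForm ℂ s (evec α) (fvec α) = 1 :=
  (exists_root_vectors α).choose_spec.choose_spec.2.2.1

lemma lie_evec_fvec (α : H.root) : ⁅evec α, fvec α⁆ = (tvec H (rootLin H α) : s) :=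
  (exists_root_vectors α).choose_spec.choose_spec.2.2.2

lemma lie_evec (α : H.root) (h : H) : ⁅(h : s), evec α⁆ = rootLin H α h • evec α :=
  lie_eq_smul_of_mem_rootSpace (evec_mem α) h

lemma lie_fvec (α : H.root) (h : H) : ⁅(h : s), fvec α⁆ = -(rootLin H α h) • fvec α :=
  lie_eq_smul_of_mem_rootSpace (fvec_mem α) h

lemma mem_rootSpace_root (α : H.root) {z : s} (hz : z ∈ rootSpace H (α : Weight ℂ H s)) :
    ∃ c : ℂ, z = c • evec α := by
  have h1 := finrank_rootSpace_eq_one (α : Weight ℂ H s) (root_ne_zero H α)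
  have h2 : (⟨evec α, evec_mem α⟩ : rootSpace H (α : Weight ℂ H s)) ≠ 0 := by
    intro h0
    have h3 : evec α = 0 := congrArg Subtype.val h0
    have := killingForm_evec_fvec α
    rw [h3] at this
    simp at this
  obtain ⟨c, hc⟩ := (finrank_eq_one_iff_of_nonzero' _ h2).mp h1 ⟨z, hz⟩
  exact ⟨c, (congrArg Subtype.val hc).symm⟩

lemma root_induction {p : s → Prop} (hH : ∀ h : H, p h) (he : ∀ α : H.root, p (evec α))
    (hadd : ∀ x y, p x → p y → p (x + y)) (hsmul : ∀ (c : ℂ) x, p x → p (c • x)) (z : s) : p z := by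
  have hz : z ∈ ⨆ χ : Weight ℂ H s, genWeightSpace s χ := by
    rw [iSup_genWeightSpace_eq_top' ℂ H s]; trivial
  refine LieSubmodule.iSup_induction (fun χ : Weight ℂ H s => genWeightSpace s χ)
    (motive := p) hz ?_
    (by simpa using hH 0) hadd
  intro χ z hz
  by_cases hχ : χ.IsZero
  · have hχ' : (χ : H → ℂ) = 0 := hχ
    rw [hχ'] at hz
    have : z ∈ rootSpace H (0 : H → ℂ) := hz
    rw [rootSpace_zero_eq] at this
    exact hH ⟨z, this⟩
  · obtain ⟨c, rfl⟩ := mem_rootSpace_root ⟨χ, by simpa using hχ⟩ hz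
    exact hsmul _ _ (he _)

lemma mem_rootSpace_zero (h : H) : (h : s) ∈ rootSpace H (0 : H → ℂ) := by
  rw [rootSpace_zero_eq]; exact h.2

variable (H) in
/-- A basis of the Cartan subalgebra. -/
noncomputable def hbas : Basis (Fin (finrank ℂ H)) ℂ H := finBasis ℂ H

variable (H) in
/-- The basis of the Cartan subalgebra dual to `hbas`. -/
noncomputable def hdbas : Basis (Fin (finrank ℂ H)) ℂ H :=
  LinearMap.BilinForm.dualBasis (traceForm ℂ H s) (traceForm_cartan_nondegenerate ℂ s H) (hbas H)

lemma hbas_sum (h : H) : ∑ i, killingForm ℂ s (hdbas H i) h • hbas H i = h := by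
  have h1 : ∀ i j, killingForm ℂ s (hdbas H i) (hbas H j) = if j = i then 1 else 0 := fun i j =>
    LinearMap.BilinForm.apply_dualBasis_left (B := traceForm ℂ H s)
      (traceForm_cartan_nondegenerate ℂ s H) (hbas H) i j
  have h2 : ∀ i, (hbas H).repr h i = killingForm ℂ s (hdbas H i) h := by
    intro i
    have h3 : killingForm ℂ s (hdbas H i) ((∑ j, (hbas H).repr h j • hbas H j : H) : s) =
        (hbas H).repr h i := by
      simp only [AddSubmonoidClass.coe_finsetSum, SetLike.val_smul, map_sum, map_smul, h1,
        smul_eq_mul, mul_ite, mul_one, mul_zero, Finset.sum_ite_eq', Finset.mem_univ, if_true]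
    rw [← h3, (hbas H).sum_repr]
  simp_rw [← h2]
  exact (hbas H).sum_repr h

variable {M : Type*} [AddCommGroup M] [Module ℂ M] [LieRingModule s M] [LieModule ℂ s M]

lemma casimir_apply_root (m : M) : casimir s M m =
    ∑ i, ⁅(hbas H i : s), ⁅(hdbas H i : s), m⁆⁆ + ∑ α : H.root, ⁅evec α, ⁅fvec α, m⁆⁆ := by
  have := casimir_apply_of_dual s
    (Sum.elim (fun i => (hbas H i : s)) (fun α : H.root => evec α))
    (Sum.elim (fun i => (hdbas H i : s)) (fun α : H.root => fvec α)) ?_ m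
  · rw [this]; simp
  intro z
  simp only [Fintype.sum_sum_type, Sum.elim_inl, Sum.elim_inr]
  refine root_induction (H := H) (p := fun z => ∑ i, killingForm ℂ s (hdbas H i) z • (hbas H i : s)
    + ∑ α : H.root, killingForm ℂ s (fvec α) z • evec α = z) ?_ ?_ ?_ ?_ z
  · intro h
    rw [Finset.sum_eq_zero (s := (Finset.univ : Finset H.root)), add_zero]
    · conv_rhs => rw [← hbas_sum h]
      simp
    · intro α _
      rw [killingForm_apply_eq_zero_of_mem_rootSpace_of_add_ne_zero ℂ s H (fvec_mem α)
        (mem_rootSpace_zero h), zero_smul]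
      simp
  · intro β
    rw [Finset.sum_eq_zero, zero_add, Finset.sum_eq_single β]
    · rw [killingForm_symm, killingForm_evec_fvec, one_smul]
    · intro α _ hne
      rw [killingForm_apply_eq_zero_of_mem_rootSpace_of_add_ne_zero ℂ s H (fvec_mem α)
        (evec_mem β), zero_smul]
      intro h0
      apply hne
      have h1 : ((α : Weight ℂ H s) : H → ℂ) = (β : Weight ℂ H s) := by
        rwa [neg_add_eq_zero] at h0
      exact Subtype.ext (DFunLike.coe_injective h1)
    · simp
    · intro i _
      rw [killingForm_apply_eq_zero_of_mem_rootSpace_of_add_ne_zero ℂ s H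
        (mem_rootSpace_zero _) (evec_mem β), zero_smul]
      simp
  · intro x y hx hy
    simp only [map_add, add_smul, Finset.sum_add_distrib]
    rw [add_add_add_comm, hx, hy]
  · intro c x hx
    simp only [map_smul, smul_assoc, ← Finset.smul_sum, ← smul_add]
    rw [hx]

lemma sum_hbas_mul (μ : Dual ℂ H) : ∑ i, μ (hbas H i) * μ (hdbas H i) = μ (tvec H μ) := by
  conv_rhs => rw [← hbas_sum (tvec H μ)]
  simp only [map_sum, map_smul, smul_eq_mul]
  refine Finset.sum_congr rfl fun i _ => ?_
  rw [killingForm_symm, killingForm_tvec, mul_comm]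

/-- The Casimir eigenvalue attached to an extremal weight `μ`. -/
noncomputable def casVal (μ : Dual ℂ H) : ℝ :=
  ‖pairVec H μ‖ ^ 2 + ∑ α : H.root, max ((μ (tvec H (rootLin H α))).re) 0

lemma norm_sq_le_casVal (μ : Dual ℂ H) : ‖pairVec H μ‖ ^ 2 ≤ casVal μ :=
  le_add_of_nonneg_right (Finset.sum_nonneg fun _ _ => le_max_right _ _)

lemma casVal_nonneg (μ : Dual ℂ H) : 0 ≤ casVal μ := (sq_nonneg _).trans (norm_sq_le_casVal μ)

lemma casVal_le (μ : Dual ℂ H) :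
    casVal μ ≤ ‖pairVec H μ‖ ^ 2 + Fintype.card H.root * ‖pairVec H μ‖ := by
  unfold casVal
  gcongr
  calc _ ≤ ∑ α : H.root, ‖pairVec H μ‖ := by
        refine Finset.sum_le_sum fun α _ => max_le ?_ (norm_nonneg _)
        have := PiLp.norm_apply_le (pairVec H μ) α
        rw [pairVec_apply] at this
        exact (le_abs_self _).trans this
    _ = _ := by rw [Finset.sum_const, nsmul_eq_mul, Finset.card_univ]

lemma IsRealWt.neg {μ : Dual ℂ H} (hμ : IsRealWt H μ) : IsRealWt H (-μ) := fun α => by simp [hμ α]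

lemma norm_lt_norm_add {μ ν : Dual ℂ H} (hμ : IsRealWt H μ) (hν : IsRealWt H ν)
    (hpos : 0 < ‖pairVec H ν‖) (h : 0 ≤ (μ (tvec H ν)).re) :
    ‖pairVec H μ‖ < ‖pairVec H (μ + ν)‖ := by
  have h1 : inner ℝ (pairVec H μ) (pairVec H ν) = (μ (tvec H ν)).re := by
    rw [← inner_pairVec hμ hν]; simp
  have h2 := norm_add_sq_real (pairVec H μ) (pairVec H ν)
  rw [map_add]
  refine lt_of_pow_lt_pow_left₀ 2 (norm_nonneg _) ?_
  rw [h2, h1]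
  nlinarith [pow_pos hpos 2]

/-- On a finite-dimensional module the Casimir operator acts on a weight vector whose weight has
maximal norm by `casVal`. -/
lemma exists_extremal (M : Type*) [AddCommGroup M] [Module ℂ M] [LieRingModule s M]
    [LieModule ℂ s M] [FiniteDimensional ℂ M] [Nontrivial M] :
    ∃ μ : Dual ℂ H, IsWt H M μ ∧ (∀ ν, IsWt H M ν → ‖pairVec H ν‖ ≤ ‖pairVec H μ‖) ∧
      ∃ v : M, v ≠ 0 ∧ casimir s M v = (casVal μ : ℂ) • v := by
  have hne : Nonempty (Weight ℂ H M) := by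
    by_contra hcon
    rw [not_nonempty_iff] at hcon
    have := iSup_genWeightSpace_eq_top' ℂ H M
    rw [iSup_of_empty] at this
    exact bot_ne_top this
  obtain ⟨χ, hχ⟩ := Finite.exists_max (fun χ : Weight ℂ H M =>
    ‖pairVec H (Weight.toLinear ℂ H M χ)‖)
  set μ := Weight.toLinear ℂ H M χ with hμdef
  have hmax : ∀ ν, IsWt H M ν → ‖pairVec H ν‖ ≤ ‖pairVec H μ‖ := by
    intro ν hν
    exact hχ ⟨ν, hν.genWeightSpace_ne_bot⟩
  have hw : IsWt H M μ := isWt_of_weight χ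
  have hreal := hw.isRealWt
  refine ⟨μ, hw, hmax, ?_⟩
  obtain ⟨v, hv, hvμ⟩ := hw
  refine ⟨v, hv, ?_⟩
  have hrr : ∀ α : H.root, IsRealWt H (rootLin H α) := fun α => (isWt_rootLin H α).isRealWt
  have hre : ∀ α : H.root, μ (tvec H (rootLin H α)) = ((μ (tvec H (rootLin H α))).re : ℂ) := by
    intro α
    apply Complex.ext <;> simp [hreal α]
  have he : ∀ α : H.root, 0 ≤ (μ (tvec H (rootLin H α))).re → ⁅evec α, v⁆ = 0 := by
    intro α hα
    by_contra h0
    have h1 : IsWt H M (μ + rootLin H α) := by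
      refine ⟨_, h0, fun h => ?_⟩
      rw [leibniz_lie, lie_evec, hvμ]
      simp only [smul_lie, lie_smul, LinearMap.add_apply, add_smul]
      abel
    exact absurd (hmax _ h1)
      (not_le.mpr (norm_lt_norm_add hreal (hrr α) (norm_pairVec_rootLin_pos α) hα))
  have hf : ∀ α : H.root, (μ (tvec H (rootLin H α))).re < 0 → ⁅fvec α, v⁆ = 0 := by
    intro α hα
    by_contra h0
    have h1 : IsWt H M (μ + -rootLin H α) := by
      refine ⟨_, h0, fun h => ?_⟩
      rw [leibniz_lie, lie_fvec, hvμ]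
      simp only [smul_lie, lie_smul, LinearMap.add_apply, LinearMap.neg_apply, add_smul]
      abel
    refine absurd (hmax _ h1)
      (not_le.mpr (norm_lt_norm_add hreal (hrr α).neg ?_ ?_))
    · rw [map_neg, norm_neg]; exact norm_pairVec_rootLin_pos α
    · simp only [map_neg, Complex.neg_re]; linarith
  have hterm : ∀ α : H.root, ⁅evec α, ⁅fvec α, v⁆⁆ =
      ((max ((μ (tvec H (rootLin H α))).re) 0 : ℝ) : ℂ) • v := by
    intro α
    rcases lt_or_ge (μ (tvec H (rootLin H α))).re 0 with h | h
    · rw [hf α h, max_eq_right h.le]; simp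
    · rw [leibniz_lie, he α h, lie_evec_fvec, hvμ, max_eq_left h, lie_zero, add_zero, ← hre]
  rw [casimir_apply_root (H := H)]
  simp_rw [hterm, hvμ, lie_smul, hvμ, smul_smul]
  rw [← Finset.sum_smul, ← Finset.sum_smul, ← add_smul]
  congr 1
  have h2 : ∑ i, μ (hdbas H i) * μ (hbas H i) = μ (tvec H μ) := by
    rw [← sum_hbas_mul]
    exact Finset.sum_congr rfl fun _ _ => mul_comm _ _
  rw [h2, ← inner_pairVec hreal hreal, real_inner_self_eq_norm_sq]
  unfold casVal
  push_cast
  rfl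

end Weights

end CasimirBound

namespace CasimirBound

open Module LieModule LieAlgebra LieAlgebra.IsKilling

section LocallyFinite

variable {s : Type*} [LieRing s] [LieAlgebra ℂ s]

/-- Locally finite Lie modules: every element lies in a finite-dimensional submodule. -/
def IsLF (s : Type*) [LieRing s] [LieAlgebra ℂ s]
    (M : Type*) [AddCommGroup M] [Module ℂ M] [LieRingModule s M] [LieModule ℂ s M] : Prop :=
  ∀ m : M, ∃ N : LieSubmodule ℂ s M, FiniteDimensional ℂ N ∧ m ∈ N

variable {M : Type*} [AddCommGroup M] [Module ℂ M] [LieRingModule s M] [LieModule ℂ s M]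
variable {N : Type*} [AddCommGroup N] [Module ℂ N] [LieRingModule s N] [LieModule ℂ s N]

lemma isLF_of_finiteDimensional [FiniteDimensional ℂ M] : IsLF s M :=
  fun _ => ⟨⊤, inferInstanceAs (FiniteDimensional ℂ (⊤ : Submodule ℂ M)), trivial⟩

lemma finiteDimensional_map (φ : M →ₗ⁅ℂ, s⁆ N) (P : LieSubmodule ℂ s M) [FiniteDimensional ℂ P] :
    FiniteDimensional ℂ (P.map φ) :=
  inferInstanceAs (FiniteDimensional ℂ (Submodule.map (φ : M →ₗ[ℂ] N) P.toSubmodule))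

lemma IsLF.of_surjective (h : IsLF s M) (φ : M →ₗ⁅ℂ, s⁆ N) (hφ : Function.Surjective φ) :
    IsLF s N := by
  intro n
  obtain ⟨m, rfl⟩ := hφ n
  obtain ⟨P, hP, hm⟩ := h m
  exact ⟨P.map φ, finiteDimensional_map φ P, LieSubmodule.mem_map_of_mem hm⟩

lemma IsLF.of_injective (h : IsLF s N) (φ : M →ₗ⁅ℂ, s⁆ N) (hφ : Function.Injective φ) :
    IsLF s M := by
  intro m
  obtain ⟨P, hP, hm⟩ := h (φ m)
  refine ⟨P.comap φ, ?_, hm⟩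
  let ψ : P.comap φ →ₗ[ℂ] P :=
    (φ : M →ₗ[ℂ] N).restrict (p := (P.comap φ).toSubmodule) (q := P.toSubmodule) (fun x hx => hx)
  refine FiniteDimensional.of_injective ψ ?_
  intro x y hxy
  exact Subtype.ext (hφ (congrArg Subtype.val hxy))

/-- Maps from a finite-dimensional module to a locally finite one form a locally finite module. -/
lemma IsLF.hom [FiniteDimensional ℂ M] (h : IsLF s N) : IsLF s (M →ₗ[ℂ] N) := by
  have hfin : ∀ P : Submodule ℂ N, P.FG → ∃ Q : LieSubmodule ℂ s N,
      FiniteDimensional ℂ Q ∧ P ≤ Q.toSubmodule := by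
    intro P hP
    induction P, hP using Submodule.fg_induction with
    | singleton x =>
      obtain ⟨Q, hQ, hx⟩ := h x
      exact ⟨Q, hQ, by simpa [Submodule.span_le] using hx⟩
    | sup P₁ P₂ _ _ h₁ h₂ =>
      obtain ⟨Q₁, hQ₁, h₁⟩ := h₁
      obtain ⟨Q₂, hQ₂, h₂⟩ := h₂
      refine ⟨Q₁ ⊔ Q₂, ?_, ?_⟩
      · have : FiniteDimensional ℂ (Q₁.toSubmodule ⊔ Q₂.toSubmodule : Submodule ℂ N) :=
          inferInstance
        rwa [← LieSubmodule.sup_toSubmodule] at this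
      · rw [LieSubmodule.sup_toSubmodule]
        exact sup_le_sup h₁ h₂
  intro φ
  obtain ⟨Q, hQ, hle⟩ := hfin (LinearMap.range φ) (Module.Finite.iff_fg.mp inferInstance)
  let R : LieSubmodule ℂ s (M →ₗ[ℂ] N) :=
    { carrier := {ψ | ∀ m, ψ m ∈ Q}
      add_mem' := fun ha hb m => Q.add_mem (ha m) (hb m)
      zero_mem' := fun m => Q.zero_mem
      smul_mem' := fun c _ ha m => Q.smul_mem c (ha m)
      lie_mem := by
        intro x ψ hψ m
        rw [LieHom.lie_apply]
        exact Q.sub_mem (Q.lie_mem (hψ m)) (hψ _) }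
  refine ⟨R, ?_, fun m => hle ⟨m, rfl⟩⟩
  let Ψ : R →ₗ[ℂ] (M →ₗ[ℂ] Q) :=
    { toFun := fun ψ => LinearMap.codRestrict Q.toSubmodule ψ.1 ψ.2
      map_add' := fun a b => rfl
      map_smul' := fun a b => rfl }
  refine FiniteDimensional.of_injective Ψ ?_
  intro a b hab
  apply Subtype.ext
  ext m
  exact congrArg (fun f : M →ₗ[ℂ] Q => (f m : N)) hab

variable [FiniteDimensional ℂ s] [LieAlgebra.IsKilling ℂ s]

lemma exists_cartan (s : Type*) [LieRing s] [LieAlgebra ℂ s] [FiniteDimensional ℂ s] :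
    ∃ H : LieSubalgebra ℂ s, H.IsCartanSubalgebra := by
  obtain ⟨x, hx⟩ := exists_isCartanSubalgebra_engel ℂ s
  exact ⟨_, hx⟩

variable (s M) in
/-- A polynomial in the Casimir operator. -/
noncomputable def casPoly (p : Polynomial ℂ) : Module.End ℂ M :=
  Polynomial.aeval (casimir s M : Module.End ℂ M) p

lemma map_casPoly (φ : M →ₗ⁅ℂ, s⁆ N) (p : Polynomial ℂ) (m : M) :
    φ (casPoly s M p m) = casPoly s N p (φ m) := by
  unfold casPoly
  induction p using Polynomial.induction_on generalizing m with
  | C a => simp [Polynomial.aeval_C, Module.algebraMap_end_apply]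
  | add p q hp hq => simp [hp, hq]
  | monomial n a h =>
    rw [pow_succ, ← mul_assoc, map_mul _ (_ * _) Polynomial.X, map_mul _ (_ * _) Polynomial.X,
      Module.End.mul_apply, Module.End.mul_apply, h, Polynomial.aeval_X, Polynomial.aeval_X]
    exact congrArg _ (map_casimir s φ m)

lemma casPoly_lie (p : Polynomial ℂ) (x : s) (m : M) :
    casPoly s M p ⁅x, m⁆ = ⁅x, casPoly s M p m⁆ := by
  unfold casPoly
  induction p using Polynomial.induction_on generalizing m with
  | C a => simp [Polynomial.aeval_C, Module.algebraMap_end_apply]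
  | add p q hp hq => simp [hp, hq]
  | monomial n a h =>
    rw [pow_succ, ← mul_assoc, map_mul _ (_ * _) Polynomial.X, Module.End.mul_apply,
      Module.End.mul_apply, ← h, Polynomial.aeval_X]
    exact congrArg _ ((casimir s M).map_lie x m)

variable (s M) in
/-- The kernel of a polynomial in the Casimir operator. -/
noncomputable def casKer (p : Polynomial ℂ) : LieSubmodule ℂ s M where
  toSubmodule := LinearMap.ker (casPoly s M p)
  lie_mem := by
    intro x m hm
    change casPoly s M p ⁅x, m⁆ = 0
    have hm' : casPoly s M p m = 0 := hm
    rw [casPoly_lie, hm', lie_zero]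

lemma mem_casKer {p : Polynomial ℂ} {m : M} : m ∈ casKer s M p ↔ casPoly s M p m = 0 := Iff.rfl

lemma casPoly_X_sub_C (c : ℂ) (m : M) :
    casPoly s M (Polynomial.X - Polynomial.C c) m = casimir s M m - c • m := by
  simp [casPoly, Module.algebraMap_end_apply]

lemma casPoly_mul (p q : Polynomial ℂ) (m : M) :
    casPoly s M (p * q) m = casPoly s M p (casPoly s M q m) := by
  simp [casPoly]

/-- `c` is an eigenvalue of the Casimir operator. -/
def IsCasEig (s : Type*) [LieRing s] [LieAlgebra ℂ s] [FiniteDimensional ℂ s]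
    [LieAlgebra.IsKilling ℂ s]
    (M : Type*) [AddCommGroup M] [Module ℂ M] [LieRingModule s M] [LieModule ℂ s M] (c : ℂ) :
    Prop :=
  ∃ m : M, m ≠ 0 ∧ casimir s M m = c • m

lemma IsCasEig.of_injective {c : ℂ} (h : IsCasEig s M c) (φ : M →ₗ⁅ℂ, s⁆ N)
    (hφ : Function.Injective φ) : IsCasEig s N c := by
  obtain ⟨m, hm, h⟩ := h
  exact ⟨φ m, fun h0 => hm (hφ (by rw [h0, map_zero])), by rw [← map_casimir, h, map_smul]⟩

lemma exists_isCasEig [FiniteDimensional ℂ M] [Nontrivial M] : ∃ c, IsCasEig s M c := by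
  obtain ⟨c, hc⟩ := Module.End.exists_eigenvalue (casimir s M : Module.End ℂ M)
  obtain ⟨v, hv⟩ := hc.exists_hasEigenvector
  exact ⟨c, v, hv.2, hv.apply_eq_smul⟩

section Weights

variable {H : LieSubalgebra ℂ s} [H.IsCartanSubalgebra]

/-- Eigenvalues of the Casimir operator are given by weights. -/
lemma IsCasEig.eq_casVal [FiniteDimensional ℂ M] {c : ℂ} (h : IsCasEig s M c) :
    ∃ μ : Dual ℂ H, IsWt H M μ ∧ c = casVal μ := by
  obtain ⟨m, hm, h⟩ := h
  let P := casKer s M (Polynomial.X - Polynomial.C c)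
  have hmP : m ∈ P := by rw [mem_casKer, casPoly_X_sub_C, h, sub_self]
  have : Nontrivial P := ⟨⟨⟨m, hmP⟩, 0, fun h0 => hm (congrArg Subtype.val h0)⟩⟩
  obtain ⟨μ, hμ, -, v, hv, hvc⟩ := exists_extremal (H := H) P
  refine ⟨μ, hμ.of_injective P.incl Subtype.val_injective, ?_⟩
  have h1 : casimir s M v = (casVal μ : ℂ) • (v : M) := by
    rw [← casimir_coe, hvc]; rfl
  have h2 : casimir s M v = c • (v : M) := by
    have := v.2
    rwa [mem_casKer, casPoly_X_sub_C, sub_eq_zero] at this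
  rw [h1] at h2
  exact (smul_left_injective ℂ (fun h0 => hv (Subtype.ext h0)) h2).symm

lemma IsWt.norm_sq_le [FiniteDimensional ℂ M] {r : ℝ} (h : ∀ c, IsCasEig s M c → c.re ≤ r)
    {μ : Dual ℂ H} (hμ : IsWt H M μ) : ‖pairVec H μ‖ ^ 2 ≤ r := by
  have : Nontrivial M := by
    obtain ⟨v, hv, -⟩ := hμ
    exact ⟨⟨v, 0, hv⟩⟩
  obtain ⟨ν, -, hmax, v, hv, hvc⟩ := exists_extremal (H := H) M
  have h1 := h _ ⟨v, hv, hvc⟩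
  rw [Complex.ofReal_re] at h1
  calc _ ≤ ‖pairVec H ν‖ ^ 2 := by gcongr; exact hmax _ hμ
    _ ≤ casVal ν := norm_sq_le_casVal ν
    _ ≤ r := h1

end Weights

lemma IsCasEig.real [FiniteDimensional ℂ M] {c : ℂ} (h : IsCasEig s M c) :
    0 ≤ c.re ∧ c = c.re := by
  obtain ⟨H, hH⟩ := exists_cartan s
  obtain ⟨μ, -, rfl⟩ := h.eq_casVal (H := H)
  simp [casVal_nonneg]

/-- If the Casimir operator has only the eigenvalue `0`, the action is trivial. -/
lemma lie_eq_zero_of_isCasEig [FiniteDimensional ℂ M] (h : ∀ c, IsCasEig s M c → c = 0) (x : s)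
    (m : M) : ⁅x, m⁆ = 0 := by
  obtain ⟨H, hH⟩ := exists_cartan s
  have hwt : ∀ χ : H → ℂ, genWeightSpace M χ ≠ ⊥ → χ = 0 := by
    intro χ hχ
    have h1 := isWt_of_weight (H := H) (M := M) ⟨χ, hχ⟩
    have h2 := h1.norm_sq_le (r := 0) (fun c hc => by rw [h c hc]; simp)
    have h3 : pairVec H (Weight.toLinear ℂ H M ⟨χ, hχ⟩) = 0 := by
      rw [← norm_eq_zero]
      exact pow_eq_zero_iff two_ne_zero |>.mp (le_antisymm h2 (sq_nonneg _))
    have h4 := eq_zero_of_pairVec_eq_zero h1.isRealWt h3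
    ext y
    exact congrArg (fun f : Dual ℂ H => f y) h4
  have htop : genWeightSpace M (0 : H → ℂ) = ⊤ := by
    rw [eq_top_iff, ← iSup_genWeightSpace_eq_top' ℂ H M]
    refine iSup_le fun χ => ?_
    rw [hwt χ χ.2]
  have hroot : ∀ χ : H → ℂ, χ ≠ 0 → ∀ e ∈ rootSpace H χ, ∀ m : M, ⁅e, m⁆ = 0 := by
    intro χ hχ e he m
    have hm : m ∈ genWeightSpace M (0 : H → ℂ) := by rw [htop]; trivial
    have h1 := toEnd_pow_apply_mem he hm 1
    have h2 : genWeightSpace M ((1 : ℕ) • χ + (0 : H → ℂ)) = ⊥ := by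
      by_contra hne
      exact hχ (by simpa using hwt _ hne)
    rw [h2] at h1
    simpa using h1
  have hE : ∀ (α : H.root) (m : M), ⁅evec α, m⁆ = 0 := fun α m =>
    hroot _ (root_ne_zero H α) _ (evec_mem α) m
  have hF : ∀ (α : H.root) (m : M), ⁅fvec α, m⁆ = 0 := fun α m =>
    hroot _ (neg_ne_zero.mpr (root_ne_zero H α)) _ (fvec_mem α) m
  refine root_induction (H := H) (p := fun x => ∀ m : M, ⁅x, m⁆ = 0) ?_ hE ?_ ?_ x m
  · intro h
    have hspan : (⊤ : Submodule ℂ (Dual ℂ H)) ≤ Submodule.comap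
        ((toEnd ℂ s M : s →ₗ[ℂ] Module.End ℂ M) ∘ₗ H.toSubmodule.subtype ∘ₗ
          ((cartanEquivDual H).symm : Dual ℂ H →ₗ[ℂ] H)) ⊥ := by
      rw [← span_weight_isNonZero_eq_top ℂ s H, Submodule.span_le]
      rintro _ ⟨α, hα, rfl⟩
      have hα' : α ∈ H.root := by simpa using hα
      simp only [SetLike.mem_coe, Submodule.mem_comap, Submodule.mem_bot]
      ext m
      change ⁅(tvec H (rootLin H ⟨α, hα'⟩) : s), m⁆ = 0
      rw [← lie_evec_fvec, lie_lie, hE, hF, sub_zero]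
    have h1 := hspan (Submodule.mem_top : cartanEquivDual H h ∈ ⊤)
    intro m
    have h2 := congrArg (fun φ : Module.End ℂ M => φ m) ((Submodule.mem_bot ℂ).mp h1)
    simpa using h2
  · intro x y hx hy m; rw [add_lie, hx, hy, add_zero]
  · intro c x hx m; rw [smul_lie, hx, smul_zero]

end LocallyFinite

end CasimirBound

namespace CasimirBound

open Module LieModule LieAlgebra LieAlgebra.IsKilling

section Reductivity

variable {s : Type*} [LieRing s] [LieAlgebra ℂ s] [FiniteDimensional ℂ s]
  [LieAlgebra.IsKilling ℂ s]
variable {M : Type*} [AddCommGroup M] [Module ℂ M] [LieRingModule s M] [LieModule ℂ s M]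
variable {N : Type*} [AddCommGroup N] [Module ℂ N] [LieRingModule s N] [LieModule ℂ s N]

lemma casPoly_of_casimir_eq_smul {c : ℂ} {m : M} (h : casimir s M m = c • m)
    (p : Polynomial ℂ) : casPoly s M p m = p.eval c • m := by
  unfold casPoly
  induction p using Polynomial.induction_on with
  | C a => simp [Polynomial.aeval_C, Module.algebraMap_end_apply]
  | add p q hp hq => simp [hp, hq, add_smul]
  | monomial n a ih =>
    have h' : (casimir s M : Module.End ℂ M) m = c • m := h
    rw [pow_succ, ← mul_assoc, map_mul _ (_ * _) Polynomial.X, Module.End.mul_apply,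
      Polynomial.aeval_X, h', map_smul, ih, smul_smul]
    congr 1
    simp only [Polynomial.eval_mul, Polynomial.eval_C, Polynomial.eval_pow, Polynomial.eval_X]
    ring

lemma lie_eq_zero_of_casimir_casimir (h : IsLF s M) {m : M}
    (hm : casimir s M (casimir s M m) = 0) (x : s) : ⁅x, m⁆ = 0 := by
  obtain ⟨P, hP, hmP⟩ := h m
  let K := casKer s P (Polynomial.X ^ 2)
  have hK : (⟨m, hmP⟩ : P) ∈ K := by
    rw [mem_casKer, pow_two, casPoly_mul]
    apply Subtype.ext
    have : ∀ y : P, casPoly s P Polynomial.X y = casimir s P y := fun y => by simp [casPoly]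
    rw [this, this, casimir_coe, casimir_coe, hm]; rfl
  have h1 := lie_eq_zero_of_isCasEig (s := s) (M := K) ?_ x ⟨_, hK⟩
  · have h2 := congrArg (fun y : K => ((y : P) : M)) h1
    simpa using h2
  · intro c ⟨v, hv, hc⟩
    have h1 : casimir s P v = c • (v : P) := by rw [← casimir_coe, hc]; rfl
    have h2 := casPoly_of_casimir_eq_smul h1 (Polynomial.X ^ 2)
    rw [mem_casKer.mp v.2] at h2
    have h3 : (v : P) ≠ 0 := fun h0 => hv (Subtype.ext h0)
    have h4 := (smul_eq_zero.mp h2.symm).resolve_right h3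
    simpa using h4

lemma casimir_eq_zero_of_lie {m : M} (h : ∀ x : s, ⁅x, m⁆ = 0) : casimir s M m = 0 := by
  simp [casimir_apply, h]

lemma casimir_eq_zero_of_invariant (h : IsLF s M) {m : M}
    (hm : ∀ x : s, ⁅x, casimir s M m⁆ = 0) : casimir s M m = 0 :=
  casimir_eq_zero_of_lie
    (lie_eq_zero_of_casimir_casimir h (casimir_eq_zero_of_lie hm))

lemma exists_invariant_add_casimir (h : IsLF s M) (m : M) :
    ∃ m₀ m' : M, (∀ x : s, ⁅x, m₀⁆ = 0) ∧ m = m₀ + casimir s M m' := by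
  obtain ⟨P, hP, hmP⟩ := h m
  have hPLF : IsLF s P := isLF_of_finiteDimensional
  let C : Module.End ℂ P := casimir s P
  have hdis : Disjoint (LinearMap.ker C) (LinearMap.range C) := by
    rw [Submodule.disjoint_def]
    rintro _ hx ⟨y, rfl⟩
    exact casimir_eq_zero_of_lie (lie_eq_zero_of_casimir_casimir hPLF hx)
  have htop : LinearMap.ker C ⊔ LinearMap.range C = ⊤ := by
    apply Submodule.eq_top_of_disjoint _ _ _ hdis
    rw [add_comm, LinearMap.finrank_range_add_finrank_ker]
  obtain ⟨a, ha, _, ⟨b, rfl⟩, hab⟩ :=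
    Submodule.mem_sup.mp (htop ▸ Submodule.mem_top : (⟨m, hmP⟩ : P) ∈ _)
  refine ⟨a, b, fun x => ?_, ?_⟩
  · have ha' : casimir s P a = 0 := ha
    have h2 := lie_eq_zero_of_casimir_casimir hPLF (m := a) (by rw [ha', map_zero]) x
    exact congrArg Subtype.val h2
  · have := congrArg Subtype.val hab
    rw [← casimir_coe]
    exact this.symm

/-- Invariants lift along surjections of locally finite modules. -/
lemma exists_invariant_lift (h : IsLF s M) (φ : M →ₗ⁅ℂ, s⁆ N) (hφ : Function.Surjective φ) {n : N}
    (hn : ∀ x : s, ⁅x, n⁆ = 0) : ∃ m : M, (∀ x : s, ⁅x, m⁆ = 0) ∧ φ m = n := by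
  obtain ⟨m, rfl⟩ := hφ n
  obtain ⟨m₀, m', h₀, rfl⟩ := exists_invariant_add_casimir h m
  refine ⟨m₀, h₀, ?_⟩
  rw [map_add, map_casimir, casimir_eq_zero_of_invariant (h.of_surjective φ hφ), add_zero]
  intro x
  have := hn x
  rwa [← LieModuleHom.map_lie, lie_add, h₀, zero_add, LieModuleHom.map_lie, map_casimir] at this

lemma lie_linearMap_eq_zero_iff {φ : M →ₗ[ℂ] N} :
    (∀ x : s, ⁅x, φ⁆ = 0) ↔ ∀ (x : s) (m : M), φ ⁅x, m⁆ = ⁅x, φ m⁆ := by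
  constructor
  · intro h x m
    have := congrArg (fun ψ : M →ₗ[ℂ] N => ψ m) (h x)
    simp only [LieHom.lie_apply, LinearMap.zero_apply, sub_eq_zero] at this
    exact this.symm
  · intro h x
    ext m
    simp [LieHom.lie_apply, h]

/-- An equivariant map from an invariant linear map. -/
def homOfInvariant (φ : M →ₗ[ℂ] N) (h : ∀ x : s, ⁅x, φ⁆ = 0) : M →ₗ⁅ℂ, s⁆ N :=
  { φ with map_lie' := fun {x m} => lie_linearMap_eq_zero_iff.mp h x m }

/-- Post-composition with an equivariant map. -/
def postcomp (Q : Type*) [AddCommGroup Q] [Module ℂ Q] [LieRingModule s Q] [LieModule ℂ s Q]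
    (φ : M →ₗ⁅ℂ, s⁆ N) : (Q →ₗ[ℂ] M) →ₗ⁅ℂ, s⁆ (Q →ₗ[ℂ] N) where
  toFun ψ := (φ : M →ₗ[ℂ] N) ∘ₗ ψ
  map_add' a b := LinearMap.comp_add _ _ _
  map_smul' c a := LinearMap.comp_smul _ _ _
  map_lie' := by
    intro x ψ
    ext q
    simp [LieHom.lie_apply]

lemma postcomp_surjective (Q : Type*) [AddCommGroup Q] [Module ℂ Q] [LieRingModule s Q]
    [LieModule ℂ s Q] (φ : M →ₗ⁅ℂ, s⁆ N) (hφ : Function.Surjective φ) :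
    Function.Surjective (postcomp Q φ) := by
  intro ψ
  obtain ⟨χ, hχ⟩ := Module.projective_lifting_property (φ : M →ₗ[ℂ] N) ψ hφ
  exact ⟨χ, hχ⟩

/-- Equivariant maps from a finite-dimensional module lift along surjections of locally finite
modules. -/
lemma exists_equivariant_lift {Q : Type*} [AddCommGroup Q] [Module ℂ Q] [LieRingModule s Q]
    [LieModule ℂ s Q] [FiniteDimensional ℂ Q] (h : IsLF s M) (φ : M →ₗ⁅ℂ, s⁆ N)
    (hφ : Function.Surjective φ) (w : Q →ₗ⁅ℂ, s⁆ N) :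
    ∃ v : Q →ₗ⁅ℂ, s⁆ M, φ.comp v = w := by
  obtain ⟨ψ, hψ, hψw⟩ := exists_invariant_lift h.hom (postcomp Q φ) (postcomp_surjective Q φ hφ)
    (n := (w : Q →ₗ[ℂ] N)) (lie_linearMap_eq_zero_iff.mpr fun x m => w.map_lie x m)
  refine ⟨homOfInvariant ψ hψ, ?_⟩
  ext q
  exact congrArg (fun f : Q →ₗ[ℂ] N => f q) hψw

/-- Casimir eigenvalues on locally finite modules are attained on finite-dimensional ones. -/
lemma IsCasEig.exists_finiteDimensional (h : IsLF s M) {c : ℂ} (hc : IsCasEig s M c) :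
    ∃ P : LieSubmodule ℂ s M, FiniteDimensional ℂ P ∧ P ≠ ⊥ ∧
      ∀ m ∈ P, casimir s M m = c • m := by
  obtain ⟨m, hm, hmc⟩ := hc
  obtain ⟨P, hP, hmP⟩ := h m
  let K := casKer s M (Polynomial.X - Polynomial.C c)
  refine ⟨P ⊓ K, ?_, ?_, ?_⟩
  · have : FiniteDimensional ℂ (P.toSubmodule ⊓ K.toSubmodule : Submodule ℂ M) :=
      Submodule.finiteDimensional_inf_left _ _
    rwa [← LieSubmodule.inf_toSubmodule] at this
  · intro h0
    have : m ∈ P ⊓ K := ⟨hmP, by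
      change casPoly s M _ m = 0
      rw [casPoly_X_sub_C, hmc, sub_self]⟩
    rw [h0] at this
    exact hm (by simpa using this)
  · rintro y ⟨-, hy⟩
    have hy' : casPoly s M _ y = 0 := hy
    rwa [casPoly_X_sub_C, sub_eq_zero] at hy'

lemma IsCasEig.real_of_isLF (h : IsLF s M) {c : ℂ} (hc : IsCasEig s M c) :
    0 ≤ c.re ∧ c = c.re := by
  obtain ⟨P, hP, hne, hPc⟩ := hc.exists_finiteDimensional h
  obtain ⟨m, hm, hm0⟩ := P.toSubmodule.ne_bot_iff.mp (by simpa using hne)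
  refine IsCasEig.real (s := s) (M := P) ⟨⟨m, hm⟩, fun h0 => hm0 (congrArg Subtype.val h0), ?_⟩
  apply Subtype.ext
  rw [casimir_coe, hPc m hm]; rfl

lemma exists_isCasEig_of_isLF (h : IsLF s M) [Nontrivial M] : ∃ c, IsCasEig s M c := by
  obtain ⟨m, hm⟩ := exists_ne (0 : M)
  obtain ⟨P, hP, hmP⟩ := h m
  have : Nontrivial P := ⟨⟨m, hmP⟩, 0, fun h0 => hm (congrArg Subtype.val h0)⟩
  obtain ⟨c, hc⟩ := exists_isCasEig (s := s) (M := P)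
  exact ⟨c, hc.of_injective P.incl Subtype.val_injective⟩

end Reductivity

end CasimirBound

namespace CasimirBound

open Module LieModule LieAlgebra LieAlgebra.IsKilling

section Traces

variable {V : Type*} [AddCommGroup V] [Module ℂ V]
variable {W : Type*} [AddCommGroup W] [Module ℂ W]

lemma re_trace_le [FiniteDimensional ℂ V] (f : Module.End ℂ V) {r : ℝ}
    (h : ∀ c, f.HasEigenvalue c → c.re ≤ r) :
    (LinearMap.trace ℂ V f).re ≤ r * finrank ℂ V := by
  have hs : f.charpoly.Splits := IsAlgClosed.splits _
  rw [Module.End.trace_eq_sum_roots_charpoly_of_splits hs]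
  have hcard : (Multiset.map Complex.reLm f.charpoly.roots).card = finrank ℂ V := by
    rw [Multiset.card_map, ← hs.natDegree_eq_card_roots, LinearMap.charpoly_natDegree]
  have h1 := Multiset.sum_le_card_nsmul (Multiset.map Complex.reLm f.charpoly.roots) r ?_
  · rw [hcard, nsmul_eq_mul, mul_comm, ← map_multiset_sum] at h1
    exact h1
  · intro x hx
    obtain ⟨c, hc, rfl⟩ := Multiset.mem_map.mp hx
    exact h c ((Module.End.hasEigenvalue_iff_isRoot_charpoly _ _).mpr
      (Polynomial.isRoot_of_mem_roots hc))

/-- Eigenvalues of a polynomial in an operator. -/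
lemma exists_eigenvalue_of_aeval [FiniteDimensional ℂ V] (f : Module.End ℂ V) (p : Polynomial ℂ)
    {c : ℂ} (h : (Polynomial.aeval f p).HasEigenvalue c) :
    ∃ d, f.HasEigenvalue d ∧ c = p.eval d := by
  obtain ⟨v, hv⟩ := h.exists_hasEigenvector
  let K := Module.End.eigenspace (Polynomial.aeval f p) c
  have hK : ∀ w ∈ K, f w ∈ K := by
    intro w hw
    rw [Module.End.mem_eigenspace_iff] at hw ⊢
    have : Commute (Polynomial.aeval f p) f := by
      simpa using Commute.map (Commute.all p Polynomial.X) (Polynomial.aeval f)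
    rw [← Module.End.mul_apply, this.eq, Module.End.mul_apply, hw, map_smul]
  have : Nontrivial K := ⟨⟨v, hv.1⟩, 0, fun h0 => hv.2 (congrArg Subtype.val h0)⟩
  obtain ⟨d, hd⟩ := Module.End.exists_eigenvalue (f.restrict hK)
  obtain ⟨w, hw⟩ := hd.exists_hasEigenvector
  have hfw : f w = d • (w : V) := congrArg Subtype.val hw.apply_eq_smul
  have hw0 : (w : V) ≠ 0 := fun h0 => hw.2 (Subtype.ext h0)
  have hev : f.HasEigenvector d w := ⟨Module.End.mem_eigenspace_iff.mpr hfw, hw0⟩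
  refine ⟨d, Module.End.hasEigenvalue_of_hasEigenvector hev, ?_⟩
  have h1 : Polynomial.aeval f p (w : V) = c • (w : V) := Module.End.mem_eigenspace_iff.mp w.2
  rw [Module.End.aeval_apply_of_hasEigenvector hev] at h1
  exact (smul_left_injective ℂ hw0 h1).symm

/-- The operator `φ ↦ a ∘ φ ∘ b`. -/
def sandwich (a : Module.End ℂ W) (b : Module.End ℂ V) : Module.End ℂ (V →ₗ[ℂ] W) where
  toFun φ := a ∘ₗ φ ∘ₗ b
  map_add' x y := by ext; simp
  map_smul' c x := by ext; simp

@[simp] lemma sandwich_apply (a : Module.End ℂ W) (b : Module.End ℂ V) (φ : V →ₗ[ℂ] W) (v : V) :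
    sandwich a b φ v = a (φ (b v)) := rfl

lemma trace_sandwich [FiniteDimensional ℂ V] [FiniteDimensional ℂ W] (a : Module.End ℂ W)
    (b : Module.End ℂ V) :
    LinearMap.trace ℂ _ (sandwich a b) = LinearMap.trace ℂ W a * LinearMap.trace ℂ V b := by
  have h : sandwich a b = (dualTensorHomEquiv ℂ V W).conj
      (TensorProduct.map (Module.Dual.transpose b) a) := by
    ext φ : 1
    obtain ⟨t, rfl⟩ := (dualTensorHomEquiv ℂ V W).surjective φ
    rw [LinearEquiv.conj_apply_apply, LinearEquiv.symm_apply_apply]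
    induction t using TensorProduct.induction_on with
    | zero => simp
    | add x y hx hy => simp only [map_add, hx, hy]
    | tmul f w =>
      ext v
      simp [dualTensorHomEquiv, Module.Dual.transpose_apply]
  rw [h, LinearMap.trace_conj', LinearMap.trace_tensorProduct', LinearMap.trace_transpose',
    mul_comm]

end Traces

section TOp

variable {s : Type*} [LieRing s] [LieAlgebra ℂ s] [FiniteDimensional ℂ s]
  [LieAlgebra.IsKilling ℂ s]
variable {X : Type*} [AddCommGroup X] [Module ℂ X]
variable {Y : Type*} [AddCommGroup Y] [Module ℂ Y]

/-- The contraction of the Casimir tensor against `L` and the coadjoint action. -/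
noncomputable def tOp (L : s →ₗ[ℂ] Module.End ℂ X) : Module.End ℂ (s →ₗ[ℂ] X) :=
  -∑ i, sandwich (L (bas s i)) (ad ℂ s (dbas s i))

lemma tOp_apply (L : s →ₗ[ℂ] Module.End ℂ X) (φ : s →ₗ[ℂ] X) (v : s) :
    tOp L φ v = -∑ i, L (bas s i) (φ ⁅dbas s i, v⁆) := by
  simp [tOp, LinearMap.sum_apply]

lemma tOp_sub (L R : s →ₗ[ℂ] Module.End ℂ X) : tOp (L - R) = tOp L - tOp R := by
  ext φ v
  simp only [tOp_apply, LinearMap.sub_apply, Finset.sum_sub_distrib]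
  abel

lemma tOp_natural {L : s →ₗ[ℂ] Module.End ℂ X} {L' : s →ₗ[ℂ] Module.End ℂ Y} (θ : X →ₗ[ℂ] Y)
    (h : ∀ x m, θ (L x m) = L' x (θ m)) (φ : s →ₗ[ℂ] X) :
    θ ∘ₗ tOp L φ = tOp L' (θ ∘ₗ φ) := by
  ext v
  simp [tOp_apply, h]

lemma aeval_tOp_natural {L : s →ₗ[ℂ] Module.End ℂ X} {L' : s →ₗ[ℂ] Module.End ℂ Y}
    (θ : X →ₗ[ℂ] Y) (h : ∀ x m, θ (L x m) = L' x (θ m)) (p : Polynomial ℂ) (φ : s →ₗ[ℂ] X) :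
    θ ∘ₗ (Polynomial.aeval (tOp L) p φ) = Polynomial.aeval (tOp L') p (θ ∘ₗ φ) := by
  induction p using Polynomial.induction_on generalizing φ with
  | C a => simp [Polynomial.aeval_C, Module.algebraMap_end_apply, LinearMap.comp_smul]
  | add p q hp hq => simp [hp, hq, LinearMap.comp_add]
  | monomial n a ih =>
    rw [pow_succ, ← mul_assoc, map_mul _ (_ * _) Polynomial.X, map_mul _ (_ * _) Polynomial.X,
      Module.End.mul_apply, Module.End.mul_apply, ih, Polynomial.aeval_X, Polynomial.aeval_X,
      tOp_natural θ h]

variable [LieRingModule s X] [LieModule ℂ s X]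

/-- Equivariance of a family of operators indexed by `s`. -/
def IsEquivariant (L : s →ₗ[ℂ] Module.End ℂ X) : Prop :=
  ∀ (x y : s) (m : X), ⁅x, L y m⁆ = L ⁅x, y⁆ m + L y ⁅x, m⁆

/-- `tOp` as an equivariant map. -/
noncomputable def tHom (L : s →ₗ[ℂ] Module.End ℂ X) (hL : IsEquivariant L) :
    (s →ₗ[ℂ] X) →ₗ⁅ℂ, s⁆ (s →ₗ[ℂ] X) where
  toLinearMap := tOp L
  map_lie' := by
    intro z φ
    ext v
    have h := sum_lie_casimir (LinearMap.mk₂ ℂ (fun x y : s => L x (φ ⁅y, v⁆))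
      (fun _ _ _ => by simp) (fun _ _ _ => by simp) (fun _ _ _ => by simp)
      (fun _ _ _ => by simp)) z
    simp only [LinearMap.mk₂_apply] at h
    change tOp L ⁅z, φ⁆ v = ⁅z, tOp L φ⁆ v
    rw [LieHom.lie_apply]
    simp only [tOp_apply, LieHom.lie_apply, lie_neg, lie_sum, hL _ _ _, map_sub]
    rw [← sub_eq_zero, ← h, sub_neg_eq_add, ← sub_eq_zero]
    simp only [← Finset.sum_neg_distrib, ← Finset.sum_sub_distrib, ← Finset.sum_add_distrib]
    refine Finset.sum_eq_zero fun i _ => ?_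
    rw [lie_lie z, map_sub, map_sub]
    abel

variable (s X) in
/-- The action as a linear map. -/
noncomputable def actLin : s →ₗ[ℂ] Module.End ℂ X := toEnd ℂ s X

@[simp] lemma actLin_apply (x : s) (m : X) : actLin s X x m = ⁅x, m⁆ := rfl

lemma casimir_hom (φ : s →ₗ[ℂ] X) :
    casimir s (s →ₗ[ℂ] X) φ =
      (casimir s X : X →ₗ[ℂ] X) ∘ₗ φ + φ + (2 : ℂ) • tOp (actLin s X) φ := by
  ext v
  have h1 := sum_swap (LinearMap.mk₂ ℂ (fun x y : s => ⁅x, φ ⁅y, v⁆⁆)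
      (fun _ _ _ => by simp) (fun _ _ _ => by simp) (fun _ _ _ => by simp)
      (fun _ _ _ => by simp))
  have h2 := sum_swap (LinearMap.mk₂ ℂ (fun x y : s => φ ⁅x, ⁅y, v⁆⁆)
      (fun _ _ _ => by simp) (fun _ _ _ => by simp) (fun _ _ _ => by simp)
      (fun _ _ _ => by simp))
  simp only [LinearMap.mk₂_apply] at h1 h2
  have h3 : ∑ i, φ ⁅bas s i, ⁅dbas s i, v⁆⁆ = φ v := by
    rw [← map_sum, ← casimir_apply, casimir_adjoint]
  rw [h3] at h2
  have h4 : casimir s X (φ v) = ∑ i, ⁅bas s i, ⁅dbas s i, φ v⁆⁆ := casimir_apply s _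
  rw [casimir_apply]
  simp only [LinearMap.sum_apply, LieHom.lie_apply, lie_sub, LinearMap.add_apply,
    LinearMap.smul_apply, tOp_apply, actLin_apply, LinearMap.comp_apply,
    Finset.sum_sub_distrib, h1, h2]
  change _ = casimir s X (φ v) + _ + _
  rw [h4, two_smul]
  abel

lemma trace_ad (x : s) : LinearMap.trace ℂ s (ad ℂ s x) = 0 := by
  rw [← casimir_adjoint s x, casimir_apply, map_sum, map_sum]
  refine Finset.sum_eq_zero fun i _ => ?_
  have h : ∀ a b : s, ad ℂ s ⁅a, b⁆ = ad ℂ s a * ad ℂ s b - ad ℂ s b * ad ℂ s a := by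
    intro a b
    ext c
    simp
  rw [h, map_sub, LinearMap.trace_mul_comm, sub_self]

lemma trace_tOp [FiniteDimensional ℂ X] : LinearMap.trace ℂ _ (tOp (actLin s X)) = 0 := by
  simp [tOp, trace_sandwich, trace_ad]

lemma trace_tOp_mul_tOp [FiniteDimensional ℂ X] :
    LinearMap.trace ℂ _ (tOp (actLin s X) * tOp (actLin s X)) =
      LinearMap.trace ℂ X (casimir s X : X →ₗ[ℂ] X) := by
  have h : tOp (actLin s X) * tOp (actLin s X) = ∑ i, ∑ j,
      sandwich (actLin s X (bas s i) * actLin s X (bas s j))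
        (ad ℂ s (dbas s j) * ad ℂ s (dbas s i)) := by
    ext φ v
    simp [tOp_apply, LinearMap.sum_apply, lie_sum]
  have hc : (casimir s X : X →ₗ[ℂ] X) =
      ∑ i, actLin s X (bas s i) * actLin s X (dbas s i) := rfl
  rw [h, hc, map_sum, map_sum]
  refine Finset.sum_congr rfl fun i _ => ?_
  conv_rhs => rw [← sum_killingForm_smul_bas (dbas s i)]
  rw [map_sum, map_sum, Finset.mul_sum, map_sum]
  refine Finset.sum_congr rfl fun j _ => ?_
  rw [trace_sandwich, map_smul, mul_smul_comm, map_smul, smul_eq_mul, mul_comm]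
  rfl

end TOp

end CasimirBound

namespace CasimirBound

open Module LieModule LieAlgebra LieAlgebra.IsKilling

section KeyBound

variable {s : Type*} [LieRing s] [LieAlgebra ℂ s] [FiniteDimensional ℂ s]
  [LieAlgebra.IsKilling ℂ s]

lemma IsWt.exists_of_hom {H : LieSubalgebra ℂ s} [H.IsCartanSubalgebra]
    {X : Type*} [AddCommGroup X] [Module ℂ X] [LieRingModule s X] [LieModule ℂ s X]
    {ρ : ℝ} (hρ0 : 0 ≤ ρ) (hρ : ∀ α : H.root, ‖pairVec H (rootLin H α)‖ ≤ ρ)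
    {ξ : Dual ℂ H} (h : IsWt H (s →ₗ[ℂ] X) ξ) :
    ∃ ν : Dual ℂ H, IsWt H X ν ∧ ‖pairVec H ξ‖ ≤ ‖pairVec H ν‖ + ρ := by
  obtain ⟨φ, hφ, hw⟩ := h
  have hw' : ∀ (h : H) (v : s), ⁅(h : s), φ v⁆ = ξ h • φ v + φ ⁅(h : s), v⁆ := by
    intro h v
    have := congrArg (fun f : s →ₗ[ℂ] X => f v) (hw h)
    simp only [LieHom.lie_apply, LinearMap.smul_apply] at this
    rw [← this, sub_add_cancel]
  by_contra! hcon
  apply hφ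
  ext v
  refine root_induction (H := H) (p := fun v => φ v = 0) ?_ ?_ ?_ ?_ v
  · intro h'
    by_contra h0
    have h1 := hcon ξ ⟨φ h', h0, fun h => by
      have : ⁅(h : s), (h' : s)⁆ = 0 := by
        have := congrArg Subtype.val (trivial_lie_zero H H h h')
        simpa using this
      rw [hw', this, map_zero, add_zero]⟩
    linarith
  · intro α
    by_contra h0
    have h1 := hcon (ξ + rootLin H α) ⟨φ (evec α), h0, fun h => by
      rw [hw', lie_evec, map_smul, LinearMap.add_apply, add_smul]⟩
    have h2 : ‖pairVec H ξ‖ ≤ ‖pairVec H (ξ + rootLin H α)‖ + ‖pairVec H (rootLin H α)‖ := by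
      have := norm_sub_le (pairVec H (ξ + rootLin H α)) (pairVec H (rootLin H α))
      rwa [map_add, add_sub_cancel_right, ← map_add] at this
    have := hρ α
    linarith
  · intro x y hx hy; rw [map_add, hx, hy, add_zero]
  · intro c x hx; rw [map_smul, hx, smul_zero]

variable {M : Type*} [AddCommGroup M] [Module ℂ M] [LieRingModule s M] [LieModule ℂ s M]
variable {Q : Type*} [AddCommGroup Q] [Module ℂ Q] [LieRingModule s Q] [LieModule ℂ s Q]

variable (Q) in
/-- Post-composition with an equivariant endomorphism, on equivariant maps. -/
def compEnd (f : M →ₗ⁅ℂ, s⁆ M) : Module.End ℂ (Q →ₗ⁅ℂ, s⁆ M) where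
  toFun w := f.comp w
  map_add' a b := by ext; simp
  map_smul' c a := by ext; simp

lemma exists_eigenvector_of_compEnd (f : M →ₗ⁅ℂ, s⁆ M) {c : ℂ}
    (h : (compEnd Q f).HasEigenvalue c) : ∃ m : M, m ≠ 0 ∧ f m = c • m := by
  obtain ⟨w, hw⟩ := h.exists_hasEigenvector
  have : ∃ q, w q ≠ 0 := by
    by_contra! hcon
    exact hw.2 (by ext q; simp [hcon q])
  obtain ⟨q, hq⟩ := this
  exact ⟨w q, hq, congrArg (fun v : Q →ₗ⁅ℂ, s⁆ M => v q) hw.apply_eq_smul⟩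

lemma isRoot_of_tHom_eigenvector {X : Type*} [AddCommGroup X] [Module ℂ X]
    {L : s →ₗ[ℂ] Module.End ℂ X} {p : Polynomial ℂ}
    (hp : ∀ φ : s →ₗ[ℂ] X, Polynomial.aeval (tOp L) p φ = 0) {φ : s →ₗ[ℂ] X} (hφ : φ ≠ 0) {c : ℂ}
    (h : tOp L φ = c • φ) : p.IsRoot c := by
  have h1 := Module.End.aeval_apply_of_hasEigenvector (p := p)
    (⟨Module.End.mem_eigenspace_iff.mpr h, hφ⟩ : (tOp L).HasEigenvector c φ)
  rw [hp] at h1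
  exact (smul_eq_zero.mp h1.symm).resolve_right hφ

end KeyBound

section Bimodule

universe u

variable {s : Type u} [LieRing s] [LieAlgebra ℂ s] [FiniteDimensional ℂ s]
  [LieAlgebra.IsKilling ℂ s]

/-- All spaces of equivariant maps from finite-dimensional modules are finite-dimensional. -/
def IsAdm (s : Type u) [LieRing s] [LieAlgebra ℂ s] (M : Type u) [AddCommGroup M] [Module ℂ M]
    [LieRingModule s M] [LieModule ℂ s M] : Prop :=
  ∀ (Q : Type u) [AddCommGroup Q] [Module ℂ Q] [LieRingModule s Q] [LieModule ℂ s Q]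
    [FiniteDimensional ℂ Q], FiniteDimensional ℂ (Q →ₗ⁅ℂ, s⁆ M)

/-- Pairs of commuting left and right actions whose difference is the Lie action, together with
polynomial relations for the associated operators. -/
structure IsBoundedBimodule (X : Type u) [AddCommGroup X] [Module ℂ X] [LieRingModule s X]
    [LieModule ℂ s X] (L R : s →ₗ[ℂ] Module.End ℂ X) (b : ℝ) : Prop where
  isLF : IsLF s X
  isAdm : IsAdm s (s →ₗ[ℂ] X)
  left : IsEquivariant L
  right : IsEquivariant R
  sub : ∀ x m, ⁅x, m⁆ = L x m - R x m
  left_poly : ∃ p : Polynomial ℂ, (∀ φ : s →ₗ[ℂ] X, Polynomial.aeval (tOp L) p φ = 0) ∧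
    ∀ c, p.IsRoot c → -b ≤ c.re
  right_poly : ∃ p : Polynomial ℂ, (∀ φ : s →ₗ[ℂ] X, Polynomial.aeval (tOp R) p φ = 0) ∧
    ∀ c, p.IsRoot c → c.re ≤ b

variable {X : Type u} [AddCommGroup X] [Module ℂ X] [LieRingModule s X] [LieModule ℂ s X]
  {L R : s →ₗ[ℂ] Module.End ℂ X} {b : ℝ}

lemma IsBoundedBimodule.le_of_isCasEig (h : IsBoundedBimodule X L R b) {c₀ : ℝ}
    (h0 : ∀ c, IsCasEig s X c → c₀ - 1 ≤ c.re) {c₁ : ℂ} (h1 : IsCasEig s (s →ₗ[ℂ] X) c₁) :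
    c₀ - 4 * b ≤ c₁.re := by
  obtain ⟨P, hP, hPne, hPc⟩ := h1.exists_finiteDimensional h.isLF.hom
  have hfd : FiniteDimensional ℂ (P →ₗ⁅ℂ, s⁆ (s →ₗ[ℂ] X)) := h.isAdm P
  have hpos : 0 < finrank ℂ (P →ₗ⁅ℂ, s⁆ (s →ₗ[ℂ] X)) := by
    have : Nontrivial (P →ₗ⁅ℂ, s⁆ (s →ₗ[ℂ] X)) := by
      obtain ⟨m, hm, hm0⟩ := P.toSubmodule.ne_bot_iff.mp (by simpa using hPne)
      refine ⟨P.incl, 0, fun hz => hm0 ?_⟩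
      exact congrArg (fun w : P →ₗ⁅ℂ, s⁆ (s →ₗ[ℂ] X) => w ⟨m, hm⟩) hz
    exact finrank_pos
  obtain ⟨p, hp, hpb⟩ := h.left_poly
  obtain ⟨q, hq, hqb⟩ := h.right_poly
  let TL := compEnd P (tHom L h.left)
  let TR := compEnd P (tHom R h.right)
  let G := compEnd P (postcomp s (casimir s X))
  have hG : G = (c₁ - 1) • 1 - (2 : ℂ) • TL + (2 : ℂ) • TR := by
    ext w y : 2
    have h2 := casimir_hom (s := s) (X := X) (w y)
    have hsub : actLin s X = L - R := by
      ext x m; exact h.sub x m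
    have h3 : casimir s P y = c₁ • y := Subtype.ext (by rw [casimir_coe, hPc _ y.2]; rfl)
    rw [← map_casimir, hsub, tOp_sub, h3, map_smul] at h2
    change (casimir s X : X →ₗ[ℂ] X) ∘ₗ w y = (c₁ - 1) • w y - (2 : ℂ) • tOp L (w y) +
      (2 : ℂ) • tOp R (w y)
    rw [sub_smul, h2, one_smul, LinearMap.sub_apply, smul_sub]
    abel
  have htL := re_trace_le (-TL) (r := b) ?_
  have htR := re_trace_le TR (r := b) ?_
  have htG := re_trace_le (-G) (r := 1 - c₀) ?_
  · have htr := congrArg (fun f => (LinearMap.trace ℂ _ f).re) hG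
    simp only [map_add, map_sub, map_smul, LinearMap.trace_one, smul_eq_mul, Complex.add_re,
      Complex.sub_re, Complex.mul_re, Complex.re_ofNat, Complex.im_ofNat, zero_mul,
      Complex.natCast_re, Complex.natCast_im, mul_zero, sub_zero, Complex.one_re] at htr
    rw [map_neg, Complex.neg_re] at htL htG
    have hpos' : (0 : ℝ) < finrank ℂ (P →ₗ⁅ℂ, s⁆ (s →ₗ[ℂ] X)) := by exact_mod_cast hpos
    by_contra! hcon
    nlinarith
  · intro c hc
    have hc' : (G).HasEigenvalue (-c) := by
      obtain ⟨w, hw⟩ := hc.exists_hasEigenvector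
      refine Module.End.hasEigenvalue_of_hasEigenvector
        (x := w) ⟨Module.End.mem_eigenspace_iff.mpr ?_, hw.2⟩
      rw [neg_smul, ← hw.apply_eq_smul]; simp
    obtain ⟨φ, hφ, hφc⟩ := exists_eigenvector_of_compEnd _ hc'
    have : ∃ v, φ v ≠ 0 := by
      by_contra! hcon
      exact hφ (LinearMap.ext hcon)
    obtain ⟨v, hv⟩ := this
    have := h0 (-c) ⟨φ v, hv, congrArg (fun f : s →ₗ[ℂ] X => f v) hφc⟩
    rw [Complex.neg_re] at this
    linarith
  · intro c hc
    obtain ⟨φ, hφ, hφc⟩ := exists_eigenvector_of_compEnd _ hc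
    exact hqb c (isRoot_of_tHom_eigenvector hq hφ hφc)
  · intro c hc
    have hc' : (TL).HasEigenvalue (-c) := by
      obtain ⟨w, hw⟩ := hc.exists_hasEigenvector
      refine Module.End.hasEigenvalue_of_hasEigenvector
        (x := w) ⟨Module.End.mem_eigenspace_iff.mpr ?_, hw.2⟩
      rw [neg_smul, ← hw.apply_eq_smul]; simp
    obtain ⟨φ, hφ, hφc⟩ := exists_eigenvector_of_compEnd _ hc'
    have := hpb _ (isRoot_of_tHom_eigenvector hp hφ hφc)
    rw [Complex.neg_re] at this
    linarith

/-- Trace estimate for the Casimir eigenvalue of an isotypic module in terms of spectral bounds of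
`tOp`. -/
lemma le_of_tOp_bounds {Y : Type*} [AddCommGroup Y] [Module ℂ Y] [LieRingModule s Y]
    [LieModule ℂ s Y] [FiniteDimensional ℂ Y] [Nontrivial Y] {c₀ m Λ : ℝ}
    (hc : ∀ y : Y, casimir s Y y = (c₀ : ℂ) • y)
    (hT : ∀ σ, (tOp (actLin s Y)).HasEigenvalue σ → σ.im = 0 ∧ -m ≤ σ.re ∧ σ.re ≤ Λ) :
    c₀ ≤ m * Λ * finrank ℂ s := by
  let S := tOp (actLin s Y)
  let p : Polynomial ℂ := (Polynomial.X + Polynomial.C (m : ℂ)) *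
    (Polynomial.X - Polynomial.C (Λ : ℂ))
  have h1 := re_trace_le (Polynomial.aeval S p) (r := 0) ?_
  · have h2 : Polynomial.aeval S p = S * S + ((m - Λ : ℝ) : ℂ) • S - ((m * Λ : ℝ) : ℂ) • 1 := by
      simp only [p, map_mul, map_add, map_sub, Polynomial.aeval_X, Polynomial.aeval_C,
        Algebra.algebraMap_eq_smul_one, Complex.ofReal_sub, Complex.ofReal_mul]
      ext φ v
      simp only [add_mul, mul_sub, smul_mul_assoc, mul_smul_comm, one_mul, mul_one,
        LinearMap.add_apply, LinearMap.sub_apply, LinearMap.smul_apply, sub_smul]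
      module
    have hcas : (casimir s Y : Y →ₗ[ℂ] Y) = (c₀ : ℂ) • LinearMap.id := LinearMap.ext hc
    rw [h2, map_sub, map_add, trace_tOp_mul_tOp, map_smul, trace_tOp, hcas, map_smul, map_smul,
      LinearMap.trace_one, LinearMap.trace_id, finrank_linearMap, smul_zero, add_zero, zero_mul,
      smul_eq_mul, smul_eq_mul, Complex.sub_re, Complex.re_ofReal_mul, Complex.re_ofReal_mul,
      Complex.natCast_re, Complex.natCast_re] at h1
    have hpos : (0 : ℝ) < finrank ℂ Y := by exact_mod_cast finrank_pos
    push_cast at h1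
    by_contra! hcon
    nlinarith
  · intro c hc'
    obtain ⟨σ, hσ, rfl⟩ := exists_eigenvalue_of_aeval _ _ hc'
    obtain ⟨him, h1, h2⟩ := hT σ hσ
    simp only [p, Polynomial.eval_mul, Polynomial.eval_add, Polynomial.eval_sub, Polynomial.eval_X,
      Polynomial.eval_C, Complex.mul_re, Complex.add_re, Complex.sub_re, Complex.ofReal_re,
      Complex.add_im, Complex.sub_im, Complex.ofReal_im, him]
    nlinarith

variable (s) in
/-- Uniform bound for the smallest Casimir eigenvalue of bounded bimodules. -/
theorem exists_isCasEig_bound (b : ℝ) (hb : 0 ≤ b) : ∃ r : ℝ, ∀ (X : Type u) [AddCommGroup X]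
    [Module ℂ X] [LieRingModule s X] [LieModule ℂ s X] [Nontrivial X]
    (L R : s →ₗ[ℂ] Module.End ℂ X), IsBoundedBimodule X L R b →
    ∃ c, IsCasEig s X c ∧ c.re ≤ r := by
  obtain ⟨H, hH⟩ := exists_cartan s
  obtain ⟨ρ, hρ0, hρ⟩ : ∃ ρ : ℝ, 0 ≤ ρ ∧ ∀ α : H.root, ‖pairVec H (rootLin H α)‖ ≤ ρ :=
    ⟨∑ α : H.root, ‖pairVec H (rootLin H α)‖, by positivity, fun α =>
      Finset.single_le_sum (f := fun α : H.root => ‖pairVec H (rootLin H α)‖)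
        (fun _ _ => norm_nonneg _) (Finset.mem_univ α)⟩
  let n : ℝ := Fintype.card H.root
  have hn : 0 ≤ n := Nat.cast_nonneg _
  let m : ℝ := 2 * b + 1 / 2
  let d : ℝ := finrank ℂ s
  have hd : 0 ≤ d := Nat.cast_nonneg _
  let A : ℝ := m * d * (ρ + n / 2)
  let B : ℝ := m * d * (ρ ^ 2 + n * ρ) / 2
  refine ⟨(A + B + 1) ^ 2, ?_⟩
  intro X _ _ _ _ _ L R h
  let E : Set ℝ := {r | IsCasEig s X (r : ℂ)}
  have hE : ∀ c, IsCasEig s X c → c.re ∈ E := by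
    intro c hc
    have := (hc.real_of_isLF h.isLF).2
    change IsCasEig s X (c.re : ℂ)
    rwa [← this]
  have hE0 : ∀ r ∈ E, 0 ≤ r := fun r hr => (hr.real_of_isLF h.isLF).1
  obtain ⟨c, hc⟩ := exists_isCasEig_of_isLF h.isLF
  obtain ⟨c₀, hc₀, hlt⟩ := exists_lt_of_csInf_lt (s := E) (b := sInf E + 1) ⟨_, hE c hc⟩
    (by linarith)
  have hmin : ∀ c, IsCasEig s X c → c₀ - 1 ≤ c.re := by
    intro c hc
    have := csInf_le ⟨0, hE0⟩ (hE c hc)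
    linarith
  refine ⟨c₀, hc₀, ?_⟩
  rw [Complex.ofReal_re]
  have hc₀0 : 0 ≤ c₀ := hE0 _ hc₀
  obtain ⟨P, hP, hPne, hPc⟩ := hc₀.exists_finiteDimensional h.isLF
  have hPc' : ∀ y : P, casimir s P y = (c₀ : ℂ) • y := fun y =>
    Subtype.ext (by rw [casimir_coe, hPc _ y.2]; rfl)
  have hPnt : Nontrivial P := by
    obtain ⟨y, hy, hy0⟩ := P.toSubmodule.ne_bot_iff.mp (by simpa using hPne)
    exact ⟨⟨y, hy⟩, 0, fun h0 => hy0 (congrArg Subtype.val h0)⟩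
  let t := √c₀
  have ht : t ^ 2 = c₀ := Real.sq_sqrt hc₀0
  have ht0 : 0 ≤ t := Real.sqrt_nonneg _
  let Λ : ℝ := (ρ + n / 2) * t + (ρ ^ 2 + n * ρ) / 2
  have hle := le_of_tOp_bounds (s := s) (Y := P) (m := m) (Λ := Λ) hPc' ?_
  · have h1 : t ^ 2 ≤ A * t + B := by
      rw [ht]
      refine hle.trans (le_of_eq ?_)
      simp only [A, B, Λ, d]
      ring
    have hA : 0 ≤ A := by positivity
    have hB : 0 ≤ B := by positivity
    have h2 : t ≤ A + B + 1 := by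
      by_contra! hcon
      nlinarith
    rw [← ht]
    gcongr
  · intro σ hσ
    obtain ⟨φ, hφ⟩ := hσ.exists_hasEigenvector
    have hcas : casimir s (s →ₗ[ℂ] P) φ = ((c₀ : ℂ) + 1 + 2 * σ) • φ := by
      have hc' : (casimir s P : P →ₗ[ℂ] P) = (c₀ : ℂ) • LinearMap.id := LinearMap.ext hPc'
      rw [casimir_hom, hφ.apply_eq_smul, hc', LinearMap.smul_comp, LinearMap.id_comp]
      module
    have heig : IsCasEig s (s →ₗ[ℂ] P) ((c₀ : ℂ) + 1 + 2 * σ) := ⟨φ, hφ.2, hcas⟩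
    have hreal := heig.real
    have him : σ.im = 0 := by
      have := congrArg Complex.im hreal.2
      simpa using this
    have hre : ((c₀ : ℂ) + 1 + 2 * σ).re = c₀ + 1 + 2 * σ.re := by simp
    refine ⟨him, ?_, ?_⟩
    · have hX : IsCasEig s (s →ₗ[ℂ] X) ((c₀ : ℂ) + 1 + 2 * σ) := by
        refine heig.of_injective (postcomp s P.incl) ?_
        intro a b hab
        ext v
        exact congrArg (fun f : s →ₗ[ℂ] X => f v) hab
      have := h.le_of_isCasEig hmin hX
      rw [hre] at this
      simp only [m]
      linarith
    · obtain ⟨ξ, hξ, hξc⟩ := heig.eq_casVal (H := H)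
      have h1 := congrArg Complex.re hξc
      rw [hre, Complex.ofReal_re] at h1
      obtain ⟨ν, hν, hle⟩ := hξ.exists_of_hom hρ0 hρ
      have hν2 := hν.norm_sq_le (r := c₀) (by
        rintro c ⟨y, hy, hyc⟩
        rw [hPc'] at hyc
        rw [← smul_left_injective ℂ hy hyc]
        simp)
      have hν3 : ‖pairVec H ν‖ ≤ t := Real.le_sqrt_of_sq_le hν2
      have h2 := casVal_le ξ
      have h3 : ‖pairVec H ξ‖ ≤ t + ρ := by linarith
      have h4 : ‖pairVec H ξ‖ ^ 2 ≤ (t + ρ) ^ 2 := by gcongr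
      have h5 : n * ‖pairVec H ξ‖ ≤ n * (t + ρ) := by gcongr
      simp only [Λ]
      change casVal ξ ≤ _ + n * _ at h2
      nlinarith

end Bimodule

end CasimirBound

namespace CasimirBound

section Ordered

variable {k : Type*} [Field k] {B : Type*} [Ring B] [Algebra k B] {ι : Type*} (x : ι → B)

variable (k) in
/-- The span of `1` and the generators. -/
def genSpan : Submodule k B := 1 ⊔ Submodule.span k (Set.range x)

variable (k) in
/-- The filtration by powers of `genSpan`, shifted by one. -/
def filt : ℕ → Submodule k B
  | 0 => ⊥
  | d + 1 => genSpan k x ^ d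

lemma one_le_genSpan : 1 ≤ genSpan k x := le_sup_left

lemma mem_genSpan (i : ι) : x i ∈ genSpan k x :=
  (le_sup_right : _ ≤ genSpan k x) (Submodule.subset_span ⟨i, rfl⟩)

lemma genSpan_pow_mono {a b : ℕ} (h : a ≤ b) : genSpan k x ^ a ≤ genSpan k x ^ b :=
  pow_le_pow_right' (one_le_genSpan x) h

lemma filt_mono : Monotone (filt k x) := by
  apply monotone_nat_of_le_succ
  intro d
  cases d with
  | zero => exact bot_le
  | succ d => exact genSpan_pow_mono x (Nat.le_succ d)

lemma mul_mem_filt {a b : B} {d : ℕ} (ha : a ∈ genSpan k x) (hb : b ∈ filt k x d) :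
    a * b ∈ filt k x (d + 1) := by
  cases d with
  | zero =>
    have : b = 0 := hb
    rw [this, mul_zero]; exact Submodule.zero_mem _
  | succ d =>
    change _ ∈ genSpan k x ^ (d + 1)
    rw [pow_succ']
    exact Submodule.mul_mem_mul ha hb

lemma list_prod_mem (l : List ι) : (l.map x).prod ∈ genSpan k x ^ l.length := by
  induction l with
  | nil => simpa using ⟨1, map_one _⟩
  | cons i l ih =>
    rw [List.map_cons, List.prod_cons, List.length_cons, pow_succ']
    exact Submodule.mul_mem_mul (mem_genSpan x i) ih

variable (hx : ∀ i j, x i * x j - x j * x i ∈ genSpan k x)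

include hx in
lemma list_prod_sub_mem_of_perm {l l' : List ι} (h : l.Perm l') :
    (l.map x).prod - (l'.map x).prod ∈ filt k x l.length := by
  induction h with
  | nil => simp [filt]
  | cons i h ih =>
    rw [List.map_cons, List.map_cons, List.prod_cons, List.prod_cons, ← mul_sub]
    exact mul_mem_filt x (mem_genSpan x i) ih
  | swap i j l =>
    simp only [List.map_cons, List.prod_cons, ← mul_assoc, ← sub_mul, List.length_cons]
    change _ ∈ genSpan k x ^ (l.length + 1)
    rw [pow_succ']
    exact Submodule.mul_mem_mul (hx j i) (list_prod_mem x l)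
  | trans h₁ h₂ ih₁ ih₂ =>
    rw [← h₁.length_eq] at ih₂
    have := Submodule.add_mem _ ih₁ ih₂
    rwa [sub_add_sub_cancel] at this

/-- A product of generators prescribed by a multiset. -/
noncomputable def ord (m : Multiset ι) : B := (m.toList.map x).prod

lemma ord_mem (m : Multiset ι) : ord x m ∈ genSpan k x ^ m.card := by
  simpa [ord] using list_prod_mem (k := k) x m.toList

include hx in
lemma list_prod_sub_ord (l : List ι) : (l.map x).prod - ord x (l : Multiset ι) ∈
    filt k x l.length :=
  list_prod_sub_mem_of_perm x hx (Multiset.coe_eq_coe.mp (by simp))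

include hx in
lemma mul_ord_sub_ord (i : ι) (m : Multiset ι) :
    x i * ord x m - ord x (i ::ₘ m) ∈ filt k x (m.card + 1) := by
  have h := list_prod_sub_ord x hx (i :: m.toList)
  simpa [ord, ← Multiset.cons_coe] using h

include hx in
lemma genSpan_pow_le_span (d : ℕ) :
    genSpan k x ^ d ≤ Submodule.span k (ord x '' {m | m.card ≤ d}) := by
  induction d with
  | zero =>
    rw [pow_zero, Submodule.one_eq_span, Submodule.span_le]
    rintro _ rfl
    exact Submodule.subset_span ⟨0, by simp, by simp [ord]⟩
  | succ d ih =>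
    have hmono : Submodule.span k (ord x '' {m | m.card ≤ d}) ≤
        Submodule.span k (ord x '' {m | m.card ≤ d + 1}) :=
      Submodule.span_mono (Set.image_mono fun m hm => Nat.le_succ_of_le hm)
    rw [pow_succ', genSpan, Submodule.sup_mul, one_mul, ← genSpan]
    refine sup_le (ih.trans hmono) ?_
    refine (mul_le_mul_right ih _).trans ?_
    rw [Submodule.span_mul_span, Submodule.span_le]
    rintro _ ⟨_, ⟨i, rfl⟩, _, ⟨m, hm, rfl⟩, rfl⟩
    have h1 : ord x (i ::ₘ m) ∈ Submodule.span k (ord x '' {m | m.card ≤ d + 1}) :=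
      Submodule.subset_span ⟨_, by simpa using hm, rfl⟩
    have h2 := hmono (ih (genSpan_pow_mono x hm (mul_ord_sub_ord x hx i m)))
    have := Submodule.add_mem _ h1 h2
    rwa [add_sub_cancel] at this

lemma exists_mem_genSpan_pow (hgen : Algebra.adjoin k (Set.range x) = ⊤) (b : B) :
    ∃ d, b ∈ genSpan k x ^ d := by
  have hb : b ∈ Algebra.adjoin k (Set.range x) := by rw [hgen]; trivial
  induction hb using Algebra.adjoin_induction with
  | mem y hy =>
    obtain ⟨i, rfl⟩ := hy
    exact ⟨1, by rw [pow_one]; exact mem_genSpan x i⟩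
  | algebraMap r => exact ⟨0, by rw [pow_zero]; exact Submodule.algebraMap_mem r⟩
  | add a b _ _ ha hb =>
    obtain ⟨d, ha⟩ := ha
    obtain ⟨e, hb⟩ := hb
    exact ⟨max d e, Submodule.add_mem _ (genSpan_pow_mono x (le_max_left _ _) ha)
      (genSpan_pow_mono x (le_max_right _ _) hb)⟩
  | mul a b _ _ ha hb =>
    obtain ⟨d, ha⟩ := ha
    obtain ⟨e, hb⟩ := hb
    exact ⟨d + e, by rw [pow_add]; exact Submodule.mul_mem_mul ha hb⟩

include hx in
/-- An algebra generated by finitely many integral elements whose commutators lie in the span of the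
generators and `1` is finite-dimensional. -/
theorem finiteDimensional_of_isIntegral [Fintype ι]
    (hgen : Algebra.adjoin k (Set.range x) = ⊤) (h_integral : ∀ i, IsIntegral k (x i)) :
    FiniteDimensional k B := by
  classical
  let N : ι → ℕ := fun i => (minpoly k (x i)).natDegree
  have hN : ∀ i, x i ^ N i ∈ filt k x (N i) := by
    intro i
    have h0 := minpoly.aeval k (x i)
    rw [Polynomial.aeval_eq_sum_range, Finset.sum_range_succ,
      (minpoly.monic (h_integral i)).coeff_natDegree, one_smul, add_eq_zero_iff_neg_eq] at h0
    change x i ^ (minpoly k (x i)).natDegree ∈ _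
    rw [← h0]
    refine Submodule.neg_mem _ (Submodule.sum_mem _ fun j hj => Submodule.smul_mem _ _ ?_)
    have hj' := Finset.mem_range.mp hj
    refine filt_mono x (Nat.succ_le_of_lt hj') ?_
    exact Submodule.pow_mem_pow _ (mem_genSpan x i) j
  let D := ∑ i, N i
  have hstep : ∀ d, D < d + 1 → genSpan k x ^ (d + 1) ≤ genSpan k x ^ d := by
    intro d hd
    refine (genSpan_pow_le_span x hx (d + 1)).trans ?_
    rw [Submodule.span_le]
    rintro _ ⟨m, hm, rfl⟩
    rcases Nat.lt_or_ge m.card (d + 1) with hlt | hge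
    · exact genSpan_pow_mono x (Nat.lt_succ_iff.mp hlt) (ord_mem x m)
    have hcard : m.card = d + 1 := le_antisymm hm hge
    obtain ⟨i, hi⟩ : ∃ i, N i ≤ m.count i := by
      by_contra! hcon
      have h1 : m.card = ∑ i, m.count i := (Multiset.sum_count_eq_card (by simp)).symm
      have h2 : ∑ i, m.count i ≤ D := Finset.sum_le_sum fun i _ => (hcon i).le
      omega
    have hle : Multiset.replicate (N i) i ≤ m := Multiset.le_count_iff_replicate_le.mp hi
    obtain ⟨m', rfl⟩ := Multiset.le_iff_exists_add.mp hle
    have hl := list_prod_sub_ord x hx (List.replicate (N i) i ++ m'.toList)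
    have hc : ((List.replicate (N i) i ++ m'.toList : List ι) : Multiset ι) =
        Multiset.replicate (N i) i + m' := by
      rw [← Multiset.coe_add, Multiset.coe_toList, Multiset.coe_replicate]
    have hlen : (List.replicate (N i) i ++ m'.toList).length = d + 1 := by
      rw [← hcard]; simp
    rw [hc, hlen] at hl
    have hprod : ((List.replicate (N i) i ++ m'.toList).map x).prod ∈ genSpan k x ^ d := by
      rw [List.map_append, List.prod_append, List.map_replicate, List.prod_replicate]
      have hNi := hN i
      have hm' := ord_mem (k := k) x m'
      have hcard' : N i + m'.card = d + 1 := by rw [← hcard]; simp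
      revert hNi hcard'
      cases N i with
      | zero =>
        intro h _
        have : x i ^ 0 = 0 := h
        rw [this, zero_mul]
        exact Submodule.zero_mem _
      | succ e =>
        intro h hce
        have : d = e + m'.card := by omega
        rw [this, pow_add]
        exact Submodule.mul_mem_mul h hm'
    have := Submodule.sub_mem _ hprod hl
    rwa [sub_sub_cancel] at this
  have hall : ∀ d, genSpan k x ^ d ≤ genSpan k x ^ D := by
    intro d
    induction d with
    | zero => exact genSpan_pow_mono x (Nat.zero_le _)
    | succ d ih =>
      rcases Nat.lt_or_ge D (d + 1) with h | h
      · exact (hstep d h).trans ih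
      · exact genSpan_pow_mono x h
  have htop : genSpan k x ^ D = ⊤ := by
    rw [eq_top_iff]
    intro b _
    obtain ⟨d, hd⟩ := exists_mem_genSpan_pow x hgen b
    exact hall d hd
  have hfg : (genSpan k x).FG := by
    refine Submodule.FG.sup ?_ (Submodule.fg_span (Set.finite_range x))
    rw [Submodule.one_eq_span]
    exact Submodule.fg_span_singleton _
  exact ⟨htop ▸ hfg.pow D⟩

open MvPolynomial

variable (k) in
/-- Ordered evaluation of polynomials. -/
noncomputable def ordLin : MvPolynomial ι k →ₗ[k] B :=
  (basisMonomials ι k).constr k fun a => ord x (Finsupp.toMultiset a)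

lemma ordLin_monomial (a : ι →₀ ℕ) (c : k) :
    ordLin k x (monomial a c) = c • ord x (Finsupp.toMultiset a) := by
  have h : (monomial a c : MvPolynomial ι k) = c • basisMonomials ι k a := by
    rw [coe_basisMonomials, smul_monomial, smul_eq_mul, mul_one]
  rw [h, map_smul, ordLin, Module.Basis.constr_basis]

lemma card_toMultiset' (a : ι →₀ ℕ) : (Finsupp.toMultiset a).card = a.degree := by
  rw [Finsupp.card_toMultiset]; rfl

include hx in
lemma mul_ordLin_sub {d : ℕ} {p : MvPolynomial ι k} (hp : p.IsHomogeneous d) (i : ι) :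
    x i * ordLin k x p - ordLin k x (X i * p) ∈ filt k x (d + 1) := by
  rw [p.as_sum, map_sum, Finset.mul_sum, Finset.mul_sum, map_sum, ← Finset.sum_sub_distrib]
  refine Submodule.sum_mem _ fun a ha => ?_
  have hdeg : a.degree = d := by
    have := hp (mem_support_iff.mp ha)
    rw [Finsupp.degree_eq_weight_one]
    exact this
  rw [X, monomial_mul, one_mul, ordLin_monomial, ordLin_monomial, mul_smul_comm, ← smul_sub,
    Finsupp.toMultiset_add, Finsupp.toMultiset_single, one_smul, Multiset.singleton_add]
  have := mul_ord_sub_ord x hx i (Finsupp.toMultiset a)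
  rw [card_toMultiset', hdeg] at this
  exact Submodule.smul_mem _ _ this

lemma homogeneousComponent_X_mul (d : ℕ) (i : ι) (p : MvPolynomial ι k) :
    homogeneousComponent (d + 1) (X i * p) = X i * homogeneousComponent d p := by
  classical
  ext m
  rw [coeff_homogeneousComponent, coeff_X_mul', coeff_X_mul']
  by_cases hi : i ∈ m.support
  · have h1 : m = (m - Finsupp.single i 1) + Finsupp.single i 1 := by
      rw [tsub_add_cancel_of_le]
      rw [Finsupp.single_le_iff]
      exact Nat.one_le_iff_ne_zero.mpr (Finsupp.mem_support_iff.mp hi)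
    have h2 : m.degree = (m - Finsupp.single i 1).degree + 1 := by
      conv_lhs => rw [h1]
      rw [map_add, Finsupp.degree_single]
    rw [if_pos hi, if_pos hi, coeff_homogeneousComponent, h2]
    simp
  · simp [hi]

/-- The ideal of leading forms of a left ideal. -/
noncomputable def leadIdeal (hx : ∀ i j, x i * x j - x j * x i ∈ genSpan k x) (N : Submodule B B) :
    Ideal (MvPolynomial ι k) where
  carrier := {p | ∀ d, ∃ b ∈ N, b - ordLin k x (homogeneousComponent d p) ∈ filt k x d}
  add_mem' := by
    intro p q hp hq d
    obtain ⟨b, hb, hb'⟩ := hp d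
    obtain ⟨c, hc, hc'⟩ := hq d
    refine ⟨b + c, N.add_mem hb hc, ?_⟩
    rw [map_add, map_add, add_sub_add_comm]
    exact Submodule.add_mem _ hb' hc'
  zero_mem' := fun d => ⟨0, N.zero_mem, by simp⟩
  smul_mem' := by
    intro q p hp
    rw [smul_eq_mul]
    induction q using MvPolynomial.induction_on with
    | C a =>
      intro d
      obtain ⟨b, hb, hb'⟩ := hp d
      refine ⟨algebraMap k B a * b, N.smul_mem (algebraMap k B a) hb, ?_⟩
      rw [homogeneousComponent_C_mul, ← smul_eq_C_mul, map_smul, ← Algebra.smul_def, ← smul_sub]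
      exact Submodule.smul_mem _ _ hb'
    | add q r hq hr =>
      intro d
      obtain ⟨b, hb, hb'⟩ := hq d
      obtain ⟨c, hc, hc'⟩ := hr d
      refine ⟨b + c, N.add_mem hb hc, ?_⟩
      rw [add_mul, map_add, map_add, add_sub_add_comm]
      exact Submodule.add_mem _ hb' hc'
    | mul_X q i hq =>
      rw [mul_comm q, mul_assoc]
      intro d
      cases d with
      | zero =>
        refine ⟨0, N.zero_mem, ?_⟩
        have h0 : coeff 0 (X i * (q * p)) = 0 := by
          classical
          rw [coeff_X_mul']; simp
        rw [homogeneousComponent_zero, h0]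
        simp
      | succ d =>
        obtain ⟨b, hb, hb'⟩ := hq d
        refine ⟨x i * b, N.smul_mem (x i) hb, ?_⟩
        rw [homogeneousComponent_X_mul]
        have h1 := mul_mem_filt x (mem_genSpan x i) hb'
        have h2 := mul_ordLin_sub x hx (homogeneousComponent_isHomogeneous d (q * p)) i
        have := Submodule.add_mem _ h1 h2
        rwa [mul_sub, sub_add_sub_cancel] at this

lemma leadIdeal_mono {N N' : Submodule B B} (h : N ≤ N') :
    leadIdeal x hx N ≤ leadIdeal x hx N' := by
  intro p hp d
  obtain ⟨b, hb, hb'⟩ := hp d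
  exact ⟨b, h hb, hb'⟩

include hx in
lemma exists_homogeneous_of_mem {d : ℕ} {b : B} (hb : b ∈ genSpan k x ^ d) :
    ∃ p : MvPolynomial ι k, p.IsHomogeneous d ∧ b - ordLin k x p ∈ filt k x d := by
  classical
  have hb' := genSpan_pow_le_span x hx d hb
  clear hb
  induction hb' using Submodule.span_induction with
  | mem y hy =>
    obtain ⟨m, hm, rfl⟩ := hy
    rcases Nat.lt_or_ge m.card d with hlt | hge
    · refine ⟨0, isHomogeneous_zero _ _ _, ?_⟩
      rw [map_zero, sub_zero]
      exact filt_mono x (Nat.succ_le_of_lt hlt) (ord_mem x m)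
    · refine ⟨monomial (Multiset.toFinsupp m) 1, isHomogeneous_monomial _ ?_, ?_⟩
      · rw [← card_toMultiset', Multiset.toFinsupp_toMultiset]
        exact le_antisymm hm hge
      · rw [ordLin_monomial, Multiset.toFinsupp_toMultiset, one_smul, sub_self]
        exact Submodule.zero_mem _
  | zero => exact ⟨0, isHomogeneous_zero _ _ _, by simp⟩
  | add y z hy hz ihy ihz =>
    obtain ⟨p, hp, hp'⟩ := ihy
    obtain ⟨q, hq, hq'⟩ := ihz
    refine ⟨p + q, hp.add hq, ?_⟩
    rw [map_add, add_sub_add_comm]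
    exact Submodule.add_mem _ hp' hq'
  | smul c y hy ih =>
    obtain ⟨p, hp, hp'⟩ := ih
    refine ⟨c • p, (homogeneousSubmodule ι k d).smul_mem c hp, ?_⟩
    rw [map_smul, ← smul_sub]
    exact Submodule.smul_mem _ _ hp'

lemma le_of_leadIdeal_le (hgen : Algebra.adjoin k (Set.range x) = ⊤) {N N' : Submodule B B}
    (h : N ≤ N') (hl : leadIdeal x hx N' ≤ leadIdeal x hx N) : N' ≤ N := by
  have key : ∀ d, ∀ b ∈ N', b ∈ filt k x d → b ∈ N := by
    intro d
    induction d with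
    | zero =>
      intro b _ hb
      have : b = 0 := hb
      rw [this]; exact N.zero_mem
    | succ d ih =>
      intro b hbN hb
      obtain ⟨p, hp, hbp⟩ := exists_homogeneous_of_mem x hx hb
      have hp' : p ∈ leadIdeal x hx N' := by
        intro e
        by_cases hed : e = d
        · subst hed
          exact ⟨b, hbN, by rwa [homogeneousComponent_eq_self hp]⟩
        · exact ⟨0, N'.zero_mem, by
            rw [homogeneousComponent_of_mem (n := d) hp, if_neg hed]; simp⟩
      obtain ⟨c, hc, hcp⟩ := hl hp' d
      rw [homogeneousComponent_eq_self hp] at hcp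
      have h1 := Submodule.sub_mem _ hbp hcp
      rw [sub_sub_sub_cancel_right] at h1
      have h2 := ih (b - c) (N'.sub_mem hbN (h hc)) h1
      have := N.add_mem h2 hc
      rwa [sub_add_cancel] at this
  intro b hb
  obtain ⟨d, hd⟩ := exists_mem_genSpan_pow x hgen b
  exact key (d + 1) b hb hd

include hx in
/-- An algebra generated by finitely many elements whose commutators lie in the span of the
generators and `1` is left noetherian. -/
theorem isNoetherianRing_of_commutator_mem [Finite ι]
    (hgen : Algebra.adjoin k (Set.range x) = ⊤) : IsNoetherianRing B := by
  have hs : StrictMono (leadIdeal x hx : Submodule B B → Ideal (MvPolynomial ι k)) := by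
    intro N N' h
    refine lt_of_le_of_ne (leadIdeal_mono x hx h.le) fun heq => ?_
    exact h.not_ge (le_of_leadIdeal_le x hx hgen h.le heq.ge)
  have : WellFoundedGT (Ideal (MvPolynomial ι k)) := inferInstance
  exact isNoetherian_iff'.mpr hs.wellFoundedGT

end Ordered

end CasimirBound

namespace CasimirBound

open Module LieModule LieAlgebra LieAlgebra.IsKilling

section Image

variable {s : Type*} [LieRing s] [LieAlgebra ℂ s]
variable {M : Type*} [AddCommGroup M] [Module ℂ M] [LieRingModule s M] [LieModule ℂ s M]

variable (s M) in
/-- The associative algebra of operators generated by the Lie action. -/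
def actAlg : Subalgebra ℂ (Module.End ℂ M) := Algebra.adjoin ℂ (Set.range (toEnd ℂ s M))

variable (M) in
/-- The action as a linear map into `actAlg`. -/
def toActAlg : s →ₗ[ℂ] actAlg s M :=
  (toEnd ℂ s M : s →ₗ[ℂ] Module.End ℂ M).codRestrict (actAlg s M).toSubmodule
    fun x => Algebra.subset_adjoin ⟨x, rfl⟩

@[simp] lemma toActAlg_coe (x : s) : (toActAlg M x : Module.End ℂ M) = toEnd ℂ s M x := rfl

lemma toActAlg_lie (x y : s) : toActAlg M ⁅x, y⁆ =
    toActAlg M x * toActAlg M y - toActAlg M y * toActAlg M x := by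
  apply Subtype.ext
  simp [Ring.lie_def]

lemma finiteDimensional_actAlg {ι : Type*} [Fintype ι] (y : ι → s)
    (hy : Submodule.span ℂ (Set.range y) = ⊤)
    (h_integral : ∀ i, IsIntegral ℂ (toEnd ℂ s M (y i))) : FiniteDimensional ℂ (actAlg s M) := by
  have hspan : ∀ z : s, toActAlg M z ∈ Submodule.span ℂ (Set.range fun i => toActAlg M (y i)) := by
    intro z
    have hz : z ∈ Submodule.span ℂ (Set.range y) := by rw [hy]; trivial
    have := Submodule.mem_map_of_mem (f := toActAlg M) hz
    rwa [Submodule.map_span, ← Set.range_comp] at this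
  refine finiteDimensional_of_isIntegral (k := ℂ) (fun i => toActAlg M (y i)) ?_ ?_ ?_
  · intro i j
    rw [← toActAlg_lie]
    exact (le_sup_right : _ ≤ genSpan ℂ _) (hspan _)
  · rw [eq_top_iff]
    rintro ⟨a, ha⟩ -
    have h1 : actAlg s M ≤ (Algebra.adjoin ℂ (Set.range fun i => toActAlg M (y i))).map
        (actAlg s M).val := by
      refine Algebra.adjoin_le ?_
      rintro _ ⟨z, rfl⟩
      refine ⟨toActAlg M z, ?_, rfl⟩
      exact Algebra.span_le_adjoin ℂ _ (hspan z)
    obtain ⟨b, hb, hba⟩ := h1 ha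
    have : b = ⟨a, ha⟩ := Subtype.ext hba
    rwa [← this]
  · intro i
    refine (isIntegral_algHom_iff (actAlg s M).val Subtype.val_injective).mp ?_
    exact h_integral i

end Image

section Adm

universe u

variable {s : Type u} [LieRing s] [LieAlgebra ℂ s]
variable {M : Type u} [AddCommGroup M] [Module ℂ M] [LieRingModule s M] [LieModule ℂ s M]

lemma finiteDimensional_of_actAlg (hadm : IsAdm s M) [FiniteDimensional ℂ (actAlg s M)] :
    FiniteDimensional ℂ M := by
  let _ : LieRingModule s (actAlg s M) :=
    { bracket := fun x u => toActAlg M x * u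
      add_lie := fun x y u => by
        rw [map_add, add_mul]
      lie_add := fun x u v => mul_add _ _ _
      leibniz_lie := fun x y u => by
        change toActAlg M x * (toActAlg M y * u) =
          toActAlg M ⁅x, y⁆ * u + toActAlg M y * (toActAlg M x * u)
        rw [toActAlg_lie, sub_mul, mul_assoc, mul_assoc, sub_add_cancel] }
  let _ : LieModule ℂ s (actAlg s M) :=
    { smul_lie := fun c x u => by
        change toActAlg M (c • x) * u = c • (toActAlg M x * u)
        rw [map_smul, smul_mul_assoc]
      lie_smul := fun c x u => mul_smul_comm _ _ _ }
  have h := hadm (actAlg s M)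
  let F : M →ₗ[ℂ] (actAlg s M →ₗ⁅ℂ, s⁆ M) :=
    { toFun := fun m =>
        { toFun := fun u => u.1 m
          map_add' := fun u v => rfl
          map_smul' := fun c u => rfl
          map_lie' := fun {x u} => rfl }
      map_add' := fun m n => by ext u; exact map_add u.1 m n
      map_smul' := fun c m => by ext u; exact map_smul u.1 c m }
  refine FiniteDimensional.of_injective F fun m n hmn => ?_
  exact congrArg (fun f : actAlg s M →ₗ⁅ℂ, s⁆ M => f 1) hmn

lemma IsAdm.of_injective {N : Type u} [AddCommGroup N] [Module ℂ N] [LieRingModule s N]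
    [LieModule ℂ s N] (h : IsAdm s N) (φ : M →ₗ⁅ℂ, s⁆ N) (hφ : Function.Injective φ) :
    IsAdm s M := by
  intro Q _ _ _ _ _
  have := h Q
  let F : (Q →ₗ⁅ℂ, s⁆ M) →ₗ[ℂ] (Q →ₗ⁅ℂ, s⁆ N) :=
    { toFun := fun w => φ.comp w
      map_add' := fun a b => by ext; simp
      map_smul' := fun c a => by ext; simp }
  refine FiniteDimensional.of_injective F fun a b hab => ?_
  ext q
  exact hφ (congrArg (fun f : Q →ₗ⁅ℂ, s⁆ N => f q) hab)

end Adm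

section WeightVectors

variable {s : Type*} [LieRing s] [LieAlgebra ℂ s] [FiniteDimensional ℂ s]
  [LieAlgebra.IsKilling ℂ s]
variable {M : Type*} [AddCommGroup M] [Module ℂ M] [LieRingModule s M] [LieModule ℂ s M]
variable {H : LieSubalgebra ℂ s} [H.IsCartanSubalgebra]

lemma lie_evec_weight {m : M} {μ : Dual ℂ H} (hm : ∀ h : H, ⁅(h : s), m⁆ = μ h • m) (α : H.root)
    (h : H) : ⁅(h : s), ⁅evec α, m⁆⁆ = (μ + rootLin H α) h • ⁅evec α, m⁆ := by
  rw [leibniz_lie, lie_evec, hm, lie_smul, smul_lie, LinearMap.add_apply, add_smul, add_comm]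

variable (H M) in
/-- The span of the weight vectors. -/
noncomputable def weightSpan : LieSubmodule ℂ s M where
  toSubmodule := Submodule.span ℂ {m | ∃ μ : Dual ℂ H, ∀ h : H, ⁅(h : s), m⁆ = μ h • m}
  lie_mem := by
    intro x m hm
    change ⁅x, m⁆ ∈ Submodule.span ℂ _
    change m ∈ Submodule.span ℂ _ at hm
    refine root_induction (H := H) (p := fun x => ⁅x, m⁆ ∈ Submodule.span ℂ
      {m : M | ∃ μ : Dual ℂ H, ∀ h : H, ⁅(h : s), m⁆ = μ h • m}) ?_ ?_ ?_ ?_ x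
    · intro h
      induction hm using Submodule.span_induction with
      | mem m hm =>
        obtain ⟨μ, hμ⟩ := hm
        rw [hμ]
        exact Submodule.smul_mem _ _ (Submodule.subset_span ⟨μ, hμ⟩)
      | zero => simp
      | add a b _ _ ha hb => rw [lie_add]; exact Submodule.add_mem _ ha hb
      | smul c a _ ha => rw [lie_smul]; exact Submodule.smul_mem _ _ ha
    · intro α
      induction hm using Submodule.span_induction with
      | mem m hm =>
        obtain ⟨μ, hμ⟩ := hm
        exact Submodule.subset_span ⟨μ + rootLin H α, lie_evec_weight hμ α⟩
      | zero => simp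
      | add a b _ _ ha hb => rw [lie_add]; exact Submodule.add_mem _ ha hb
      | smul c a _ ha => rw [lie_smul]; exact Submodule.smul_mem _ _ ha
    · intro x y hx hy
      rw [add_lie]; exact Submodule.add_mem _ hx hy
    · intro c x hx
      rw [smul_lie]; exact Submodule.smul_mem _ _ hx

lemma weightSpan_eq_top (h : IsLF s M) : weightSpan M H = ⊤ := by
  by_contra hne
  let N := weightSpan M H
  have hnt : Nontrivial (M ⧸ N) := by
    rw [← not_subsingleton_iff_nontrivial]
    intro hs
    exact hne (by
      rw [← LieSubmodule.toSubmodule_eq_top]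
      exact Submodule.Quotient.subsingleton_iff.mp hs)
  have hLF : IsLF s (M ⧸ N) := h.of_surjective (LieSubmodule.Quotient.mk' N)
    (LieSubmodule.Quotient.surjective_mk' N)
  obtain ⟨q, hq⟩ := exists_ne (0 : M ⧸ N)
  obtain ⟨P, hP, hqP⟩ := hLF q
  have : Nontrivial P := ⟨⟨q, hqP⟩, 0, fun h0 => hq (congrArg Subtype.val h0)⟩
  obtain ⟨μ, ⟨v, hv, hvμ⟩, -⟩ := exists_extremal (H := H) P
  obtain ⟨w, hw⟩ := exists_equivariant_lift h (LieSubmodule.Quotient.mk' N)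
    (LieSubmodule.Quotient.surjective_mk' N) P.incl
  have h1 : w v ∈ N := Submodule.subset_span ⟨μ, fun x => by
    rw [← LieModuleHom.map_lie, hvμ, map_smul]⟩
  have h2 : (LieSubmodule.Quotient.mk' N) (w v) = v :=
    congrArg (fun f : P →ₗ⁅ℂ, s⁆ (M ⧸ N) => f v) hw
  have h3 : (LieSubmodule.Quotient.mk' N) (w v) = 0 := by
    rwa [LieSubmodule.Quotient.mk_eq_zero]
  exact hv (Subtype.ext (h2.symm.trans h3))

end WeightVectors

end CasimirBound

namespace CasimirBound

open Module LieModule LieAlgebra LieAlgebra.IsKilling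

section Sl2

variable {s : Type*} [LieRing s] [LieAlgebra ℂ s] [FiniteDimensional ℂ s]
  [LieAlgebra.IsKilling ℂ s]
variable {M : Type*} [AddCommGroup M] [Module ℂ M] [LieRingModule s M] [LieModule ℂ s M]
variable {H : LieSubalgebra ℂ s} [H.IsCartanSubalgebra]

lemma isSl2Triple_root (α : H.root) {c : ℝ} (hc : 0 < c)
    (h : rootLin H α (tvec H (rootLin H α)) = c) :
    IsSl2Triple ((2 / c : ℂ) • (tvec H (rootLin H α) : s)) (evec α) ((2 / c : ℂ) • fvec α) := by
  have hc' : (c : ℂ) ≠ 0 := by exact_mod_cast hc.ne'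
  have he := lie_evec α (tvec H (rootLin H α))
  have hf := lie_fvec α (tvec H (rootLin H α))
  rw [h] at he hf
  refine ⟨?_, ?_, ?_, ?_⟩
  · intro h0
    have h1 : (tvec H (rootLin H α) : s) = 0 :=
      (smul_eq_zero.mp h0).resolve_left (div_ne_zero two_ne_zero hc')
    have h2 : tvec H (rootLin H α) = 0 := Subtype.ext h1
    rw [h2, map_zero] at h
    exact hc' h.symm
  · rw [lie_smul, lie_evec_fvec]
  · rw [smul_lie, he, smul_smul, div_mul_cancel₀ _ hc', two_smul, two_smul]
  · rw [smul_lie, lie_smul, hf, smul_smul, smul_smul, ← Nat.cast_smul_eq_nsmul ℂ, ← neg_smul,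
      smul_smul]
    congr 1
    field_simp
    norm_num

lemma pow_evec_weight {m : M} {μ : Dual ℂ H} (hm : ∀ h : H, ⁅(h : s), m⁆ = μ h • m) (α : H.root)
    (n : ℕ) (h : H) : ⁅(h : s), (toEnd ℂ s M (evec α) ^ n) m⁆ =
      (μ + n • rootLin H α) h • (toEnd ℂ s M (evec α) ^ n) m := by
  induction n generalizing h with
  | zero => simpa using hm h
  | succ n ih =>
    rw [pow_succ', Module.End.mul_apply, toEnd_apply_apply, lie_evec_weight ih, succ_nsmul,
      add_assoc]

/-- Weights of locally finite modules with bounded weights take finitely many values. -/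
lemma weight_eq_of_bound (hLF : IsLF s M) {C : ℝ}
    (hC : ∀ μ : Dual ℂ H, IsWt H M μ → ‖pairVec H μ‖ ≤ C) {α : H.root} {c : ℝ} (hc : 0 < c)
    (hα : rootLin H α (tvec H (rootLin H α)) = c) {K : ℕ}
    (hK : toEnd ℂ s M (evec α) ^ K = 0) {μ : Dual ℂ H} (hμ : IsWt H M μ) :
    ∃ k < K, ∃ n < ⌊2 / c * C⌋₊ + 1, μ (tvec H (rootLin H α)) = c / 2 * n - k * c := by
  classical
  obtain ⟨v, hv, hvμ⟩ := hμ
  have hex : ∃ k, (toEnd ℂ s M (evec α) ^ k) v = 0 := ⟨K, by rw [hK]; rfl⟩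
  obtain ⟨k, hk⟩ : ∃ k, Nat.find hex = k + 1 := by
    refine Nat.exists_eq_succ_of_ne_zero fun h0 => hv ?_
    have := Nat.find_spec hex
    rw [h0] at this
    simpa using this
  have hkK : k < K := by
    have := Nat.find_min' hex (m := K) (by rw [hK]; rfl)
    omega
  set w := (toEnd ℂ s M (evec α) ^ k) v with hw
  have hw0 : w ≠ 0 := Nat.find_min hex (by omega)
  have hw1 : ⁅evec α, w⁆ = 0 := by
    have := Nat.find_spec hex
    rwa [hk, pow_succ', Module.End.mul_apply, toEnd_apply_apply] at this
  have hwt := pow_evec_weight hvμ α k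
  rw [← hw] at hwt
  obtain ⟨P, hP, hwP⟩ := hLF w
  have hprim : (isSl2Triple_root α hc hα).HasPrimitiveVectorWith (⟨w, hwP⟩ : P)
      (2 / c * (μ + k • rootLin H α) (tvec H (rootLin H α)) : ℂ) := by
    refine ⟨fun h0 => hw0 (congrArg Subtype.val h0), Subtype.ext ?_, Subtype.ext hw1⟩
    change ⁅(2 / c : ℂ) • (tvec H (rootLin H α) : s), w⁆ = _ • w
    rw [smul_lie, hwt, smul_smul]
  obtain ⟨n, hn⟩ := hprim.exists_nat
  have hc' : (c : ℂ) ≠ 0 := by exact_mod_cast hc.ne'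
  refine ⟨k, hkK, n, ?_, ?_⟩
  · have h1 := hC _ ⟨w, hw0, hwt⟩
    have h2 : pairVec H (μ + k • rootLin H α) α ≤ C :=
      (le_abs_self _).trans ((PiLp.norm_apply_le _ _).trans h1)
    rw [pairVec_apply] at h2
    have h3 := congrArg Complex.re hn
    have h4 : (2 / c : ℂ) = ((2 / c : ℝ) : ℂ) := by push_cast; rfl
    rw [h4, Complex.re_ofReal_mul, Complex.natCast_re] at h3
    refine Nat.lt_succ_of_le (Nat.le_floor ?_)
    rw [← h3]
    gcongr
  · rw [LinearMap.add_apply, LinearMap.smul_apply, hα, ← Nat.cast_smul_eq_nsmul ℂ,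
      smul_eq_mul] at hn
    field_simp at hn
    linear_combination hn / 2

end Sl2

section LowPart

universe u

variable {s : Type u} [LieRing s] [LieAlgebra ℂ s] [FiniteDimensional ℂ s]
  [LieAlgebra.IsKilling ℂ s]
variable {M : Type u} [AddCommGroup M] [Module ℂ M] [LieRingModule s M] [LieModule ℂ s M]

/-- An admissible locally finite module with bounded Casimir eigenvalues is finite-dimensional. -/
theorem finiteDimensional_of_isCasEig_le (hLF : IsLF s M) (hadm : IsAdm s M) {r : ℝ}
    (hr : ∀ c, IsCasEig s M c → c.re ≤ r) : FiniteDimensional ℂ M := by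
  obtain ⟨H, hH⟩ := exists_cartan s
  have hC : ∀ μ : Dual ℂ H, IsWt H M μ → ‖pairVec H μ‖ ≤ √r := by
    rintro μ ⟨v, hv, hvμ⟩
    obtain ⟨P, hP, hvP⟩ := hLF v
    refine Real.le_sqrt_of_sq_le (IsWt.norm_sq_le (M := P)
      (fun c hc => hr c (hc.of_injective P.incl P.injective_incl))
      ⟨⟨v, hvP⟩, fun h0 => hv (congrArg Subtype.val h0), fun h => Subtype.ext (hvμ h)⟩)
  have hspan : ∀ f : Module.End ℂ M, (∀ (μ : Dual ℂ H) (m : M), m ≠ 0 →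
      (∀ h : H, ⁅(h : s), m⁆ = μ h • m) → f m = 0) → f = 0 := by
    intro f hf
    ext m
    have hm : m ∈ weightSpan M H := by rw [weightSpan_eq_top hLF]; trivial
    change m ∈ Submodule.span ℂ _ at hm
    induction hm using Submodule.span_induction with
    | mem m hm =>
      obtain ⟨μ, hμ⟩ := hm
      by_cases h0 : m = 0
      · rw [h0, map_zero, map_zero]
      · exact hf μ m h0 hμ
    | zero => simp
    | add a b _ _ ha hb => rw [map_add, ha, hb, LinearMap.zero_apply, LinearMap.zero_apply,
        LinearMap.zero_apply, add_zero]
    | smul c a _ ha => rw [map_smul, ha, LinearMap.zero_apply, LinearMap.zero_apply, smul_zero]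
  have hnil : ∀ α : H.root, ∃ K : ℕ, toEnd ℂ s M (evec α) ^ K = 0 := by
    intro α
    obtain ⟨K, hK⟩ := exists_nat_gt (2 * √r / ‖pairVec H (rootLin H α)‖)
    refine ⟨K, hspan _ fun μ m hm hμ => ?_⟩
    by_contra hne
    have h1 := hC _ ⟨m, hm, hμ⟩
    have h2 := hC _ ⟨_, hne, pow_evec_weight hμ α K⟩
    have hpos := norm_pairVec_rootLin_pos α
    rw [div_lt_iff₀ hpos] at hK
    have h3 : ‖K • pairVec H (rootLin H α)‖ ≤ √r + √r := by
      have : K • pairVec H (rootLin H α) = pairVec H (μ + K • rootLin H α) - pairVec H μ := by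
        rw [map_add, map_nsmul, add_sub_cancel_left]
      rw [this]
      exact (norm_sub_le _ _).trans (add_le_add h2 h1)
    rw [← Nat.cast_smul_eq_nsmul ℝ, norm_smul, Real.norm_natCast] at h3
    linarith
  have hfd : FiniteDimensional ℂ (actAlg s M) := by
    refine finiteDimensional_actAlg (ι := H.root ⊕ H.root)
      (Sum.elim (fun α => evec α) fun α => (tvec H (rootLin H α) : s)) ?_ ?_
    · rw [Set.Sum.elim_range, Submodule.span_union, eq_top_iff]
      intro z _
      refine root_induction (H := H) (p := fun z => z ∈ Submodule.span ℂ
        (Set.range fun α : H.root => evec α) ⊔ Submodule.span ℂ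
        (Set.range fun α : H.root => (tvec H (rootLin H α) : s))) ?_ ?_ ?_ ?_ z
      · intro h
        refine Submodule.mem_sup_right ?_
        have h1 : (⊤ : Submodule ℂ (Dual ℂ H)) ≤ (Submodule.span ℂ
            (Set.range fun α : H.root => (tvec H (rootLin H α) : s))).comap
            (H.toSubmodule.subtype ∘ₗ (cartanEquivDual H).symm.toLinearMap) := by
          rw [← span_weight_isNonZero_eq_top ℂ s H, Submodule.span_le]
          rintro _ ⟨α, hα, rfl⟩
          have hα' : α ∈ H.root := by simpa using hα
          exact Submodule.subset_span ⟨⟨α, hα'⟩, rfl⟩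
        have h2 := h1 (Submodule.mem_top : cartanEquivDual H h ∈ ⊤)
        simpa using h2
      · exact fun α => Submodule.mem_sup_left (Submodule.subset_span ⟨α, rfl⟩)
      · exact fun x y => Submodule.add_mem _
      · exact fun c x => Submodule.smul_mem _ c
    · rintro (α | α)
      · obtain ⟨K, hK⟩ := hnil α
        exact ⟨Polynomial.X ^ K, Polynomial.monic_X_pow K, by simpa using hK⟩
      · obtain ⟨K, hK⟩ := hnil α
        obtain ⟨c, hc, hα⟩ := exists_pos_root H α
        let a : ℕ × ℕ → ℂ := fun x => c / 2 * x.2 - x.1 * c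
        let p : Polynomial ℂ := ∏ x ∈ Finset.range K ×ˢ Finset.range (⌊2 / c * √r⌋₊ + 1),
          (Polynomial.X - Polynomial.C (a x))
        refine ⟨p, Polynomial.monic_prod_of_monic _ _ fun x _ => Polynomial.monic_X_sub_C _, ?_⟩
        change Polynomial.aeval (toEnd ℂ s M (tvec H (rootLin H α) : s)) p = 0
        refine hspan _ fun μ m hm hμ => ?_
        obtain ⟨k, hk, n, hn, h⟩ := weight_eq_of_bound hLF hC hc hα hK ⟨m, hm, hμ⟩
        have hv : (toEnd ℂ s M (tvec H (rootLin H α) : s)).HasEigenvector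
            (μ (tvec H (rootLin H α))) m := ⟨Module.End.mem_eigenspace_iff.mpr (hμ _), hm⟩
        rw [Module.End.aeval_apply_of_hasEigenvector hv, h, Polynomial.eval_prod,
          Finset.prod_eq_zero (i := (k, n)) (by simp [hk, Nat.lt_succ_iff.mp hn]) (by simp [a]),
          zero_smul]
  exact finiteDimensional_of_actAlg hadm

variable (s M) in
/-- The sum of the generalized Casimir eigenspaces with eigenvalues of real part at most `r`. -/
noncomputable def lowPart (r : ℝ) : LieSubmodule ℂ s M where
  carrier := {m | ∃ p : Polynomial ℂ, p ≠ 0 ∧ (∀ c, p.IsRoot c → c.re ≤ r) ∧ casPoly s M p m = 0}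
  zero_mem' := ⟨1, one_ne_zero, fun c hc => by simp at hc, map_zero _⟩
  add_mem' := by
    rintro a b ⟨p, hp, hpr, hpa⟩ ⟨q, hq, hqr, hqb⟩
    refine ⟨p * q, mul_ne_zero hp hq, fun c hc => ?_, ?_⟩
    · rcases Polynomial.root_mul.mp hc with h | h
      exacts [hpr c h, hqr c h]
    · rw [map_add, casPoly_mul, casPoly_mul, hqb, map_zero, add_zero, ← casPoly_mul, mul_comm,
        casPoly_mul, hpa, map_zero]
  smul_mem' := by
    rintro c a ⟨p, hp, hpr, hpa⟩
    exact ⟨p, hp, hpr, by rw [map_smul, hpa, smul_zero]⟩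
  lie_mem := by
    rintro x a ⟨p, hp, hpr, hpa⟩
    exact ⟨p, hp, hpr, by rw [casPoly_lie, hpa, lie_zero]⟩

lemma finiteDimensional_lowPart (hLF : IsLF s M) (hadm : IsAdm s M) (r : ℝ) :
    FiniteDimensional ℂ (lowPart s M r) := by
  refine finiteDimensional_of_isCasEig_le (s := s) (r := r)
    (hLF.of_injective _ (lowPart s M r).injective_incl)
    (hadm.of_injective _ (lowPart s M r).injective_incl) ?_
  rintro c ⟨⟨m, p, hp, hpr, hpm⟩, hm0, hmc⟩
  have h1 : casimir s M m = c • m := by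
    have := congrArg (lowPart s M r).incl hmc
    rwa [map_casimir] at this
  rw [casPoly_of_casimir_eq_smul h1] at hpm
  exact hpr c ((smul_eq_zero.mp hpm).resolve_right fun h0 => hm0 (Subtype.ext h0))

end LowPart

end CasimirBound

namespace CasimirBound

open Module LieModule LieAlgebra LieAlgebra.IsKilling

section Inner

universe u

variable {s : Type u} [LieRing s] [LieAlgebra ℂ s]
variable {B : Type u} [Ring B] [Algebra ℂ B] [LieRingModule s B] [LieModule ℂ s B]

/-- The Lie action on an algebra is by commutators with the values of `ρ`. -/
structure IsInner (ρ : s →ₗ[ℂ] B) : Prop where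
  lie_eq : ∀ x b, ⁅x, b⁆ = ρ x * b - b * ρ x
  map_lie : ∀ x y, ρ ⁅x, y⁆ = ρ x * ρ y - ρ y * ρ x
  adjoin_eq : Algebra.adjoin ℂ (Set.range ρ ∪ Subalgebra.center ℂ B) = ⊤

variable {ρ : s →ₗ[ℂ] B} (hρ : IsInner ρ)
include hρ

lemma IsInner.lie_mul (x : s) (a b : B) : ⁅x, a * b⁆ = ⁅x, a⁆ * b + a * ⁅x, b⁆ := by
  rw [hρ.lie_eq, hρ.lie_eq, hρ.lie_eq]; noncomm_ring

lemma IsInner.lie_center {z : B} (hz : z ∈ Subalgebra.center ℂ B) (x : s) : ⁅x, z⁆ = 0 := by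
  rw [hρ.lie_eq, Subalgebra.mem_center_iff.mp hz, sub_self]

lemma IsInner.lie_one (x : s) : ⁅x, (1 : B)⁆ = 0 := hρ.lie_center (one_mem _) x

lemma IsInner.mem_center {b : B} (hb : ∀ x : s, ⁅x, b⁆ = 0) : b ∈ Subalgebra.center ℂ B := by
  rw [Subalgebra.mem_center_iff]
  have h : (⊤ : Subalgebra ℂ B) ≤ Subalgebra.centralizer ℂ {b} := by
    rw [← hρ.adjoin_eq]
    refine Algebra.adjoin_le ?_
    rintro a (⟨x, rfl⟩ | ha)
    · rw [SetLike.mem_coe, Subalgebra.mem_centralizer_iff]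
      rintro _ rfl
      exact (sub_eq_zero.mp ((hρ.lie_eq x _).symm.trans (hb x))).symm
    · rw [SetLike.mem_coe, Subalgebra.mem_centralizer_iff]
      rintro _ rfl
      exact Subalgebra.mem_center_iff.mp ha _
  intro a
  exact (Subalgebra.mem_centralizer_iff ℂ |>.mp (h (Algebra.mem_top : a ∈ ⊤)) b rfl).symm

lemma IsInner.isLF [FiniteDimensional ℂ s] : IsLF s B := by
  intro b
  have hb : b ∈ Algebra.adjoin ℂ (Set.range ρ ∪ Subalgebra.center ℂ B) := by
    rw [hρ.adjoin_eq]; trivial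
  have hcen : ∀ z ∈ Subalgebra.center ℂ B, ∃ N : LieSubmodule ℂ s B,
      FiniteDimensional ℂ N ∧ z ∈ N := by
    intro z hz
    refine ⟨{ Submodule.span ℂ {z} with lie_mem := ?_ }, ?_,
      Submodule.mem_span_singleton_self z⟩
    swap
    · exact (inferInstance : FiniteDimensional ℂ (Submodule.span ℂ {z}))
    intro x m hm
    obtain ⟨c, rfl⟩ := Submodule.mem_span_singleton.mp hm
    rw [lie_smul, hρ.lie_center hz, smul_zero]
    exact Submodule.zero_mem _
  induction hb using Algebra.adjoin_induction with
  | mem b hb =>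
    rcases hb with ⟨x, rfl⟩ | hb
    · have hmap : ∀ x y : s, ρ ⁅x, y⁆ = ⁅x, ρ y⁆ := fun x y => by rw [hρ.lie_eq, hρ.map_lie]
      let F : s →ₗ⁅ℂ, s⁆ B := { ρ with map_lie' := fun {x y} => hmap x y }
      exact ⟨F.range, inferInstanceAs (FiniteDimensional ℂ (LinearMap.range (F : s →ₗ[ℂ] B))),
        x, rfl⟩
    · exact hcen b hb
  | algebraMap c => exact hcen _ ((Subalgebra.center ℂ B).algebraMap_mem c)
  | add a b _ _ ha hb =>
    obtain ⟨N, hN, ha⟩ := ha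
    obtain ⟨P, hP, hb⟩ := hb
    refine ⟨N ⊔ P, ?_, add_mem (le_sup_left (a := N) ha) (le_sup_right (a := N) hb)⟩
    change FiniteDimensional ℂ (N ⊔ P).toSubmodule
    rw [LieSubmodule.sup_toSubmodule]
    have : FiniteDimensional ℂ N.toSubmodule := hN
    have : FiniteDimensional ℂ P.toSubmodule := hP
    infer_instance
  | mul a b _ _ ha hb =>
    obtain ⟨N, hN, ha⟩ := ha
    obtain ⟨P, hP, hb⟩ := hb
    refine ⟨{ N.toSubmodule * P.toSubmodule with lie_mem := ?_ }, ?_, Submodule.mul_mem_mul ha hb⟩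
    · intro x m hm
      change ⁅x, m⁆ ∈ N.toSubmodule * P.toSubmodule
      change m ∈ N.toSubmodule * P.toSubmodule at hm
      induction hm using Submodule.mul_induction_on' with
      | mem_mul_mem m hm n hn =>
        rw [hρ.lie_mul]
        exact add_mem (Submodule.mul_mem_mul (N.lie_mem hm) hn)
          (Submodule.mul_mem_mul hm (P.lie_mem hn))
      | add m _ n _ hm hn => rw [lie_add]; exact add_mem hm hn
    · have h1 : N.toSubmodule.FG := Module.Finite.iff_fg.mp hN
      have h2 : P.toSubmodule.FG := Module.Finite.iff_fg.mp hP
      exact Module.Finite.iff_fg.mpr (h1.mul h2)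

variable [FiniteDimensional ℂ s] [LieAlgebra.IsKilling ℂ s]

lemma IsInner.lie_smul_hom {Q : Type*} [AddCommGroup Q] [Module ℂ Q] [LieRingModule s Q]
    [LieModule ℂ s Q] (w : Q →ₗ⁅ℂ, s⁆ B) (x : s) (a : B) :
    ⁅x, a • (w : Q →ₗ[ℂ] B)⁆ = ⁅x, a⁆ • (w : Q →ₗ[ℂ] B) := by
  ext q
  rw [LieHom.lie_apply]
  change ⁅x, a * w q⁆ - a * w ⁅x, q⁆ = ⁅x, a⁆ * w q
  rw [hρ.lie_mul, LieModuleHom.map_lie, add_sub_cancel_right]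

lemma IsInner.casimir_smul_hom {Q : Type*} [AddCommGroup Q] [Module ℂ Q] [LieRingModule s Q]
    [LieModule ℂ s Q] (w : Q →ₗ⁅ℂ, s⁆ B) (a : B) :
    casimir s (Q →ₗ[ℂ] B) (a • (w : Q →ₗ[ℂ] B)) = casimir s B a • (w : Q →ₗ[ℂ] B) := by
  simp only [casimir_apply, hρ.lie_smul_hom, Finset.sum_smul]

lemma IsInner.isAdm [IsNoetherianRing B] [FiniteDimensional ℂ (Subalgebra.center ℂ B)] :
    IsAdm s B := by
  intro Q _ _ _ _ _
  have hnoeth : IsNoetherian B (Q →ₗ[ℂ] B) := by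
    let F : (Q →ₗ[ℂ] B) →ₗ[B] (Fin (finrank ℂ Q) → B) :=
      { toFun := fun φ i => φ (finBasis ℂ Q i)
        map_add' := fun _ _ => rfl
        map_smul' := fun _ _ => rfl }
    refine isNoetherian_of_injective F fun φ ψ h => ?_
    exact (finBasis ℂ Q).ext fun i => congrFun h i
  let S : Set (Q →ₗ[ℂ] B) := Set.range fun w : Q →ₗ⁅ℂ, s⁆ B => (w : Q →ₗ[ℂ] B)
  obtain ⟨T, hTS, hT⟩ := (Submodule.fg_span_iff_fg_span_finset_subset S).mp
    (IsNoetherian.noetherian (Submodule.span B S))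
  let G : (T → Subalgebra.center ℂ B) →ₗ[ℂ] (Q →ₗ[ℂ] B) :=
    { toFun := fun z => ∑ φ, (z φ : B) • (φ : Q →ₗ[ℂ] B)
      map_add' := fun a b => by simp [add_smul, Finset.sum_add_distrib]
      map_smul' := fun c a => by simp [Finset.smul_sum] }
  let F : (Q →ₗ⁅ℂ, s⁆ B) →ₗ[ℂ] (Q →ₗ[ℂ] B) :=
    { toFun := fun w => w
      map_add' := fun _ _ => rfl
      map_smul' := fun _ _ => rfl }
  have hF : ∀ w, F w ∈ LinearMap.range G := by
    intro w
    have hw : (w : Q →ₗ[ℂ] B) ∈ Submodule.span B (T : Set (Q →ₗ[ℂ] B)) := by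
      rw [← hT]; exact Submodule.subset_span ⟨w, rfl⟩
    obtain ⟨f, -, hf⟩ := Submodule.mem_span_finset.mp hw
    choose z u hz hu using fun φ => exists_invariant_add_casimir hρ.isLF (f φ)
    refine ⟨fun φ => ⟨z φ, hρ.mem_center (hz φ)⟩, ?_⟩
    change ∑ φ : T, z φ • (φ : Q →ₗ[ℂ] B) = (w : Q →ₗ[ℂ] B)
    rw [Finset.sum_coe_sort T (fun φ => z φ • φ)]
    have h1 : ∀ φ ∈ T, f φ • φ = z φ • φ + casimir s (Q →ₗ[ℂ] B) (u φ • φ) := by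
      intro φ hφ
      obtain ⟨v, rfl⟩ := hTS hφ
      rw [hρ.casimir_smul_hom, ← add_smul, ← hu]
    rw [Finset.sum_congr rfl h1, Finset.sum_add_distrib, ← map_sum] at hf
    have h2 : casimir s (Q →ₗ[ℂ] B) (∑ φ ∈ T, u φ • φ) = 0 := by
      refine casimir_eq_zero_of_invariant hρ.isLF.hom fun x => ?_
      have h3 : casimir s (Q →ₗ[ℂ] B) (∑ φ ∈ T, u φ • φ) =
          (w : Q →ₗ[ℂ] B) - ∑ φ ∈ T, z φ • φ := by rw [← hf, add_sub_cancel_left]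
      rw [h3, lie_sub, lie_sum, lie_linearMap_eq_zero_iff.mpr (fun x m => w.map_lie x m) x,
        zero_sub, neg_eq_zero]
      refine Finset.sum_eq_zero fun φ hφ => ?_
      obtain ⟨v, rfl⟩ := hTS hφ
      rw [hρ.lie_smul_hom, hz, zero_smul]
    rw [h2, add_zero] at hf
    exact hf
  have hfin : FiniteDimensional ℂ (LinearMap.range G) := inferInstance
  refine Module.Finite.of_injective (F.codRestrict (LinearMap.range G) hF) fun v w h => ?_
  ext q
  exact congrArg (fun φ : LinearMap.range G => (φ : Q →ₗ[ℂ] B) q) h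

end Inner

section AdmHom

universe u

variable {s : Type u} [LieRing s] [LieAlgebra ℂ s] [FiniteDimensional ℂ s]
  [LieAlgebra.IsKilling ℂ s]
variable {M : Type u} [AddCommGroup M] [Module ℂ M] [LieRingModule s M] [LieModule ℂ s M]
variable {N : Type u} [AddCommGroup N] [Module ℂ N] [LieRingModule s N] [LieModule ℂ s N]

lemma IsAdm.of_surjective (h : IsAdm s M) (hLF : IsLF s M) (φ : M →ₗ⁅ℂ, s⁆ N)
    (hφ : Function.Surjective φ) : IsAdm s N := by
  intro Q _ _ _ _ _
  have := h Q
  let F : (Q →ₗ⁅ℂ, s⁆ M) →ₗ[ℂ] (Q →ₗ⁅ℂ, s⁆ N) :=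
    { toFun := fun w => φ.comp w
      map_add' := fun a b => by ext; simp
      map_smul' := fun c a => by ext; simp }
  exact Module.Finite.of_surjective F fun w => exists_equivariant_lift hLF φ hφ w

lemma IsAdm.hom (h : IsAdm s M) (V : Type u) [AddCommGroup V] [Module ℂ V] [LieRingModule s V]
    [LieModule ℂ s V] [FiniteDimensional ℂ V] : IsAdm s (V →ₗ[ℂ] M) := by
  intro Q _ _ _ _ _
  have := h (TensorProduct ℂ Q V)
  exact Module.Finite.equiv (TensorProduct.LieModule.liftLie ℂ s Q V M).symm

end AdmHom

end CasimirBound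

namespace CasimirBound

open Module LieModule LieAlgebra LieAlgebra.IsKilling

section Transfer

universe u

variable {s : Type u} [LieRing s] [LieAlgebra ℂ s] [FiniteDimensional ℂ s]
  [LieAlgebra.IsKilling ℂ s]
variable {X : Type u} [AddCommGroup X] [Module ℂ X] [LieRingModule s X] [LieModule ℂ s X]
variable {Y : Type u} [AddCommGroup Y] [Module ℂ Y] [LieRingModule s Y] [LieModule ℂ s Y]
variable {L R : s →ₗ[ℂ] Module.End ℂ X} {L' R' : s →ₗ[ℂ] Module.End ℂ Y} {b : ℝ}

lemma IsBoundedBimodule.of_injective (h : IsBoundedBimodule Y L' R' b) (φ : X →ₗ⁅ℂ, s⁆ Y)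
    (hφ : Function.Injective φ) (hL : ∀ x m, φ (L x m) = L' x (φ m))
    (hR : ∀ x m, φ (R x m) = R' x (φ m)) : IsBoundedBimodule X L R b where
  isLF := h.isLF.of_injective φ hφ
  isAdm := h.isAdm.of_injective (postcomp s φ) fun a c hac => by
    ext v
    exact hφ (congrArg (fun f : s →ₗ[ℂ] Y => f v) hac)
  left x y m := hφ (by rw [LieModuleHom.map_lie, map_add, hL, hL, hL, LieModuleHom.map_lie, h.left])
  right x y m := hφ (by
    rw [LieModuleHom.map_lie, map_add, hR, hR, hR, LieModuleHom.map_lie, h.right])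
  sub x m := hφ (by rw [LieModuleHom.map_lie, map_sub, hL, hR, h.sub])
  left_poly := by
    obtain ⟨p, hp, hb⟩ := h.left_poly
    refine ⟨p, fun ψ => ?_, hb⟩
    have h1 := aeval_tOp_natural (φ : X →ₗ[ℂ] Y) hL p ψ
    rw [hp] at h1
    ext v
    exact hφ ((congrArg (fun f : s →ₗ[ℂ] Y => f v) h1).trans (map_zero φ).symm)
  right_poly := by
    obtain ⟨p, hp, hb⟩ := h.right_poly
    refine ⟨p, fun ψ => ?_, hb⟩
    have h1 := aeval_tOp_natural (φ : X →ₗ[ℂ] Y) hR p ψ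
    rw [hp] at h1
    ext v
    exact hφ ((congrArg (fun f : s →ₗ[ℂ] Y => f v) h1).trans (map_zero φ).symm)

lemma IsBoundedBimodule.of_surjective (h : IsBoundedBimodule X L R b) (φ : X →ₗ⁅ℂ, s⁆ Y)
    (hφ : Function.Surjective φ) (hL : ∀ x m, φ (L x m) = L' x (φ m))
    (hR : ∀ x m, φ (R x m) = R' x (φ m)) : IsBoundedBimodule Y L' R' b where
  isLF := h.isLF.of_surjective φ hφ
  isAdm := h.isAdm.of_surjective h.isLF.hom (postcomp s φ) (postcomp_surjective s φ hφ)
  left x y m := by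
    obtain ⟨m, rfl⟩ := hφ m
    rw [← hL, ← hL, ← LieModuleHom.map_lie, ← LieModuleHom.map_lie, ← hL, ← map_add, h.left]
  right x y m := by
    obtain ⟨m, rfl⟩ := hφ m
    rw [← hR, ← hR, ← LieModuleHom.map_lie, ← LieModuleHom.map_lie, ← hR, ← map_add, h.right]
  sub x m := by
    obtain ⟨m, rfl⟩ := hφ m
    rw [← LieModuleHom.map_lie, ← hL, ← hR, ← map_sub, h.sub]
  left_poly := by
    obtain ⟨p, hp, hb⟩ := h.left_poly
    refine ⟨p, fun ψ => ?_, hb⟩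
    obtain ⟨ψ, rfl⟩ := postcomp_surjective s φ hφ ψ
    have h1 := aeval_tOp_natural (φ : X →ₗ[ℂ] Y) hL p ψ
    rw [hp, LinearMap.comp_zero] at h1
    exact h1.symm
  right_poly := by
    obtain ⟨p, hp, hb⟩ := h.right_poly
    refine ⟨p, fun ψ => ?_, hb⟩
    obtain ⟨ψ, rfl⟩ := postcomp_surjective s φ hφ ψ
    have h1 := aeval_tOp_natural (φ : X →ₗ[ℂ] Y) hR p ψ
    rw [hp, LinearMap.comp_zero] at h1
    exact h1.symm

end Transfer

section InnerPoly

universe u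

variable {s : Type u} [LieRing s] [LieAlgebra ℂ s] [FiniteDimensional ℂ s]
  [LieAlgebra.IsKilling ℂ s]
variable {B : Type u} [Ring B] [Algebra ℂ B] [LieRingModule s B] [LieModule ℂ s B]

/-- Polynomial relation for `tOp L` when the centralizer of `L` acts transitively on an invariant
vector. -/
lemma exists_aeval_tOp_eq_zero {L : s →ₗ[ℂ] Module.End ℂ B} (hL : IsEquivariant L)
    (hone : ∀ x : s, ⁅x, (1 : B)⁆ = 0)
    (hcomm : ∀ b : B, ∃ r : Module.End ℂ B, r 1 = b ∧ ∀ x m, r (L x m) = L x (r m))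
    (hadm : IsAdm s (s →ₗ[ℂ] B)) :
    ∃ q : Polynomial ℂ, q ≠ 0 ∧ ∀ φ : s →ₗ[ℂ] B, Polynomial.aeval (tOp L) q φ = 0 := by
  have hfd := hadm s
  let w₀ : s →ₗ⁅ℂ, s⁆ (s →ₗ[ℂ] B) :=
    { toFun := fun y => (killingForm ℂ s y).smulRight 1
      map_add' := fun a c => by ext; simp [add_smul]
      map_smul' := fun c a => by ext; simp [mul_smul]
      map_lie' := fun {x y} => by
        ext v
        rw [LieHom.lie_apply]
        simp only [LinearMap.smulRight_apply, lie_smul, hone, smul_zero, zero_sub]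
        rw [← lie_skew, map_neg, LinearMap.neg_apply, killingForm_lie, neg_smul] }
  let T := compEnd s (tHom L hL)
  refine ⟨T.charpoly, T.charpoly_monic.ne_zero, fun φ => ?_⟩
  have haev : ∀ (p : Polynomial ℂ) (w : s →ₗ⁅ℂ, s⁆ (s →ₗ[ℂ] B)) (y : s),
      (Polynomial.aeval T p w) y = Polynomial.aeval (tOp L) p (w y) := by
    intro p
    induction p using Polynomial.induction_on with
    | C a => intro w y; simp [Polynomial.aeval_C, Module.algebraMap_end_apply]
    | add p q hp hq => intro w y; simp [hp, hq]
    | monomial n a ih =>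
      intro w y
      rw [pow_succ, ← mul_assoc, map_mul _ (_ * _) Polynomial.X, map_mul _ (_ * _) Polynomial.X,
        Module.End.mul_apply, Module.End.mul_apply, ih, Polynomial.aeval_X, Polynomial.aeval_X]
      rfl
  have h0 : ∀ y, Polynomial.aeval (tOp L) T.charpoly (w₀ y) = 0 := by
    intro y
    rw [← haev, LinearMap.aeval_self_charpoly]
    rfl
  choose r hr1 hr using hcomm
  have hφ : φ = ∑ i, r (φ (bas s i)) ∘ₗ w₀ (dbas s i) := by
    refine (bas s).ext fun j => ?_
    rw [LinearMap.sum_apply]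
    have : ∀ i, (r (φ (bas s i)) ∘ₗ w₀ (dbas s i)) (bas s j) =
        if j = i then φ (bas s i) else 0 := by
      intro i
      change r _ (killingForm ℂ s (dbas s i) (bas s j) • (1 : B)) = _
      rw [map_smul, hr1, killingForm_dbas_bas, ite_smul, one_smul, zero_smul]
    simp [this]
  rw [hφ, map_sum]
  refine Finset.sum_eq_zero fun i _ => ?_
  rw [← aeval_tOp_natural _ (hr _), h0, LinearMap.comp_zero]

variable {ρ : s →ₗ[ℂ] B}

/-- Left multiplications. -/
def lmul (ρ : s →ₗ[ℂ] B) : s →ₗ[ℂ] Module.End ℂ B := LinearMap.mul ℂ B ∘ₗ ρ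

/-- Right multiplications. -/
def rmul (ρ : s →ₗ[ℂ] B) : s →ₗ[ℂ] Module.End ℂ B := (LinearMap.mul ℂ B).flip ∘ₗ ρ

@[simp] lemma lmul_apply (x : s) (b : B) : lmul ρ x b = ρ x * b := rfl

@[simp] lemma rmul_apply (x : s) (b : B) : rmul ρ x b = b * ρ x := rfl

lemma IsInner.exists_isBoundedBimodule (hρ : IsInner ρ) [IsNoetherianRing B]
    [FiniteDimensional ℂ (Subalgebra.center ℂ B)] :
    ∃ b : ℝ, 0 ≤ b ∧ IsBoundedBimodule B (lmul ρ) (rmul ρ) b := by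
  have hadm : IsAdm s (s →ₗ[ℂ] B) := hρ.isAdm.hom s
  have hl : IsEquivariant (lmul ρ) := fun x y m => by
    simp only [lmul_apply, hρ.lie_eq, hρ.map_lie]; noncomm_ring
  have hr : IsEquivariant (rmul ρ) := fun x y m => by
    simp only [rmul_apply, hρ.lie_eq, hρ.map_lie]; noncomm_ring
  obtain ⟨p, hp0, hp⟩ := exists_aeval_tOp_eq_zero hl hρ.lie_one
    (fun b => ⟨LinearMap.mulRight ℂ b, by simp, fun x m => by simp [mul_assoc]⟩) hadm
  obtain ⟨q, hq0, hq⟩ := exists_aeval_tOp_eq_zero hr hρ.lie_one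
    (fun b => ⟨LinearMap.mulLeft ℂ b, by simp, fun x m => by simp [mul_assoc]⟩) hadm
  have hbd : ∀ p : Polynomial ℂ, p ≠ 0 → ∃ b : ℝ, 0 ≤ b ∧ ∀ c, p.IsRoot c → |c.re| ≤ b := by
    intro p hp
    refine ⟨∑ c ∈ p.roots.toFinset, |c.re|, Finset.sum_nonneg fun _ _ => abs_nonneg _,
      fun c hc => ?_⟩
    exact Finset.single_le_sum (f := fun c : ℂ => |c.re|) (fun _ _ => abs_nonneg _)
      (by rw [Multiset.mem_toFinset, Polynomial.mem_roots hp]; exact hc)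
  obtain ⟨b₁, hb₁, h₁⟩ := hbd p hp0
  obtain ⟨b₂, hb₂, h₂⟩ := hbd q hq0
  refine ⟨b₁ + b₂, add_nonneg hb₁ hb₂, hρ.isLF, hadm, hl, hr, hρ.lie_eq, ⟨p, hp, ?_⟩, ⟨q, hq, ?_⟩⟩
  · intro c hc
    have := (abs_le.mp (h₁ c hc)).1
    linarith
  · intro c hc
    have := (abs_le.mp (h₂ c hc)).2
    linarith

end InnerPoly

section Strict

universe u

variable {s : Type u} [LieRing s] [LieAlgebra ℂ s] [FiniteDimensional ℂ s]
  [LieAlgebra.IsKilling ℂ s]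
variable {B : Type u} [Ring B] [Algebra ℂ B] [LieRingModule s B] [LieModule ℂ s B]
variable {ρ : s →ₗ[ℂ] B} (hρ : IsInner ρ)

/-- A two-sided ideal as a Lie submodule. -/
def IsInner.lieIdeal (hρ : IsInner ρ) (K : Ideal B) (hK : K.IsTwoSided) : LieSubmodule ℂ s B where
  toSubmodule := K.restrictScalars ℂ
  lie_mem := by
    intro x m hm
    change ⁅x, m⁆ ∈ K
    rw [hρ.lie_eq]
    exact K.sub_mem (K.mul_mem_left _ hm) (K.mul_mem_right _ hm)

lemma casPoly_mem {M : Type*} [AddCommGroup M] [Module ℂ M] [LieRingModule s M] [LieModule ℂ s M]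
    (N : LieSubmodule ℂ s M) (p : Polynomial ℂ) {m : M} (hm : m ∈ N) : casPoly s M p m ∈ N := by
  have := map_casPoly N.incl p ⟨m, hm⟩
  rw [LieSubmodule.incl_apply] at this
  exact this ▸ (casPoly s N p ⟨m, hm⟩).2

lemma exists_casPoly_eq_zero {M : Type*} [AddCommGroup M] [Module ℂ M] [LieRingModule s M]
    [LieModule ℂ s M] (hLF : IsLF s M) (m : M) :
    ∃ p : Polynomial ℂ, p ≠ 0 ∧ casPoly s M p m = 0 := by
  obtain ⟨P, hP, hm⟩ := hLF m
  let C : Module.End ℂ P := casimir s P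
  refine ⟨C.charpoly, C.charpoly_monic.ne_zero, ?_⟩
  have h1 := map_casPoly P.incl C.charpoly ⟨m, hm⟩
  have h2 : casPoly s P C.charpoly = 0 := LinearMap.aeval_self_charpoly C
  rw [h2] at h1
  exact h1.symm

/-- Generalized eigenvectors lift along surjections. -/
lemma exists_lift_mem_lowPart {M N : Type u} [AddCommGroup M] [Module ℂ M] [LieRingModule s M]
    [LieModule ℂ s M] [AddCommGroup N] [Module ℂ N] [LieRingModule s N] [LieModule ℂ s N]
    (hLF : IsLF s M) (φ : M →ₗ⁅ℂ, s⁆ N) {c : ℂ} {r : ℝ} (hc : c.re ≤ r) {P : LieSubmodule ℂ s M}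
    {m : M} (hm : m ∈ P) (hm0 : φ m ≠ 0) (hmc : casimir s N (φ m) = c • φ m) :
    ∃ y ∈ P, y ∈ lowPart s M r ∧ φ y ≠ 0 := by
  obtain ⟨p, hp, hpm⟩ := exists_casPoly_eq_zero hLF m
  obtain ⟨q, hq, hqc⟩ := Polynomial.exists_eq_pow_rootMultiplicity_mul_and_not_dvd p hp c
  refine ⟨casPoly s M q m, casPoly_mem P q hm, ?_, ?_⟩
  · refine ⟨(Polynomial.X - Polynomial.C c) ^ p.rootMultiplicity c,
      pow_ne_zero _ (Polynomial.X_sub_C_ne_zero c), fun d hd => ?_, ?_⟩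
    · have h1 : d - c = 0 := by
        have := hd.eq_zero
        rw [Polynomial.eval_pow] at this
        simpa using eq_zero_of_pow_eq_zero this
      rw [sub_eq_zero.mp h1]; exact hc
    · rw [← casPoly_mul, ← hq, hpm]
  · rw [map_casPoly, casPoly_of_casimir_eq_smul hmc]
    refine smul_ne_zero (fun h0 => hqc ?_) hm0
    rwa [Polynomial.dvd_iff_isRoot]

theorem IsInner.exists_lowPart_lt (hρ : IsInner ρ) [IsNoetherianRing B]
    [FiniteDimensional ℂ (Subalgebra.center ℂ B)] :
    ∃ r : ℝ, ∀ (K K' : Ideal B), K.IsTwoSided → K'.IsTwoSided → K' < K →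
      ∃ y ∈ K, y ∈ lowPart s B r ∧ y ∉ K' := by
  obtain ⟨b, hb, hB⟩ := hρ.exists_isBoundedBimodule
  obtain ⟨r, hr⟩ := exists_isCasEig_bound s b hb
  refine ⟨r, fun K K' hK hK' hlt => ?_⟩
  let N := hρ.lieIdeal K' hK'
  let π := LieSubmodule.Quotient.mk' N
  have hπ : Function.Surjective π := LieSubmodule.Quotient.surjective_mk' N
  have hπ0 : ∀ m : B, π m = 0 ↔ m ∈ K' := fun m => LieSubmodule.Quotient.mk_eq_zero N
  have hlN : ∀ a : B, N.toSubmodule ≤ N.toSubmodule.comap (LinearMap.mul ℂ B a) :=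
    fun a m hm => K'.mul_mem_left a hm
  have hrN : ∀ a : B, N.toSubmodule ≤ N.toSubmodule.comap ((LinearMap.mul ℂ B).flip a) :=
    fun a m hm => K'.mul_mem_right a hm
  let L' : s →ₗ[ℂ] Module.End ℂ (B ⧸ N) :=
    { toFun := fun x => N.toSubmodule.mapQ N.toSubmodule (lmul ρ x) (hlN (ρ x))
      map_add' := fun x y => by
        refine LinearMap.ext fun m => ?_
        obtain ⟨m, rfl⟩ := hπ m
        exact congrArg π (by simp : lmul ρ (x + y) m = lmul ρ x m + lmul ρ y m)
      map_smul' := fun c x => by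
        refine LinearMap.ext fun m => ?_
        obtain ⟨m, rfl⟩ := hπ m
        exact congrArg π (by simp : lmul ρ (c • x) m = c • lmul ρ x m) }
  let R' : s →ₗ[ℂ] Module.End ℂ (B ⧸ N) :=
    { toFun := fun x => N.toSubmodule.mapQ N.toSubmodule (rmul ρ x) (hrN (ρ x))
      map_add' := fun x y => by
        refine LinearMap.ext fun m => ?_
        obtain ⟨m, rfl⟩ := hπ m
        exact congrArg π (by simp : rmul ρ (x + y) m = rmul ρ x m + rmul ρ y m)
      map_smul' := fun c x => by
        refine LinearMap.ext fun m => ?_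
        obtain ⟨m, rfl⟩ := hπ m
        exact congrArg π (by simp : rmul ρ (c • x) m = c • rmul ρ x m) }
  have hL' : ∀ x m, π (lmul ρ x m) = L' x (π m) := fun x m => rfl
  have hR' : ∀ x m, π (rmul ρ x m) = R' x (π m) := fun x m => rfl
  have hQ : IsBoundedBimodule (B ⧸ N) L' R' b := hB.of_surjective π hπ hL' hR'
  let X : LieSubmodule ℂ s (B ⧸ N) := (hρ.lieIdeal K hK).map π
  have hX : ∀ m, m ∈ X ↔ ∃ k ∈ K, π k = m := fun m => Iff.rfl
  have hXL : ∀ x, ∀ m ∈ X.toSubmodule, L' x m ∈ X.toSubmodule := by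
    rintro x _ ⟨k, hk, rfl⟩
    exact ⟨ρ x * k, K.mul_mem_left _ hk, rfl⟩
  have hXR : ∀ x, ∀ m ∈ X.toSubmodule, R' x m ∈ X.toSubmodule := by
    rintro x _ ⟨k, hk, rfl⟩
    exact ⟨k * ρ x, K.mul_mem_right _ hk, rfl⟩
  let L'' : s →ₗ[ℂ] Module.End ℂ X :=
    { toFun := fun x => (L' x).restrict (hXL x)
      map_add' := fun x y => by ext m; simp
      map_smul' := fun c x => by ext m; simp }
  let R'' : s →ₗ[ℂ] Module.End ℂ X :=
    { toFun := fun x => (R' x).restrict (hXR x)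
      map_add' := fun x y => by ext m; simp
      map_smul' := fun c x => by ext m; simp }
  have hXB : IsBoundedBimodule X L'' R'' b := hQ.of_injective X.incl X.injective_incl
    (fun x m => rfl) (fun x m => rfl)
  obtain ⟨k, hkK, hkK'⟩ := SetLike.exists_of_lt hlt
  have hnt : Nontrivial X := ⟨⟨π k, (hX _).mpr ⟨k, hkK, rfl⟩⟩, 0, fun h0 =>
    hkK' ((hπ0 k).mp (congrArg Subtype.val h0))⟩
  obtain ⟨c, ⟨⟨_, x, hx, rfl⟩, hx0, hxc⟩, hcr⟩ := hr X L'' R'' hXB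
  have hxc' : casimir s (B ⧸ N) (π x) = c • π x := by
    have := congrArg X.incl hxc
    rwa [map_casimir] at this
  obtain ⟨y, hyK, hy, hy0⟩ := exists_lift_mem_lowPart hρ.isLF π hcr hx
    (fun h0 => hx0 (Subtype.ext h0)) hxc'
  exact ⟨y, hyK, hy, fun h0 => hy0 ((hπ0 y).mpr h0)⟩

end Strict

end CasimirBound

namespace CasimirBound

section Primitive

universe u

/-- A primitive ideal: the annihilator of a simple module. -/
def IsPrimitive {B : Type u} [Ring B] (J : Ideal B) : Prop :=
  ∃ (V : Type u) (_ : AddCommGroup V) (_ : Module B V),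
    IsSimpleModule B V ∧ J = Module.annihilator B V

/-- Between two consecutive two-sided ideals of a Noetherian ring, some primitive ideal kills the
subquotient. -/
lemma exists_isPrimitive_mul_mem {B : Type u} [Ring B] [IsNoetherianRing B] {K K' : Ideal B}
    (hK : K.IsTwoSided) (hK' : K'.IsTwoSided) (hlt : K' < K)
    (hmax : ∀ W : Ideal B, W.IsTwoSided → K' ≤ W → W < K → W = K') :
    ∃ J : Ideal B, IsPrimitive J ∧ ∀ u ∈ J, ∀ k ∈ K, u * k ∈ K' := by
  obtain ⟨Y, ⟨hKY, hYK⟩, hY⟩ := set_has_maximal_iff_noetherian.mpr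
    (inferInstance : IsNoetherian B B) {Y : Ideal B | K' ≤ Y ∧ Y < K} ⟨K', le_rfl, hlt⟩
  have hcov : Y ⋖ K := ⟨hYK, fun Z hYZ hZK => hY Z ⟨hKY.trans hYZ.le, hZK⟩ hYZ⟩
  have hsimple := (covBy_iff_quot_is_simple hYK.le).mp hcov
  refine ⟨_, ⟨_, _, _, hsimple, rfl⟩, ?_⟩
  have hann : ∀ u, u ∈ Module.annihilator B (K ⧸ Submodule.comap K.subtype Y) →
      ∀ k ∈ K, u * k ∈ Y := by
    intro u hu k hk
    have := Module.mem_annihilator.mp hu (Submodule.Quotient.mk ⟨k, hk⟩)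
    rw [← Submodule.Quotient.mk_smul, Submodule.Quotient.mk_eq_zero] at this
    exact this
  let J := Module.annihilator B (K ⧸ Submodule.comap K.subtype Y)
  let W : Ideal B := K' ⊔ J * K
  have hJK : J * K ≤ Y := Ideal.mul_le.mpr fun u hu k hk => hann u hu k hk
  have hWY : W ≤ Y := sup_le hKY hJK
  have hJK2 : (J * K).IsTwoSided := inferInstance
  have hW : W.IsTwoSided := ⟨fun b ha => by
    obtain ⟨p, hp, q, hq, rfl⟩ := Submodule.mem_sup.mp ha
    rw [add_mul]
    exact add_mem (le_sup_left (a := K') (K'.mul_mem_right b hp))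
      (le_sup_right (a := K') ((J * K).mul_mem_right b hq))⟩
  have hWK : W = K' := hmax W hW le_sup_left (hWY.trans_lt hYK)
  intro u hu k hk
  rw [← hWK]
  exact le_sup_right (a := K') (Ideal.mul_mem_mul hu hk)

variable {s : Type u} [LieRing s] [LieAlgebra ℂ s] [FiniteDimensional ℂ s]
  [LieAlgebra.IsKilling ℂ s]
variable {B : Type u} [Ring B] [Algebra ℂ B] [LieRingModule s B] [LieModule ℂ s B]
variable {ρ : s →ₗ[ℂ] B}

theorem IsInner.exists_isPrimitive_prod_eq_zero (hρ : IsInner ρ) [IsNoetherianRing B]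
    [FiniteDimensional ℂ (Subalgebra.center ℂ B)] :
    ∃ l : List (Ideal B), (∀ J ∈ l, IsPrimitive J) ∧
      ∀ xs : List B, List.Forall₂ (fun x J => x ∈ J) xs l → xs.prod = 0 := by
  obtain ⟨r, hr⟩ := hρ.exists_lowPart_lt
  have hfin := finiteDimensional_lowPart (s := s) (M := B) hρ.isLF hρ.isAdm r
  let low : Submodule ℂ B := (lowPart s B r).toSubmodule
  have hfin' : FiniteDimensional ℂ low := hfin
  have key : ∀ (n : ℕ) (K : Ideal B), K.IsTwoSided →
      Module.finrank ℂ (K.restrictScalars ℂ ⊓ low : Submodule ℂ B) = n →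
      ∃ l : List (Ideal B), (∀ J ∈ l, IsPrimitive J) ∧
        ∀ xs : List B, List.Forall₂ (fun x J => x ∈ J) xs l → ∀ k ∈ K, xs.prod * k = 0 := by
    intro n
    induction n using Nat.strong_induction_on with
    | _ n ih =>
    intro K hK hn
    by_cases hbot : K = ⊥
    · refine ⟨[], by simp, fun xs _ k hk => ?_⟩
      rw [hbot, Ideal.mem_bot] at hk
      rw [hk, mul_zero]
    obtain ⟨K', ⟨hK', hlt⟩, hmax⟩ := set_has_maximal_iff_noetherian.mpr
      (inferInstance : IsNoetherian B B) {K' : Ideal B | K'.IsTwoSided ∧ K' < K}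
      ⟨⊥, inferInstance, bot_lt_iff_ne_bot.mpr hbot⟩
    obtain ⟨J, hJ, hJK⟩ := exists_isPrimitive_mul_mem hK hK' hlt fun W hW hle hWK =>
      (eq_of_le_of_not_lt hle (hmax W ⟨hW, hWK⟩)).symm
    obtain ⟨y, hyK, hy, hyK'⟩ := hr K K' hK hK' hlt
    have hlt' : (K'.restrictScalars ℂ ⊓ low : Submodule ℂ B) < K.restrictScalars ℂ ⊓ low := by
      refine lt_of_le_of_ne (inf_le_inf_right _ fun a ha => hlt.le ha) fun h => hyK' ?_
      have : y ∈ (K'.restrictScalars ℂ ⊓ low : Submodule ℂ B) := h ▸ ⟨hyK, hy⟩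
      exact this.1
    have hfK : FiniteDimensional ℂ (K.restrictScalars ℂ ⊓ low : Submodule ℂ B) :=
      Submodule.finiteDimensional_of_le inf_le_right
    obtain ⟨l, hl, hprod⟩ := ih _ (hn ▸ Submodule.finrank_lt_finrank_of_lt hlt') K' hK' rfl
    refine ⟨l ++ [J], ?_, fun xs hxs k hk => ?_⟩
    · intro J' hJ'
      rcases List.mem_append.mp hJ' with h | h
      · exact hl _ h
      · rw [List.mem_singleton.mp h]; exact hJ
    · obtain ⟨xs₁, xs₂, h₁, h₂, rfl⟩ : ∃ xs₁ xs₂, List.Forall₂ (fun x J => x ∈ J) xs₁ l ∧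
          List.Forall₂ (fun x J => x ∈ J) xs₂ [J] ∧ xs = xs₁ ++ xs₂ :=
        ⟨xs.take l.length, xs.drop l.length, List.forall₂_take_append _ _ _ hxs,
          List.forall₂_drop_append _ _ _ hxs, (List.take_append_drop _ _).symm⟩
      obtain ⟨u, hu, rfl⟩ : ∃ u ∈ J, xs₂ = [u] := by
        rcases h₂ with _ | ⟨hu, h⟩
        rcases h
        exact ⟨_, hu, rfl⟩
      rw [List.prod_append, List.prod_singleton, mul_assoc]
      exact hprod _ h₁ _ (hJK u hu k hk)
  obtain ⟨l, hl, hprod⟩ := key _ ⊤ inferInstance rfl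
  exact ⟨l, hl, fun xs hxs => by simpa using hprod xs hxs 1 trivial⟩

end Primitive

end CasimirBound

namespace CasimirBound

section Quotient

universe u

variable {s : Type u} [LieRing s] [LieAlgebra ℂ s]

/-- The action of a Lie algebra on an associative algebra by commutators. -/
abbrev innerLieRingModule {B : Type u} [Ring B] [Algebra ℂ B] (ρ : s →ₗ[ℂ] B)
    (h : ∀ x y, ρ ⁅x, y⁆ = ρ x * ρ y - ρ y * ρ x) : LieRingModule s B where
  bracket x b := ρ x * b - b * ρ x
  add_lie x y b := by
    change ρ (x + y) * b - b * ρ (x + y) = (ρ x * b - b * ρ x) + (ρ y * b - b * ρ y)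
    rw [map_add]; noncomm_ring
  lie_add x a b := by
    change ρ x * (a + b) - (a + b) * ρ x = (ρ x * a - a * ρ x) + (ρ x * b - b * ρ x)
    noncomm_ring
  leibniz_lie x y b := by
    change ρ x * (ρ y * b - b * ρ y) - (ρ y * b - b * ρ y) * ρ x =
      (ρ ⁅x, y⁆ * b - b * ρ ⁅x, y⁆) + (ρ y * (ρ x * b - b * ρ x) - (ρ x * b - b * ρ x) * ρ y)
    rw [h]; noncomm_ring

lemma innerLieModule {B : Type u} [Ring B] [Algebra ℂ B] (ρ : s →ₗ[ℂ] B)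
    (h : ∀ x y, ρ ⁅x, y⁆ = ρ x * ρ y - ρ y * ρ x) :
    letI := innerLieRingModule ρ h
    LieModule ℂ s B :=
  letI := innerLieRingModule ρ h
  { smul_lie := fun c x b => by
      change ρ (c • x) * b - b * ρ (c • x) = c • (ρ x * b - b * ρ x)
      rw [map_smul, smul_mul_assoc, mul_smul_comm, smul_sub]
    lie_smul := fun c x b => by
      change ρ x * (c • b) - (c • b) * ρ x = c • (ρ x * b - b * ρ x)
      rw [smul_mul_assoc, mul_smul_comm, smul_sub] }

lemma IsPrimitive.comap {A B : Type u} [Ring A] [Ring B] (π : A →+* B)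
    (hπ : Function.Surjective π) {J : Ideal B} (hJ : IsPrimitive J) :
    IsPrimitive (J.comap π) := by
  obtain ⟨V, _, _, hV, rfl⟩ := hJ
  let _ : Module A V := Module.compHom V π
  have : RingHomSurjective π := ⟨hπ⟩
  let l : V →ₛₗ[π] V := { toFun := id, map_add' := fun _ _ => rfl, map_smul' := fun _ _ => rfl }
  refine ⟨V, inferInstance, inferInstance,
    (LinearMap.isSimpleModule_iff_of_bijective l Function.bijective_id).mpr hV, ?_⟩
  ext u
  rw [Ideal.mem_comap, Module.mem_annihilator, Module.mem_annihilator]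
  rfl

variable [FiniteDimensional ℂ s] [LieAlgebra.IsKilling ℂ s]

/-- Finite products of primitive ideals inside a two-sided ideal of finite central codimension. -/
theorem exists_isPrimitive_prod_mem {A : Type u} [Ring A] [Algebra ℂ A] [IsNoetherianRing A]
    (ρ : s →ₗ[ℂ] A) (hlie : ∀ x y, ρ ⁅x, y⁆ = ρ x * ρ y - ρ y * ρ x)
    (hadj : Algebra.adjoin ℂ (Set.range ρ ∪ Subalgebra.center ℂ A) = ⊤)
    (I : TwoSidedIdeal A) (t : Finset A)
    (ht : ∀ z ∈ Subalgebra.center ℂ A, ∃ w ∈ Submodule.span ℂ (t : Set A), z - w ∈ I) :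
    ∃ l : List (Ideal A), (∀ J ∈ l, IsPrimitive J) ∧ (∀ J ∈ l, ∀ a ∈ I, a ∈ J) ∧
      ∀ xs : List A, List.Forall₂ (fun x J => x ∈ J) xs l → xs.prod ∈ I := by
  let B := I.ringCon.Quotient
  let π : A →ₐ[ℂ] B := I.ringCon.mkₐ ℂ
  have hπ : Function.Surjective π := I.ringCon.mkₐ_surjective
  have hπ0 : ∀ a, π a = 0 ↔ a ∈ I := fun a => RingCon.eq I.ringCon
  let ρB : s →ₗ[ℂ] B := π.toLinearMap ∘ₗ ρ
  have hlieB : ∀ x y, ρB ⁅x, y⁆ = ρB x * ρB y - ρB y * ρB x := fun x y => by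
    simp [ρB, hlie]
  let _ : LieRingModule s A := innerLieRingModule ρ hlie
  let _ : LieModule ℂ s A := innerLieModule ρ hlie
  let _ : LieRingModule s B := innerLieRingModule ρB hlieB
  let _ : LieModule ℂ s B := innerLieModule ρB hlieB
  have hA : IsInner ρ := ⟨fun _ _ => rfl, hlie, hadj⟩
  have hcen : ∀ z ∈ Subalgebra.center ℂ A, π z ∈ Subalgebra.center ℂ B := by
    intro z hz
    rw [Subalgebra.mem_center_iff]
    intro b
    obtain ⟨a, rfl⟩ := hπ b
    rw [← map_mul, ← map_mul, Subalgebra.mem_center_iff.mp hz]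
  have hB : IsInner ρB := by
    refine ⟨fun _ _ => rfl, hlieB, top_le_iff.mp ?_⟩
    have h1 : (⊤ : Subalgebra ℂ A).map π = ⊤ := by
      rw [Algebra.map_top, (AlgHom.range_eq_top π).mpr hπ]
    rw [← h1, ← hadj, AlgHom.map_adjoin]
    refine Algebra.adjoin_mono ?_
    rintro _ ⟨a, ⟨x, rfl⟩ | ha, rfl⟩
    · exact Or.inl ⟨x, rfl⟩
    · exact Or.inr (hcen a ha)
  have : IsNoetherianRing B := isNoetherianRing_of_surjective A B π.toRingHom hπ
  let F : A →ₗ⁅ℂ, s⁆ B :=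
    { π.toLinearMap with
      map_lie' := fun {x a} => by
        change π (ρ x * a - a * ρ x) = π (ρ x) * π a - π a * π (ρ x)
        rw [map_sub, map_mul, map_mul] }
  have hfd : FiniteDimensional ℂ (Subalgebra.center ℂ B) := by
    have hle : (Subalgebra.center ℂ B).toSubmodule ≤
        (Submodule.span ℂ (t : Set A)).map π.toLinearMap := by
      intro b hb
      obtain ⟨z, hz, hzb⟩ := exists_invariant_lift (s := s) hA.isLF F hπ
        (n := b) (fun x => hB.lie_center hb x)
      obtain ⟨w, hw, hzw⟩ := ht z (hA.mem_center hz)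
      refine ⟨w, hw, ?_⟩
      have h2 := (hπ0 _).mpr hzw
      rw [map_sub, sub_eq_zero] at h2
      exact h2.symm.trans hzb
    have : FiniteDimensional ℂ (Submodule.span ℂ (t : Set A)) :=
      FiniteDimensional.span_finset ℂ t
    exact Submodule.finiteDimensional_of_le hle
  obtain ⟨l, hl, hprod⟩ := hB.exists_isPrimitive_prod_eq_zero
  refine ⟨l.map (Ideal.comap π.toRingHom), ?_, ?_, ?_⟩
  · intro J hJ
    obtain ⟨J', hJ', rfl⟩ := List.mem_map.mp hJ
    exact (hl J' hJ').comap π.toRingHom hπ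
  · intro J hJ a ha
    obtain ⟨J', hJ', rfl⟩ := List.mem_map.mp hJ
    rw [Ideal.mem_comap]
    change π a ∈ J'
    rw [(hπ0 a).mpr ha]
    exact J'.zero_mem
  · intro xs hxs
    rw [← hπ0, map_list_prod]
    refine hprod _ ?_
    rw [List.forall₂_map_right_iff] at hxs
    rw [List.forall₂_map_left_iff]
    exact hxs

end Quotient

end CasimirBound

namespace CasimirBound

section Reductive

universe u

open LieAlgebra

attribute [local instance] LieRing.ofAssociativeRing

variable {g : Type u} [LieRing g] [LieAlgebra ℂ g]

lemma ad_eq_zero_iff (a : g) : ad ℂ g a = 0 ↔ a ∈ center ℂ g := by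
  rw [← LieHom.mem_ker, LieAlgebra.ad_ker_eq_self_module_ker, LieAlgebra.self_module_ker_eq_center]

variable [FiniteDimensional ℂ g]

/-- The adjoint image of a reductive Lie algebra has trivial radical. -/
lemma hasTrivialRadical_range_ad (hred : radical ℂ g = center ℂ g) :
    HasTrivialRadical ℂ (ad ℂ g).range := by
  rw [hasTrivialRadical_iff_no_abelian_ideals]
  intro I hI
  let φ := (ad ℂ g).rangeRestrict
  have hφ : Function.Surjective φ := (ad ℂ g).surjective_rangeRestrict
  have hφ0 : ∀ a, φ a = 0 ↔ a ∈ center ℂ g := fun a => by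
    rw [← ad_eq_zero_iff, Subtype.ext_iff]; rfl
  let P : LieIdeal ℂ g := I.comap φ
  have h1 : ⁅P, P⁆ ≤ center ℂ g := by
    rw [LieSubmodule.lie_le_iff]
    intro x hx y hy
    rw [← hφ0, LieHom.map_lie]
    have := hI.trivial ⟨φ x, LieIdeal.mem_comap.mp hx⟩ ⟨φ y, LieIdeal.mem_comap.mp hy⟩
    exact congrArg Subtype.val this
  have h2 : derivedSeriesOfIdeal ℂ g 2 P = ⊥ := by
    change ⁅⁅P, P⁆, ⁅P, P⁆⁆ = ⊥
    rw [eq_bot_iff, LieSubmodule.lie_le_iff]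
    intro x _ y hy
    rw [LieSubmodule.mem_bot]
    exact (LieModule.mem_maxTrivSubmodule ℂ g g y).mp (h1 hy) x
  have h3 : IsSolvable P := IsSolvable.mk (R := ℂ) (k := 2)
    ((LieIdeal.derivedSeries_eq_bot_iff P 2).mpr h2)
  have h4 : P ≤ center ℂ g := hred ▸ (LieIdeal.solvable_iff_le_radical ℂ g P).mp h3
  rw [eq_bot_iff]
  intro y hy
  obtain ⟨x, rfl⟩ := hφ y
  rw [LieSubmodule.mem_bot, hφ0]
  exact h4 (LieIdeal.mem_comap.mpr hy)

/-- A reductive Lie algebra is the sum of its center and a semisimple subalgebra. -/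
theorem exists_isKilling_add_center (hred : radical ℂ g = center ℂ g) :
    ∃ (s : Type u) (_ : LieRing s) (_ : LieAlgebra ℂ s), FiniteDimensional ℂ s ∧ IsKilling ℂ s ∧
      ∃ j : s →ₗ⁅ℂ⁆ g, ∀ a : g, ∃ x : s, a - j x ∈ center ℂ g := by
  let s := (ad ℂ g).range
  have := hasTrivialRadical_range_ad hred
  have hK : IsKilling ℂ s := HasTrivialRadical.instIsKilling ℂ s
  let φ : g →ₗ⁅ℂ, s⁆ s :=
    { ((ad ℂ g).rangeRestrict : g →ₗ[ℂ] s) with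
      map_lie' := fun {x a} => by
        obtain ⟨x, y, rfl⟩ := x
        exact (ad ℂ g).rangeRestrict.map_lie y a }
  have hφ : Function.Surjective φ := (ad ℂ g).surjective_rangeRestrict
  obtain ⟨v, hv⟩ := exists_equivariant_lift (isLF_of_finiteDimensional (s := s) (M := g)) φ hφ
    (LieModuleHom.id : s →ₗ⁅ℂ, s⁆ s)
  have hv' : ∀ x : s, φ (v x) = x := fun x => LieModuleHom.congr_fun hv x
  refine ⟨s, inferInstance, inferInstance, inferInstance, hK,
    { (v : s →ₗ[ℂ] g) with map_lie' := fun {x y} => ?_ }, fun a => ⟨φ a, ?_⟩⟩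
  · have h1 : v ⁅x, y⁆ = ⁅x, v y⁆ := v.map_lie x y
    have h2 : ⁅x, v y⁆ = ⁅v x, v y⁆ :=
      LinearMap.congr_fun (congrArg Subtype.val (hv' x)).symm (v y)
    exact h1.trans h2
  · rw [← ad_eq_zero_iff]
    change ad ℂ g (a - v (φ a)) = 0
    rw [map_sub, sub_eq_zero]
    exact (congrArg Subtype.val (hv' (φ a))).symm

end Reductive

section Enveloping

universe u

open LieAlgebra

attribute [local instance] LieRing.ofAssociativeRing

variable {g : Type u} [LieRing g] [LieAlgebra ℂ g]

local notation "U" => UniversalEnvelopingAlgebra ℂ g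

local notation "ι" => UniversalEnvelopingAlgebra.ι ℂ (L := g)

lemma ι_lie (a b : g) : ι ⁅a, b⁆ = ι a * ι b - ι b * ι a := by
  rw [LieHom.map_lie, LieRing.of_associative_ring_bracket]

lemma adjoin_range_ι : Algebra.adjoin ℂ (Set.range (ι : g → U)) = ⊤ := by
  let S := Algebra.adjoin ℂ (Set.range (ι : g → U))
  let f : g →ₗ⁅ℂ⁆ S :=
    { toFun := fun a => ⟨ι a, Algebra.subset_adjoin ⟨a, rfl⟩⟩
      map_add' := fun a b => Subtype.ext (map_add _ a b)
      map_smul' := fun c a => Subtype.ext (map_smul _ c a)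
      map_lie' := fun {a b} => Subtype.ext (ι_lie a b) }
  have h : S.val.comp (UniversalEnvelopingAlgebra.lift ℂ f) = AlgHom.id ℂ U := by
    refine UniversalEnvelopingAlgebra.hom_ext ℂ (LieHom.ext fun a => ?_)
    change ((UniversalEnvelopingAlgebra.lift ℂ f (ι a) : S) : U) = ι a
    rw [UniversalEnvelopingAlgebra.lift_ι_apply]
    rfl
  rw [eq_top_iff]
  intro u _
  have hu : ((UniversalEnvelopingAlgebra.lift ℂ f u : S) : U) = u := AlgHom.congr_fun h u
  rw [← hu]
  exact (UniversalEnvelopingAlgebra.lift ℂ f u).2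

lemma ι_mem_center {a : g} (ha : a ∈ center ℂ g) : ι a ∈ Subalgebra.center ℂ U := by
  rw [Subalgebra.mem_center_iff]
  have h : (⊤ : Subalgebra ℂ U) ≤ Subalgebra.centralizer ℂ {ι a} := by
    rw [← adjoin_range_ι]
    refine Algebra.adjoin_le ?_
    rintro _ ⟨b, rfl⟩
    rw [SetLike.mem_coe, Subalgebra.mem_centralizer_iff]
    rintro _ rfl
    have h1 := ι_lie b a
    rw [(LieModule.mem_maxTrivSubmodule ℂ g g a).mp ha b, map_zero] at h1
    exact (sub_eq_zero.mp h1.symm).symm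
  intro b
  exact ((Subalgebra.mem_centralizer_iff ℂ).mp (h (Algebra.mem_top : b ∈ ⊤)) _ rfl).symm

lemma isNoetherianRing_enveloping [FiniteDimensional ℂ g] : IsNoetherianRing U := by
  let b := Module.finBasis ℂ g
  have hspan : ∀ a : g, ι a ∈ Submodule.span ℂ (Set.range fun i => ι (b i)) := by
    intro a
    rw [← b.sum_repr a, map_sum]
    refine Submodule.sum_mem _ fun i _ => ?_
    rw [map_smul]
    exact Submodule.smul_mem _ _ (Submodule.subset_span ⟨i, rfl⟩)
  refine isNoetherianRing_of_commutator_mem (k := ℂ) (fun i => ι (b i)) (fun i j => ?_)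
    (top_le_iff.mp ?_)
  · rw [← ι_lie]
    exact le_sup_right (a := (1 : Submodule ℂ U)) (hspan _)
  · rw [← adjoin_range_ι]
    refine Algebra.adjoin_le ?_
    rintro _ ⟨a, rfl⟩
    exact Algebra.span_le_adjoin ℂ _ (hspan a)

/-- The enveloping algebra of a reductive Lie algebra is generated by its center and the image of
a semisimple Lie algebra. -/
theorem exists_isKilling_adjoin_eq_top [FiniteDimensional ℂ g] (hred : radical ℂ g = center ℂ g) :
    ∃ (s : Type u) (_ : LieRing s) (_ : LieAlgebra ℂ s), FiniteDimensional ℂ s ∧ IsKilling ℂ s ∧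
      ∃ ρ : s →ₗ[ℂ] U, (∀ x y, ρ ⁅x, y⁆ = ρ x * ρ y - ρ y * ρ x) ∧
        Algebra.adjoin ℂ (Set.range ρ ∪ Subalgebra.center ℂ U) = ⊤ := by
  obtain ⟨s, i₁, i₂, i₃, i₄, j, hj⟩ := exists_isKilling_add_center hred
  let ρ : s →ₗ[ℂ] U := ((ι).comp j : s →ₗ⁅ℂ⁆ U)
  have hρ : ∀ x, ρ x = ι (j x) := fun _ => rfl
  refine ⟨s, i₁, i₂, i₃, i₄, ρ, fun x y => by rw [hρ, LieHom.map_lie, ι_lie]; rfl, ?_⟩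
  rw [eq_top_iff, ← adjoin_range_ι]
  refine Algebra.adjoin_le ?_
  rintro _ ⟨a, rfl⟩
  obtain ⟨x, hx⟩ := hj a
  have h : ι a = ρ x + ι (a - j x) := by rw [hρ, ← map_add, add_sub_cancel]
  rw [h]
  exact add_mem (Algebra.subset_adjoin (Or.inl ⟨x, rfl⟩))
    (Algebra.subset_adjoin (Or.inr (ι_mem_center hx)))

end Enveloping

end CasimirBound

universe u

/-- Let `g` be a finite-dimensional reductive Lie algebra over `ℂ` (its solvable radical
equals its center), `U(g)` its universal enveloping algebra and `Z` the center of
`U(g)`.  Let `I` be a proper two-sided ideal of `U(g)` such that `I ∩ Z` has finite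
codimension in `Z` (there is a finite subset of `Z` whose `ℂ`-span together with `I`
covers `Z`).  Then there exist finitely many primitive two-sided ideals `J₁, …, J_n` of
`U(g)` — each the annihilator of some simple `U(g)`-module — all containing `I`, with
`J₁J₂⋯J_n ⊆ I`. -/
theorem stmt14 (g : Type u) [LieRing g] [LieAlgebra ℂ g] [FiniteDimensional ℂ g]
    (hred : LieAlgebra.radical ℂ g = LieAlgebra.center ℂ g)
    (I : TwoSidedIdeal (UniversalEnvelopingAlgebra ℂ g))
    (hproper : (1 : UniversalEnvelopingAlgebra ℂ g) ∉ I)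
    (hcodim : ∃ s : Finset (UniversalEnvelopingAlgebra ℂ g),
      (∀ x ∈ s, x ∈ Subalgebra.center ℂ (UniversalEnvelopingAlgebra ℂ g)) ∧
      ∀ z ∈ Subalgebra.center ℂ (UniversalEnvelopingAlgebra ℂ g),
        ∃ w ∈ Submodule.span ℂ (s : Set (UniversalEnvelopingAlgebra ℂ g)), z - w ∈ I) :
    ∃ (n : ℕ) (J : Fin n → TwoSidedIdeal (UniversalEnvelopingAlgebra ℂ g)),
      (∀ k, ∃ (V : Type u) (_ : AddCommGroup V)
          (_ : Module (UniversalEnvelopingAlgebra ℂ g) V),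
          IsSimpleModule (UniversalEnvelopingAlgebra ℂ g) V ∧
          ∀ u : UniversalEnvelopingAlgebra ℂ g, u ∈ J k ↔ ∀ v : V, u • v = 0) ∧
      (∀ k, I ≤ J k) ∧
      (∀ x : Fin n → UniversalEnvelopingAlgebra ℂ g,
        (∀ k, x k ∈ J k) → (List.ofFn x).prod ∈ I) := by
  obtain ⟨t, -, ht⟩ := hcodim
  obtain ⟨s, _, _, _, _, ρ, hlie, hadj⟩ := CasimirBound.exists_isKilling_adjoin_eq_top hred
  have := CasimirBound.isNoetherianRing_enveloping (g := g)
  obtain ⟨l, hl, hIl, hprod⟩ := CasimirBound.exists_isPrimitive_prod_mem ρ hlie hadj I t ht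
  have hprim : ∀ k : Fin l.length, CasimirBound.IsPrimitive (l.get k) :=
    fun k => hl _ (List.get_mem l k)
  choose V iV mV hV hann using hprim
  let J : Fin l.length → TwoSidedIdeal (UniversalEnvelopingAlgebra ℂ g) := fun k =>
    (Module.annihilator (UniversalEnvelopingAlgebra ℂ g) (V k)).toTwoSided
  have hJ : ∀ k u, u ∈ J k ↔ u ∈ l.get k := fun k u => by
    rw [hann k]; exact Ideal.mem_toTwoSided
  refine ⟨l.length, J, fun k => ⟨V k, iV k, mV k, hV k, fun u => ?_⟩, fun k a ha => ?_,
    fun x hx => hprod _ ?_⟩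
  · rw [hJ, hann k, Module.mem_annihilator]
  · exact (hJ k a).mpr (hIl _ (List.get_mem l k) a ha)
  · rw [List.forall₂_iff_get]
    refine ⟨List.length_ofFn, fun i h₁ h₂ => ?_⟩
    rw [List.get_ofFn]
    exact (hJ _ _).mp (hx ⟨i, h₂⟩)
end

section
/- Let B be a commutative integral domain of characteristic zero equipped with a Poisson bracket ⁅·,·⁆, and let A ⊆ B be a subring closed under the bracket such that every element of B is algebraic over A (each b ∈ B is a root of some nonzero polynomial with coefficients in A; this holds in particular when B is integral over A). If a ∈ A satisfies ⁅a, x⁆ = 0 for every x ∈ A, then ⁅a, b⁆ = 0 for every b ∈ B. In other words, the Poisson center of A is contained in the Poisson center of B. -/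
open Polynomial in
/-- A derivation of a domain of characteristic zero vanishes on the elements algebraic over
its ring of constants. -/
theorem Derivation.apply_eq_zero_of_isAlgebraic {R S : Type*} [CommRing R] [CommRing S]
    [IsDomain S] [CharZero S] [Algebra R S] [FaithfulSMul R S] (D : Derivation R S S) {b : S}
    (hb : IsAlgebraic R b) : D b = 0 := by
  have hinj : Function.Injective (algebraMap R S) := FaithfulSMul.algebraMap_injective R S
  have : IsDomain R := hinj.isDomain _
  have : CharZero R := (algebraMap R S).charZero
  by_contra hDb
  obtain ⟨p, hp, hpb⟩ := hb
  induction hn : p.natDegree using Nat.strong_induction_on generalizing p with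
  | _ n ih =>
    have hder : aeval b (derivative p) = 0 := by
      have h := D.map_aeval p b
      rw [hpb, map_zero, smul_eq_mul] at h
      exact (mul_eq_zero.mp h.symm).resolve_right hDb
    by_cases hdeg : p.natDegree = 0
    · rw [eq_C_of_natDegree_eq_zero hdeg, aeval_C] at hpb
      refine hp ?_
      rw [eq_C_of_natDegree_eq_zero hdeg, (map_eq_zero_iff _ hinj).mp hpb, C_0]
    · exact ih _ (hn ▸ natDegree_derivative_lt hdeg) (derivative p)
        (fun h => hdeg (derivative_eq_zero.mp h)) hder rfl

/-- Let `B` be a commutative integral domain of characteristic zero with a Poisson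
bracket `br` (biadditive, alternating, Jacobi identity in Leibniz form, Leibniz rule),
and let `A ⊆ B` be a subring closed under the bracket such that every element of `B` is
algebraic over `A`.  If `a ∈ A` satisfies `⁅a, x⁆ = 0` for every `x ∈ A`, then
`⁅a, b⁆ = 0` for every `b ∈ B`: the Poisson center of `A` is contained in the Poisson
center of `B`. -/
theorem stmt16 (B : Type*) [CommRing B] [IsDomain B] [CharZero B] (br : B → B → B)
    (hadd_left : ∀ a b c : B, br (a + b) c = br a c + br b c)
    (hadd_right : ∀ a b c : B, br a (b + c) = br a b + br a c)
    (halt : ∀ a : B, br a a = 0)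
    (hjacobi : ∀ a b c : B, br a (br b c) = br (br a b) c + br b (br a c))
    (hleibniz : ∀ a b c : B, br a (b * c) = br a b * c + b * br a c)
    (A : Subring B)
    (hclosed : ∀ x ∈ A, ∀ y ∈ A, br x y ∈ A)
    (halg : ∀ b : B, ∃ (n : ℕ) (c : Fin (n + 1) → B),
      (∀ i, c i ∈ A) ∧ (∃ i, c i ≠ 0) ∧ ∑ i : Fin (n + 1), c i * b ^ (i : ℕ) = 0)
    (a : B) (ha : a ∈ A) (hcentral : ∀ x ∈ A, br a x = 0) :
    ∀ b : B, br a b = 0 := by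
  intro b
  let D : Derivation A B B := Derivation.mk'
    { toFun := br a
      map_add' := hadd_right a
      map_smul' := fun r x => by
        simp [Subring.smul_def, hleibniz, hcentral r r.2] }
    (fun x y => by
      change br a (x * y) = x * br a y + y * br a x
      rw [hleibniz]
      ring)
  refine D.apply_eq_zero_of_isAlgebraic (b := b) ?_
  obtain ⟨n, c, hcA, ⟨i, hi⟩, hsum⟩ := halg b
  refine ⟨∑ j : Fin (n + 1), Polynomial.monomial (j : ℕ) (⟨c j, hcA j⟩ : A), fun h => hi ?_, ?_⟩
  · have hcoeff := congrArg (fun p => ((p.coeff i : A) : B)) h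
    simpa [Polynomial.finsetSum_coeff, Polynomial.coeff_monomial, Fin.val_inj] using hcoeff
  · rw [map_sum, ← hsum]
    exact Finset.sum_congr rfl fun j _ => Polynomial.aeval_monomial ..
end

section
/- Let A be a unital ℂ-algebra of at most countable dimension over ℂ and let Z be a subalgebra contained in the center of A such that A is generated as a Z-module by k elements. Then every simple (left) A-module has ℂ-dimension at most k. -/
open Cardinal

universe u v

/-- A field extension whose degree is smaller than the cardinality of the base field is
algebraic. -/
theorem Algebra.IsAlgebraic.of_lift_rank_lt_mk {F : Type u} {E : Type v} [Field F] [Field E]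
    [Algebra F E] (h : lift.{u} (Module.rank F E) < lift.{v} #F) :
    Algebra.IsAlgebraic F E := by
  refine ⟨fun x => ?_⟩
  by_contra hx
  exact (Transcendental.linearIndependent_sub_inv hx).cardinal_lift_le_rank.not_gt h

section Schur

variable {F A V : Type*} [Field F] [Ring A] [Algebra F A] [AddCommGroup V] [Module F V]
  [Module A V] [IsScalarTower F A V] [IsSimpleModule A V]

/-- Evaluation at a nonzero vector embeds the endomorphism ring of a simple module. -/
theorem IsSimpleModule.rank_end_le : Module.rank F (Module.End A V) ≤ Module.rank F V := by
  have := IsSimpleModule.nontrivial A V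
  obtain ⟨v, hv⟩ := exists_ne (0 : V)
  let ev : Module.End A V →ₗ[F] V :=
    { toFun := fun f => f v, map_add' := fun _ _ => rfl, map_smul' := fun _ _ => rfl }
  refine LinearMap.rank_le_of_injective ev ((injective_iff_map_eq_zero ev).2 fun f hf => ?_)
  ext w
  obtain ⟨a, rfl⟩ := IsSimpleModule.toSpanSingleton_surjective A hv w
  have hfv : f v = 0 := hf
  simp [hfv]

theorem IsSimpleModule.rank_le_aleph0 (hA : Module.rank F A ≤ ℵ₀) : Module.rank F V ≤ ℵ₀ := by
  have := IsSimpleModule.nontrivial A V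
  obtain ⟨v, hv⟩ := exists_ne (0 : V)
  have h := LinearMap.lift_rank_le_of_surjective ((LinearMap.toSpanSingleton A V v).restrictScalars F)
    (IsSimpleModule.toSpanSingleton_surjective A hv)
  exact lift_le_aleph0.1 (h.trans (lift_le_aleph0.2 hA))

/-- **Schur's lemma** in countable dimension: central elements act on a simple module by
scalars. -/
theorem IsSimpleModule.exists_smul_eq_of_mem_center [IsAlgClosed F] (hF : ℵ₀ < #F)
    (hA : Module.rank F A ≤ ℵ₀) {z : A} (hz : z ∈ Subalgebra.center F A) :
    ∃ c : F, ∀ v : V, z • v = c • v := by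
  classical
  have hfield : IsField (Subalgebra.center F (Module.End A V)) :=
    (Subring.instField (K := Module.End A V)).toIsField
  let := hfield.toField
  have hrank : Module.rank F (Subalgebra.center F (Module.End A V)) ≤ ℵ₀ :=
    (Submodule.rank_le (Subalgebra.center F (Module.End A V)).toSubmodule).trans
      (rank_end_le.trans (rank_le_aleph0 hA))
  have : Algebra.IsAlgebraic F (Subalgebra.center F (Module.End A V)) :=
    .of_lift_rank_lt_mk ((lift_le_aleph0.2 hrank).trans_lt (aleph0_lt_lift.2 hF))
  let f : Module.End A V :=
    { toFun := fun v => z • v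
      map_add' := smul_add z
      map_smul' := fun a v => by
        simp [smul_smul, Subalgebra.mem_center_iff.1 hz a] }
  have hf : f ∈ Subalgebra.center F (Module.End A V) :=
    Subalgebra.mem_center_iff.2 fun e => LinearMap.ext fun v => e.map_smul z v
  obtain ⟨c, hc⟩ := (IsAlgClosed.algebraMap_bijective_of_isIntegral (k := F)
    (K := Subalgebra.center F (Module.End A V))).2 ⟨f, hf⟩
  exact ⟨c, fun v => (LinearMap.congr_fun (congrArg Subtype.val hc) v).symm⟩

end Schur


/-- Let `A` be a unital `ℂ`-algebra of at most countable dimension over `ℂ` and `Z` a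
central subalgebra of `A` such that `A` is generated as a `Z`-module by `k` elements
`g₁, …, g_k` (i.e. `A = Z·g₁ + ⋯ + Z·g_k`).  Then every simple left `A`-module has
`ℂ`-dimension at most `k`. -/
theorem stmt17 (A : Type*) [Ring A] [Algebra ℂ A]
    (hcount : Module.rank ℂ A ≤ Cardinal.aleph0)
    (Z : Subalgebra ℂ A) (hZ : ∀ z ∈ Z, ∀ x : A, z * x = x * z)
    (k : ℕ) (g : Fin k → A)
    (hgen : ∀ x : A, ∃ c : Fin k → A, (∀ i, c i ∈ Z) ∧ x = ∑ i : Fin k, c i * g i)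
    (V : Type*) [AddCommGroup V] [Module ℂ V] [Module A V] [IsScalarTower ℂ A V]
    [IsSimpleModule A V] :
    Module.rank ℂ V ≤ (k : Cardinal) := by
  have := IsSimpleModule.nontrivial A V
  obtain ⟨v, hv⟩ := exists_ne (0 : V)
  have hspan : Submodule.span ℂ (Set.range fun i => g i • v) = ⊤ := by
    refine eq_top_iff.2 fun w _ => ?_
    obtain ⟨a, rfl⟩ := IsSimpleModule.toSpanSingleton_surjective A hv w
    obtain ⟨c, hc, rfl⟩ := hgen a
    rw [LinearMap.toSpanSingleton_apply, Finset.sum_smul]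
    refine Submodule.sum_mem _ fun i _ => ?_
    have hci : c i ∈ Subalgebra.center ℂ A :=
      Subalgebra.mem_center_iff.2 fun x => (hZ _ (hc i) x).symm
    obtain ⟨t, ht⟩ := IsSimpleModule.exists_smul_eq_of_mem_center (V := V)
      (by rw [mk_complex]; exact aleph0_lt_continuum) hcount hci
    rw [mul_smul, ht]
    exact Submodule.smul_mem _ t (Submodule.subset_span ⟨i, rfl⟩)
  rw [← rank_top ℂ V, ← hspan]
  refine (rank_span_le _).trans ?_
  simpa using mk_range_le_lift (f := fun i => g i • v)
end
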